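/- arXiv:2203.11017 — 3 statements merged into one kernel-verified Lean document; each statement's English description precedes it below -/
import Mathlib

section
/- For every integer r ≥ 4 and all integers n₁, …, n_r ≥ 2, the Cayley digraph Cay(ℤ_{n₁} × ⋯ × ℤ_{n_r}; e₁, …, e_r) (the Cartesian product of r directed cycles of lengths n₁, …, n_r) has two arc-disjoint hamiltonian paths. -/
/-- The arc set of a path `v : Fin N → G`: the pairs `(v i, v (i+1))`. -/
def ArcSet {G : Type*} (N : ℕ) (v : Fin N → G) : Set (G × G) :=
  {p | ∃ (i : ℕ) (h : i + 1 < N), p = (v ⟨i, Nat.lt_of_succ_lt h⟩, v ⟨i + 1, h⟩)}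

/-- `v : Fin N → G` is a hamiltonian path of the Cayley digraph `Cay(G; S)`:
a bijection onto the vertex set `G` each of whose steps lies in `S`. -/
def IsHamPathOn {G : Type*} [AddCommGroup G] (S : Set G) (N : ℕ) (v : Fin N → G) : Prop :=
  Function.Bijective v ∧
    ∀ (i : ℕ) (h : i + 1 < N),
      v ⟨i + 1, h⟩ - v ⟨i, Nat.lt_of_succ_lt h⟩ ∈ S

/-- A self-map `f` describing a hamiltonian path of the digraph `R` that ends at `t`: every vertex
other than `t` is sent to its successor on the path. The value of `f` at `t` is irrelevant. -/
structure IsHamMap {V : Type*} (R : V → V → Prop) (f : V → V) (t : V) : Prop where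
  step : ∀ u, u ≠ t → R u (f u)
  inj : ∀ u v, u ≠ t → v ≠ t → f u = f v → u = v
  reach : ∀ u, ∃ k, f^[k] u = t

namespace IsHamMap

variable {V : Type*} {R : V → V → Prop} {f : V → V} {t : V}

open Classical in
/-- The number of steps from `u` to the end of the path. -/
noncomputable def depth (h : IsHamMap R f t) (u : V) : ℕ := Nat.find (h.reach u)

theorem depth_eq_zero (h : IsHamMap R f t) {u : V} : h.depth u = 0 ↔ u = t := by
  classical simp [depth, Nat.find_eq_zero]

theorem depth_eq_succ (h : IsHamMap R f t) {u : V} (hu : u ≠ t) :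
    h.depth u = h.depth (f u) + 1 := by
  classical
  have := Nat.find_comp_succ (h.reach u) (h.reach (f u)) (by simpa using hu)
  simpa [depth] using this

theorem induction (h : IsHamMap R f t) {P : V → Prop} (ht : P t)
    (hs : ∀ u, u ≠ t → P (f u) → P u) (u : V) : P u := by
  induction hd : h.depth u generalizing u with
  | zero => rwa [h.depth_eq_zero.1 hd]
  | succ k ih =>
    have hu : u ≠ t := fun e => by simp [h.depth_eq_zero.2 e] at hd
    exact hs u hu (ih _ (by have := h.depth_eq_succ hu; omega))

theorem depth_injective (h : IsHamMap R f t) : Function.Injective h.depth := by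
  intro u
  induction u using h.induction with
  | ht => exact fun v hv => (h.depth_eq_zero.1 (hv ▸ h.depth_eq_zero.2 rfl)).symm
  | hs u hu ih =>
    intro v hv
    have hv' : v ≠ t := by
      rintro rfl
      exact hu (h.depth_eq_zero.1 (hv.trans (h.depth_eq_zero.2 rfl)))
    exact h.inj _ _ hu hv' (ih (by
      have := h.depth_eq_succ hu; have := h.depth_eq_succ hv'; omega))

theorem exists_depth_eq (h : IsHamMap R f t) (u : V) : ∀ k ≤ h.depth u, ∃ w, h.depth w = k := by
  induction u using h.induction with
  | ht => exact fun k hk => ⟨t, by have := h.depth_eq_zero.2 rfl; omega⟩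
  | hs u hu ih =>
    intro k hk
    rcases hk.eq_or_lt with rfl | hk
    · exact ⟨u, rfl⟩
    · exact ih k (by have := h.depth_eq_succ hu; omega)

theorem depth_lt_card [Fintype V] (h : IsHamMap R f t) (u : V) : h.depth u < Fintype.card V := by
  choose w hw using fun k : Fin (h.depth u + 1) =>
    h.exists_depth_eq u k (Nat.lt_succ_iff.1 k.2)
  have hi : Function.Injective w := fun i j hij => Fin.ext (by rw [← hw i, ← hw j, hij])
  simpa using Fintype.card_le_of_injective w hi

/-- The path itself, as an enumeration of the vertices. -/
theorem exists_path [Fintype V] (h : IsHamMap R f t) {N : ℕ} (hN : Fintype.card V = N) :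
    ∃ v : Fin N → V, Function.Bijective v ∧ ∀ (i : ℕ) (hi : i + 1 < N),
      v ⟨i, Nat.lt_of_succ_lt hi⟩ ≠ t ∧
        v ⟨i + 1, hi⟩ = f (v ⟨i, Nat.lt_of_succ_lt hi⟩) := by
  subst hN
  let d : V → Fin (Fintype.card V) := fun u => ⟨h.depth u, h.depth_lt_card u⟩
  have hd : Function.Bijective d :=
    (Fintype.bijective_iff_injective_and_card d).2
      ⟨fun u v huv => h.depth_injective (congrArg Fin.val huv), by simp⟩
  let e := Equiv.ofBijective d hd
  have he : ∀ j, h.depth (e.symm j) = j := fun j => congrArg Fin.val (e.apply_symm_apply j)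
  refine ⟨fun i => e.symm i.rev, e.symm.bijective.comp Fin.rev_bijective, fun i hi => ?_⟩
  have hne : e.symm (Fin.rev ⟨i, Nat.lt_of_succ_lt hi⟩) ≠ t := fun hc => by
    have := he (Fin.rev ⟨i, Nat.lt_of_succ_lt hi⟩)
    rw [h.depth_eq_zero.2 hc, Fin.val_rev] at this
    simp only at this
    omega
  refine ⟨hne, h.depth_injective ?_⟩
  have h1 := h.depth_eq_succ hne
  simp only [he, Fin.val_rev] at h1 ⊢
  omega

theorem map {W : Type*} {R' : W → W → Prop} (h : IsHamMap R f t) (e : V ≃ W)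
    (he : ∀ u v, R u v → R' (e u) (e v)) :
    IsHamMap R' (fun w => e (f (e.symm w))) (e t) where
  step u hu := by
    simpa using he _ _ (h.step (e.symm u) (fun hc => hu (by simp [← hc])))
  inj u v hu hv huv :=
    e.symm.injective (h.inj _ _ (fun hc => hu (by simp [← hc])) (fun hc => hv (by simp [← hc]))
      (e.injective huv))
  reach u := by
    obtain ⟨k, hk⟩ := h.reach (e.symm u)
    have hs : Function.Semiconj e f (fun w => e (f (e.symm w))) := fun x => by simp
    refine ⟨k, ?_⟩
    rw [← hk, (hs.iterate_right k).eq, e.apply_symm_apply]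

end IsHamMap

/-- Adjacency in the cartesian product of two digraphs. -/
def ProdAdj {A L : Type*} (RA : A → A → Prop) (RL : L → L → Prop) (u v : A × L) : Prop :=
  (RA u.1 v.1 ∧ u.2 = v.2) ∨ (u.1 = v.1 ∧ RL u.2 v.2)

section Layers

variable {A L : Type*} {RA : A → A → Prop} {RL : L → L → Prop} {h : L → L} {z : L}

open Classical in
/-- Follow the path `F ℓ` in the layer `ℓ` up to its end `T ℓ`, then pass to the layer `h ℓ`. -/
noncomputable def layerMap (h : L → L) (F : L → A → A) (T : L → A) (u : A × L) : A × L :=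
  if u.1 = T u.2 then (u.1, h u.2) else (F u.2 u.1, u.2)

theorem IsHamMap.layerMap (hL : IsHamMap RL h z) {F : L → A → A} {T S : L → A}
    (hF : ∀ l, IsHamMap RA (F l) (T l)) (hS : ∀ l a, a ≠ T l → F l a ≠ S l)
    (hTS : ∀ l, l ≠ z → S (h l) = T l) :
    IsHamMap (ProdAdj RA RL) (layerMap h F T) (T z, z) where
  step := by
    rintro ⟨a, l⟩ hu
    unfold _root_.layerMap
    split_ifs with ha
    · refine Or.inr ⟨rfl, hL.step l ?_⟩
      rintro rfl
      exact hu (Prod.ext ha rfl)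
    · exact Or.inl ⟨(hF l).step a ha, rfl⟩
  inj := by
    rintro ⟨a, l⟩ ⟨b, k⟩ hu hv huv
    have hl : a = T l → l ≠ z := by rintro ha rfl; exact hu (Prod.ext ha rfl)
    have hk : b = T k → k ≠ z := by rintro hb rfl; exact hv (Prod.ext hb rfl)
    simp only [_root_.layerMap] at huv
    split_ifs at huv with ha hb hb <;> obtain ⟨h1, h2⟩ := Prod.ext_iff.1 huv <;>
      simp only at h1 h2
    · exact Prod.ext h1 (hL.inj _ _ (hl ha) (hk hb) h2)
    · subst h2
      exact absurd (by rw [← h1, ha, hTS l (hl ha)]) (hS _ b hb)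
    · subst h2
      exact absurd (by rw [h1, hb, hTS k (hk hb)]) (hS _ a ha)
    · subst h2
      exact Prod.ext ((hF l).inj _ _ ha hb h1) rfl
  reach := by
    rintro ⟨a, l⟩
    have hstep : ∀ u, (∃ k, (_root_.layerMap h F T)^[k] (_root_.layerMap h F T u) = (T z, z)) →
        ∃ k, (_root_.layerMap h F T)^[k] u = (T z, z) := fun u ⟨k, hk⟩ => ⟨k + 1, hk⟩
    induction l using hL.induction generalizing a with
    | ht =>
      induction a using (hF z).induction with
      | ht => exact ⟨0, rfl⟩
      | hs a ha ih => exact hstep _ (by simpa [_root_.layerMap, ha] using ih)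
    | hs l hl ih =>
      induction a using (hF l).induction with
      | ht => exact hstep _ (by simpa [_root_.layerMap] using ih (T l))
      | hs a ha ih' => exact hstep _ (by simpa [_root_.layerMap, ha] using ih')

theorem layerMap_ne (hRA : ∀ a b, RA a b → a ≠ b) {F F' : L → A → A} {T T' : L → A}
    (hF : ∀ l, IsHamMap RA (F l) (T l)) (hF' : ∀ l, IsHamMap RA (F' l) (T' l))
    (hT : ∀ l, T l ≠ T' l) (hd : ∀ l a, a ≠ T l → a ≠ T' l → F l a ≠ F' l a) (u : A × L) :
    layerMap h F T u ≠ layerMap h F' T' u := by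
  obtain ⟨a, l⟩ := u
  unfold layerMap
  simp only
  split_ifs with ha ha' ha'
  · exact absurd (ha.symm.trans ha') (hT l)
  · exact fun hc => hRA _ _ ((hF' l).step a ha') (congrArg Prod.fst hc)
  · exact fun hc => hRA _ _ ((hF l).step a ha) (congrArg Prod.fst hc).symm
  · exact fun hc => hd l a ha ha' (congrArg Prod.fst hc)

end Layers

/-- Adjacency in a cartesian product of directed cycles. -/
def PiAdj {ι : Type*} [DecidableEq ι] (n : ι → ℕ) (u v : ∀ i, ZMod (n i)) : Prop :=
  ∃ i, v = u + Pi.single i 1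

/-- Adjacency in a directed cycle. -/
def CycleAdj (n : ℕ) (u v : ZMod n) : Prop := v = u + 1

theorem piAdj_of_prodAdj {ι : Type*} [DecidableEq ι] (n : ι → ℕ) (i : ι)
    (u v : ZMod (n i) × ∀ j : {j // j ≠ i}, ZMod (n j))
    (huv : ProdAdj (CycleAdj (n i)) (PiAdj fun j : {j // j ≠ i} => n j) u v) :
    PiAdj n ((Equiv.piSplitAt i fun j => ZMod (n j)).symm u)
      ((Equiv.piSplitAt i fun j => ZMod (n j)).symm v) := by
  obtain ⟨a, l⟩ := u
  obtain ⟨b, k⟩ := v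
  rcases huv with ⟨h1, h2⟩ | ⟨h1, j, h2⟩
  · simp only [CycleAdj] at h1 h2
    subst h1 h2
    refine ⟨i, ?_⟩
    rw [Equiv.symm_apply_eq]
    refine Prod.ext (by simp) (funext fun j => ?_)
    simp [j.2]
  · simp only at h1 h2
    subst h1 h2
    refine ⟨j, ?_⟩
    rw [Equiv.symm_apply_eq]
    refine Prod.ext ?_ (funext fun j' => ?_)
    · simp [Ne.symm j.2]
    · rcases eq_or_ne j' j with rfl | hj
      · simp [j'.2]
      · simp [j'.2, hj, Subtype.coe_injective.ne hj]

theorem isHamMap_cycle (n : ℕ) [NeZero n] (t : ZMod n) :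
    IsHamMap (CycleAdj n) (fun a => a + 1) t where
  step _ _ := rfl
  inj _ _ _ _ := by simp
  reach u := ⟨(t - u).val, by simp⟩

theorem exists_isHamMap_pi {ι : Type*} [Fintype ι] [DecidableEq ι] (n : ι → ℕ)
    (hn : ∀ i, n i ≠ 0) : ∃ f t, IsHamMap (PiAdj n) f t := by
  induction hc : Fintype.card ι generalizing ι with
  | zero =>
    have := Fintype.card_eq_zero_iff.1 hc
    exact ⟨id, 0, fun u hu => absurd (Subsingleton.elim _ _) hu,
      fun u v _ _ _ => Subsingleton.elim _ _, fun u => ⟨0, Subsingleton.elim _ _⟩⟩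
  | succ c ih =>
    obtain ⟨i⟩ : Nonempty ι := Fintype.card_pos_iff.1 (by omega)
    obtain ⟨h, z, hL⟩ := ih (fun j : {j // j ≠ i} => n j) (fun j => hn j)
      (by simp [Fintype.card_subtype_compl, hc])
    have : NeZero (n i) := ⟨hn i⟩
    have := hL.layerMap (F := fun _ a => a + 1) (T := fun l => (hL.depth l : ZMod (n i)))
      (S := fun l => (hL.depth l : ZMod (n i)) + 1) (fun l => isHamMap_cycle _ _)
      (fun l a ha => by simpa using ha) (fun l hl => by simp [hL.depth_eq_succ hl])
    exact ⟨_, _, this.map _ (piAdj_of_prodAdj n i)⟩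

/-- Two arc-disjoint hamiltonian paths of `R`, one from `s` to `t` and one from `s'` to `t'`,
with different ends. -/
def ArcDisjointPair {A : Type*} (R : A → A → Prop) (s t s' t' : A) : Prop :=
  t ≠ t' ∧ ∃ f f', IsHamMap R f t ∧ IsHamMap R f' t' ∧ (∀ a, a ≠ t → f a ≠ s) ∧
    (∀ a, a ≠ t' → f' a ≠ s') ∧ ∀ a, a ≠ t → a ≠ t' → f a ≠ f' a

theorem ArcDisjointPair.symm {A : Type*} {R : A → A → Prop} {s t s' t' : A}
    (h : ArcDisjointPair R s t s' t') : ArcDisjointPair R s' t' s t := by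
  obtain ⟨ht, f, f', h1, h2, h3, h4, h5⟩ := h
  exact ⟨ht.symm, f', f, h2, h1, h4, h3, fun a ha ha' => (h5 a ha' ha).symm⟩

theorem ArcDisjointPair.translate {A : Type*} [AddCommGroup A] {R : A → A → Prop}
    (hR : ∀ a b o, R a b → R (a + o) (b + o)) {s t s' t' : A}
    (h : ArcDisjointPair R s t s' t') (o : A) :
    ArcDisjointPair R (s + o) (t + o) (s' + o) (t' + o) := by
  obtain ⟨ht, f, f', h1, h2, h3, h4, h5⟩ := h
  have key : ∀ a b : A, a ≠ b + o → a - o ≠ b := fun a b hab hc => hab (by simp [← hc])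
  have hmap : ∀ {g : A → A} {w : A}, IsHamMap R g w →
      IsHamMap R (fun a => g (a - o) + o) (w + o) := fun hg => by
    simpa [← sub_eq_add_neg] using hg.map (Equiv.addRight o) (fun u v huv => hR u v o huv)
  refine ⟨by simpa using ht, _, _, hmap h1, hmap h2, fun a ha => ?_, fun a ha => ?_,
    fun a ha hb => ?_⟩
  · simpa using h3 _ (key _ _ ha)
  · simpa using h4 _ (key _ _ ha)
  · simpa using h5 _ (key _ _ ha) (key _ _ hb)

/-- Two pairs of arc-disjoint hamiltonian paths which can be used in alternation on the layers of
a product. -/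
def HasAlternatingPairs {A : Type*} [AddCommGroup A] (R : A → A → Prop) : Prop :=
  ∃ s t s' t' r u r' u', ArcDisjointPair R s t s' t' ∧ ArcDisjointPair R r u r' u' ∧
    t' - t = r' - r ∧ u' - u = s' - s

def HasArcDisjointHamMaps {V : Type*} (R : V → V → Prop) : Prop :=
  ∃ f t f' t', IsHamMap R f t ∧ IsHamMap R f' t' ∧ ∀ u, u ≠ t → u ≠ t' → f u ≠ f' u

theorem HasArcDisjointHamMaps.map {V W : Type*} {R : V → V → Prop} {R' : W → W → Prop}
    (h : HasArcDisjointHamMaps R) (e : V ≃ W) (he : ∀ u v, R u v → R' (e u) (e v)) :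
    HasArcDisjointHamMaps R' := by
  obtain ⟨f, t, f', t', h1, h2, h3⟩ := h
  refine ⟨_, _, _, _, h1.map e he, h2.map e he, fun u hu hu' hc => ?_⟩
  exact h3 (e.symm u) (fun hc => hu (by simp [← hc])) (fun hc => hu' (by simp [← hc]))
    (e.injective hc)

/-- Alternate between two pairs on the layers of `A × L`, translating so that in each layer both
paths start where they left the previous one. -/
theorem HasAlternatingPairs.prod {A L : Type*} [AddCommGroup A] {RA : A → A → Prop}
    {RL : L → L → Prop} (hRA : ∀ a b o, RA a b → RA (a + o) (b + o))
    (hirr : ∀ a b, RA a b → a ≠ b) {h : L → L} {z : L} (hL : IsHamMap RL h z)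
    (hA : HasAlternatingPairs RA) : HasArcDisjointHamMaps (ProdAdj RA RL) := by
  obtain ⟨s, t, s', t', r, u, r', u', h1, h2, htr, hus⟩ := hA
  have hpairs : ∃ S T S' T' : ℕ → A, (∀ d, ArcDisjointPair RA (S d) (T d) (S' d) (T' d)) ∧
      (∀ d, S d = T (d + 1)) ∧ ∀ d, S' d = T' (d + 1) := by
    let o : ℕ → A := fun d => (d / 2) • (r + s - u - t) + if Even d then 0 else s - u
    refine ⟨fun d => (if Even d then s else r) + o d, fun d => (if Even d then t else u) + o d,
      fun d => (if Even d then s' else r') + o d, fun d => (if Even d then t' else u') + o d,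
      fun d => ?_, fun d => ?_, fun d => ?_⟩
    · dsimp only
      split_ifs
      exacts [h1.translate hRA _, h2.translate hRA _]
    · obtain ⟨k, rfl | rfl⟩ := d.even_or_odd'
      · simp [o, show (2 * k + 1) / 2 = k by omega]
        abel
      · simp [o, Nat.even_add_one, show (2 * k + 1) / 2 = k by omega,
          show (2 * k + 1 + 1) / 2 = k + 1 by omega, succ_nsmul]
        abel
    · obtain ⟨k, rfl | rfl⟩ := d.even_or_odd'
      · have : s' = u' - u + s := by rw [hus]; abel
        simp [o, show (2 * k + 1) / 2 = k by omega, this]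
        abel
      · have : r' = t' - t + r := by rw [htr]; abel
        simp [o, Nat.even_add_one, show (2 * k + 1) / 2 = k by omega,
          show (2 * k + 1 + 1) / 2 = k + 1 by omega, succ_nsmul, this]
        abel
  obtain ⟨S, T, S', T', hP, hS, hS'⟩ := hpairs
  choose hT F F' hF hF' hFS hFS' hd using hP
  exact ⟨_, _, _, _,
    hL.layerMap (fun l => hF (hL.depth l)) (S := fun l => S (hL.depth l))
      (fun l => hFS _) (fun l hl => by simp only [hS, hL.depth_eq_succ hl]),
    hL.layerMap (fun l => hF' (hL.depth l)) (S := fun l => S' (hL.depth l))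
      (fun l => hFS' _) (fun l hl => by simp only [hS', hL.depth_eq_succ hl]),
    fun v _ _ => layerMap_ne hirr (fun l => hF _) (fun l => hF' _) (fun l => hT _)
      (fun l => hd _) v⟩

theorem HasArcDisjointHamMaps.exists_paths {ι : Type*} [Fintype ι] [DecidableEq ι] (n : ι → ℕ)
    (hn : ∀ i, n i ≠ 0) (h : HasArcDisjointHamMaps (PiAdj n)) :
    ∃ v v' : Fin (∏ i, n i) → (∀ i, ZMod (n i)),
      IsHamPathOn (Set.range fun i => Pi.single i (1 : ZMod (n i))) (∏ i, n i) v ∧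
      IsHamPathOn (Set.range fun i => Pi.single i (1 : ZMod (n i))) (∏ i, n i) v' ∧
      Disjoint (ArcSet (∏ i, n i) v) (ArcSet (∏ i, n i) v') := by
  obtain ⟨f, t, f', t', h1, h2, h3⟩ := h
  have (i : ι) : NeZero (n i) := ⟨hn i⟩
  have hN : Fintype.card (∀ i, ZMod (n i)) = ∏ i, n i := by simp [ZMod.card]
  have hpath : ∀ {g w}, IsHamMap (PiAdj n) g w → ∀ {v : Fin (∏ i, n i) → ∀ i, ZMod (n i)},
      Function.Bijective v → (∀ (i : ℕ) (hi : i + 1 < ∏ i, n i),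
        v ⟨i, Nat.lt_of_succ_lt hi⟩ ≠ w ∧ v ⟨i + 1, hi⟩ = g (v ⟨i, Nat.lt_of_succ_lt hi⟩)) →
      IsHamPathOn (Set.range fun i => Pi.single i (1 : ZMod (n i))) (∏ i, n i) v := by
    intro g w hg v hv hs
    refine ⟨hv, fun i hi => ?_⟩
    obtain ⟨j, hj⟩ := hg.step _ (hs i hi).1
    exact ⟨j, by rw [(hs i hi).2, hj]; simp⟩
  obtain ⟨v, hv, hs⟩ := h1.exists_path hN
  obtain ⟨v', hv', hs'⟩ := h2.exists_path hN
  refine ⟨v, v', hpath h1 hv hs, hpath h2 hv' hs', Set.disjoint_left.2 ?_⟩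
  rintro _ ⟨i, hi, rfl⟩ ⟨j, hj, he⟩
  obtain ⟨e1, e2⟩ := Prod.ext_iff.1 he
  simp only at e1 e2
  obtain ⟨a1, a2⟩ := hs i hi
  obtain ⟨b1, b2⟩ := hs' j hj
  exact h3 _ a1 (e1 ▸ b1) (by rw [← a2, e2, b2, ← e1])

/-- Reversal gives a second path when all lengths are `2`. -/
theorem exists_paths_of_forall_eq_two {ι : Type*} [Fintype ι] [DecidableEq ι] (n : ι → ℕ)
    (hn : ∀ i, n i = 2) :
    ∃ v v' : Fin (∏ i, n i) → (∀ i, ZMod (n i)),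
      IsHamPathOn (Set.range fun i => Pi.single i (1 : ZMod (n i))) (∏ i, n i) v ∧
      IsHamPathOn (Set.range fun i => Pi.single i (1 : ZMod (n i))) (∏ i, n i) v' ∧
      Disjoint (ArcSet (∏ i, n i) v) (ArcSet (∏ i, n i) v') := by
  have (i : ι) : NeZero (n i) := ⟨by simp [hn]⟩
  obtain ⟨f, t, hf⟩ := exists_isHamMap_pi n (by simp [hn])
  obtain ⟨v, hv, hs⟩ := hf.exists_path (N := ∏ i, n i) (by simp [ZMod.card])
  have hstep : ∀ (i : ℕ) (hi : i + 1 < ∏ i, n i), ∃ j,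
      v ⟨i + 1, hi⟩ = v ⟨i, Nat.lt_of_succ_lt hi⟩ + Pi.single j 1 := fun i hi => by
    rw [(hs i hi).2]
    exact hf.step _ (hs i hi).1
  have hneg : ∀ j, -(Pi.single j 1 : ∀ i, ZMod (n i)) = Pi.single j 1 := fun j => by
    rw [← Pi.single_neg]
    congr 1
    have : ∀ m, m = 2 → (-1 : ZMod m) = 1 := by rintro _ rfl; rfl
    exact this _ (hn j)
  refine ⟨v, fun i => v i.rev, ⟨hv, fun i hi => ?_⟩, ⟨hv.comp Fin.rev_bijective, fun i hi => ?_⟩,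
    Set.disjoint_left.2 ?_⟩
  · obtain ⟨j, hj⟩ := hstep i hi
    exact ⟨j, by simp [hj]⟩
  · obtain ⟨j, hj⟩ := hstep (∏ i, n i - (i + 2)) (by omega)
    refine ⟨j, ?_⟩
    have e1 : Fin.rev ⟨i, Nat.lt_of_succ_lt hi⟩ =
        ⟨∏ i, n i - (i + 2) + 1, by omega⟩ := Fin.ext (by simp [Fin.val_rev]; omega)
    have e2 : Fin.rev ⟨i + 1, hi⟩ = ⟨∏ i, n i - (i + 2), by omega⟩ :=
      Fin.ext (by simp [Fin.val_rev])
    dsimp only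
    rw [e1, e2, hj, sub_add_cancel_left, hneg]
  · rintro _ ⟨i, hi, rfl⟩ ⟨j, hj, he⟩
    obtain ⟨e1, e2⟩ := Prod.ext_iff.1 he
    have e1 := congrArg Fin.val (hv.1 e1)
    have e2 := congrArg Fin.val (hv.1 e2)
    simp only [Fin.val_rev] at e1 e2
    omega

/-- Adjacency in the product of two directed cycles. -/
def GridAdj (m n : ℕ) (u v : ZMod m × ZMod n) : Prop := v = u + (1, 0) ∨ v = u + (0, 1)

theorem HasAlternatingPairs.exists_paths {ι : Type*} [Fintype ι] [DecidableEq ι] (n : ι → ℕ)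
    (hn : ∀ i, 2 ≤ n i) {i j : ι} (hij : j ≠ i) (h : HasAlternatingPairs (GridAdj (n i) (n j))) :
    ∃ v v' : Fin (∏ i, n i) → (∀ i, ZMod (n i)),
      IsHamPathOn (Set.range fun i => Pi.single i (1 : ZMod (n i))) (∏ i, n i) v ∧
      IsHamPathOn (Set.range fun i => Pi.single i (1 : ZMod (n i))) (∏ i, n i) v' ∧
      Disjoint (ArcSet (∏ i, n i) v) (ArcSet (∏ i, n i) v') := by
  have hn0 : ∀ k, n k ≠ 0 := fun k => by have := hn k; omega
  refine HasArcDisjointHamMaps.exists_paths n hn0 ?_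
  let κ := {k : {k // k ≠ i} // k ≠ ⟨j, hij⟩}
  obtain ⟨g, z, hL⟩ := exists_isHamMap_pi (fun k : κ => n k.1.1) (fun k => hn0 _)
  have (k : ι) : Fact (1 < n k) := ⟨hn k⟩
  have h' := h.prod (RL := PiAdj fun k : κ => n k.1.1) ?_ ?_ hL
  · refine h'.map ((Equiv.prodAssoc _ _ _).trans (((Equiv.refl _).prodCongr
      (Equiv.piSplitAt (⟨j, hij⟩ : {k // k ≠ i}) fun k => ZMod (n k)).symm).trans
      (Equiv.piSplitAt i fun k => ZMod (n k)).symm)) ?_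
    rintro ⟨⟨a, b⟩, l⟩ ⟨⟨a', b'⟩, l'⟩ huv
    apply piAdj_of_prodAdj
    have hinner := piAdj_of_prodAdj (fun k : {k // k ≠ i} => n k) ⟨j, hij⟩ (b, l) (b', l')
    rcases huv with ⟨h1 | h1, h2⟩ | ⟨h1, h2⟩
    · obtain ⟨rfl, rfl⟩ : a' = a + 1 ∧ b' = b := by simpa using h1
      obtain rfl : l = l' := h2
      exact Or.inl ⟨rfl, rfl⟩
    · obtain ⟨rfl, rfl⟩ : a' = a ∧ b' = b + 1 := by simpa using h1
      obtain rfl : l = l' := h2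
      exact Or.inr ⟨rfl, hinner (Or.inl ⟨rfl, rfl⟩)⟩
    · obtain ⟨rfl, rfl⟩ : a = a' ∧ b = b' := by simpa using h1
      exact Or.inr ⟨rfl, hinner (Or.inr ⟨rfl, h2⟩)⟩
  · rintro a b o (rfl | rfl)
    · exact Or.inl (by abel)
    · exact Or.inr (by abel)
  · rintro a b (rfl | rfl) hc <;> simp at hc

section Steps

variable {A : Type*} [AddCommGroup A]

/-- Adjacency in the Cayley digraph with generators `x` and `y`. -/
def StepAdj (x y u v : A) : Prop := v = u + x ∨ v = u + y

/-- The vertices which `stepMap x y U t p` moves by `y`, where `g = x - y`. -/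
def IsYStep (g : A) (U : A → Prop) (t : A) (p : ℕ) (v : A) : Prop :=
  U v ∨ ∃ k, 1 ≤ k ∧ k ≤ p ∧ v = t + k • g

open Classical in
/-- Move by `y` on `U` and on `p` consecutive points of the coset of `t`, and by `x` elsewhere. -/
noncomputable def stepMap (x y : A) (U : A → Prop) (t : A) (p : ℕ) (v : A) : A :=
  if IsYStep (x - y) U t p v then v + y else v + x

/-- Every orbit of `stepMap x y U t p` passes through `t`. -/
def Reaches (x y : A) (U : A → Prop) (t : A) (p : ℕ) : Prop :=
  ∀ v, ∃ k, (stepMap x y U t p)^[k] v = t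

variable {x y t : A} {U : A → Prop} {p : ℕ}

theorem stepMap_of_isYStep {v : A} (h : IsYStep (x - y) U t p v) :
    stepMap x y U t p v = v + y := if_pos h

theorem stepMap_of_not_isYStep {v : A} (h : ¬ IsYStep (x - y) U t p v) :
    stepMap x y U t p v = v + x := if_neg h

theorem invariant_nsmul {g : A} (hU : ∀ v, U (v + g) ↔ U v) (v : A) (k : ℕ) :
    U (v + k • g) ↔ U v := by
  induction k with
  | zero => simp
  | succ k ih => rw [succ_nsmul, ← add_assoc, hU, ih]

theorem nsmul_inj_of_lt {g : A} {i j : ℕ} (hi : i < addOrderOf g) (hj : j < addOrderOf g)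
    (h : i • g = j • g) : i = j :=
  nsmul_injOn_Iio_addOrderOf hi hj h

theorem semiconj_stepMap (hU : ∀ v, U (v + (x - y)) ↔ U v) (c p : ℕ) :
    Function.Semiconj (· + c • (x - y)) (stepMap x y U 0 p) (stepMap x y U (c • (x - y)) p) := by
  intro w
  have hT : IsYStep (x - y) U (c • (x - y)) p (w + c • (x - y)) ↔ IsYStep (x - y) U 0 p w := by
    simp only [IsYStep, invariant_nsmul hU, zero_add]
    simp [add_comm w]
  by_cases h : IsYStep (x - y) U 0 p w
  · rw [stepMap_of_isYStep h, stepMap_of_isYStep (hT.2 h), add_right_comm]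
  · rw [stepMap_of_not_isYStep h, stepMap_of_not_isYStep (mt hT.1 h), add_right_comm]

theorem reaches_zero_of_reaches (hU : ∀ v, U (v + (x - y)) ↔ U v) (c : ℕ)
    (h : Reaches x y U (c • (x - y)) p) : Reaches x y U 0 p := by
  intro v
  obtain ⟨k, hk⟩ := h (v + c • (x - y))
  refine ⟨k, ?_⟩
  have := ((semiconj_stepMap hU c p).iterate_right k).eq v
  simp only [hk] at this
  simpa using this

theorem reaches_of_zero (hU : ∀ v, U (v + (x - y)) ↔ U v) (c : ℕ)
    (h : Reaches x y U 0 p) : Reaches x y U (c • (x - y)) p := by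
  intro v
  obtain ⟨k, hk⟩ := h (v - c • (x - y))
  refine ⟨k, ?_⟩
  have := ((semiconj_stepMap hU c p).iterate_right k).eq (v - c • (x - y))
  simpa [hk] using this.symm

theorem isHamMap_stepMap (hU : ∀ v, U (v + (x - y)) ↔ U v) (ht : ¬ U t)
    (hp : p < addOrderOf (x - y)) (h : Reaches x y U t p) :
    IsHamMap (StepAdj x y) (stepMap x y U t p) t ∧
      ∀ v, v ≠ t → stepMap x y U t p v ≠ t + p • (x - y) + x := by
  have key : ∀ u v, v ≠ t → IsYStep (x - y) U t p u → ¬ IsYStep (x - y) U t p v →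
      u + y ≠ v + x := by
    intro u v hvt hu hv huv
    obtain rfl : u = v + (x - y) := by rw [add_sub, ← huv]; abel
    rcases hu with hu | ⟨k, hk1, hkp, hk⟩
    · exact hv (Or.inl ((hU v).1 hu))
    · obtain ⟨k, rfl⟩ := Nat.exists_eq_add_of_le' hk1
      rw [succ_nsmul, ← add_assoc, add_right_cancel_iff] at hk
      rcases k with _ | k
      · exact hvt (by simpa using hk)
      · exact hv (Or.inr ⟨k + 1, by omega, by omega, hk⟩)
  refine ⟨⟨fun u _ => ?_, fun u v hu hv huv => ?_, h⟩, fun v hv hs => ?_⟩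
  · unfold stepMap
    split_ifs
    exacts [Or.inr rfl, Or.inl rfl]
  · by_cases h1 : IsYStep (x - y) U t p u <;> by_cases h2 : IsYStep (x - y) U t p v <;>
      simp only [stepMap, h1, h2, if_true, if_false] at huv
    · exact add_right_cancel huv
    · exact absurd huv (key u v hv h1 h2)
    · exact absurd huv.symm (key v u hu h2 h1)
    · exact add_right_cancel huv
  · by_cases h1 : IsYStep (x - y) U t p v
    · rw [stepMap_of_isYStep h1] at hs
      obtain rfl : v = t + (p + 1) • (x - y) := by
        rw [succ_nsmul, ← add_assoc, add_sub, ← hs]; abel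
      rcases h1 with h1 | ⟨k, hk1, hkp, hk⟩
      · exact ht ((invariant_nsmul hU _ _).1 h1)
      · have : (p + 1 - k) • (x - y) = 0 := by
          rw [sub_nsmul _ (by omega), ← sub_eq_add_neg, sub_eq_zero]
          exact add_left_cancel hk
        exact nsmul_ne_zero_of_lt_addOrderOf (by omega) (by omega) this
    · rw [stepMap_of_not_isYStep h1, add_right_cancel_iff] at hs
      rcases p with _ | p
      · exact hv (by simpa using hs)
      · exact h1 (Or.inr ⟨p + 1, by omega, le_rfl, hs⟩)

theorem arcDisjointPair_stepMap {U' : A → Prop} {q c : ℕ}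
    (hU : ∀ v, U (v + (x - y)) ↔ U v) (hU' : ∀ v, U' (v + (x - y)) ↔ U' v)
    (h0 : ¬ U 0) (h0' : ¬ U' 0)
    (hcompl : ∀ v ∉ AddSubgroup.zmultiples (x - y), U' v ↔ ¬ U v) (hxy : x ≠ y)
    (hp : p < addOrderOf (x - y)) (hc : 1 ≤ c) (hcΛ : c < addOrderOf (x - y))
    (hcq : c + q ≤ addOrderOf (x - y))
    (hk : ∀ k, 1 ≤ k → k < addOrderOf (x - y) → k ≠ c → (k ≤ p ↔ ¬ (c < k ∧ k ≤ c + q)))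
    (h1 : Reaches x y U 0 p) (h2 : Reaches x y U' 0 q) :
    ArcDisjointPair (StepAdj x y) (p • (x - y) + x) 0 ((c + q) • (x - y) + x) (c • (x - y)) := by
  have h0c : ¬ U' (c • (x - y)) := fun h => h0' (by
    rw [← zero_add (c • (x - y)), invariant_nsmul hU'] at h; exact h)
  obtain ⟨hm, hs⟩ := isHamMap_stepMap hU h0 hp h1
  obtain ⟨hm', hs'⟩ := isHamMap_stepMap hU' h0c (by omega) (reaches_of_zero hU' c h2)
  refine ⟨(nsmul_ne_zero_of_lt_addOrderOf (by omega) hcΛ).symm, _, _, hm, hm', by simpa using hs,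
    by simpa [add_nsmul] using hs', fun v hv hv' => ?_⟩
  have hopp : IsYStep (x - y) U' (c • (x - y)) q v ↔ ¬ IsYStep (x - y) U 0 p v := by
    by_cases hvg : v ∈ AddSubgroup.zmultiples (x - y)
    · have hfin : IsOfFinAddOrder (x - y) := addOrderOf_pos_iff.1 (by omega)
      obtain ⟨k, hkΛ, rfl⟩ : ∃ k < addOrderOf (x - y), k • (x - y) = v := by
        classical simpa using hfin.mem_zmultiples_iff_mem_range_addOrderOf.1 hvg
      have hk1 : 1 ≤ k := Nat.one_le_iff_ne_zero.2 fun h => hv (by simp [h])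
      have hkc : k ≠ c := fun h => hv' (by rw [h])
      have hn : ¬ U (k • (x - y)) := fun h => h0 (by
        rw [← zero_add (k • (x - y)), invariant_nsmul hU] at h; exact h)
      have hn' : ¬ U' (k • (x - y)) := fun h => h0' (by
        rw [← zero_add (k • (x - y)), invariant_nsmul hU'] at h; exact h)
      have e1 : IsYStep (x - y) U 0 p (k • (x - y)) ↔ k ≤ p := by
        simp only [IsYStep, hn, false_or, zero_add]
        constructor
        · rintro ⟨j, hj1, hjp, hj⟩
          rw [nsmul_inj_of_lt hkΛ (by omega) hj]
          exact hjp
        · exact fun h => ⟨k, hk1, h, rfl⟩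
      have e2 : IsYStep (x - y) U' (c • (x - y)) q (k • (x - y)) ↔ c < k ∧ k ≤ c + q := by
        simp only [IsYStep, hn', false_or, ← add_nsmul]
        constructor
        · rintro ⟨j, hj1, hjq, hj⟩
          rcases (show c + j ≤ addOrderOf (x - y) by omega).lt_or_eq with h | h
          · have := nsmul_inj_of_lt hkΛ h hj
            omega
          · rw [h, addOrderOf_nsmul_eq_zero] at hj
            exact absurd hj hv
        · exact fun h => ⟨k - c, by omega, by omega, by congr 1; omega⟩
      rw [e1, e2, hk k hk1 hkΛ hkc, not_not]
    · have e : ∀ (W : A → Prop) (d r : ℕ),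
          IsYStep (x - y) W (d • (x - y)) r v ↔ W v := fun W d r => by
        refine or_iff_left ?_
        rintro ⟨k, -, -, rfl⟩
        exact hvg (by rw [← add_nsmul]; exact AddSubgroup.nsmul_mem_zmultiples _ _)
      have e0 := e U 0 p
      rw [zero_nsmul] at e0
      rw [e, e0, hcompl v hvg]
  by_cases h : IsYStep (x - y) U 0 p v
  · rw [stepMap_of_isYStep h, stepMap_of_not_isYStep (fun hc => hopp.1 hc h)]
    exact fun hc => hxy (add_left_cancel hc).symm
  · rw [stepMap_of_not_isYStep h, stepMap_of_isYStep (hopp.2 h)]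
    exact fun hc => hxy (add_left_cancel hc)

/-- The three ways to combine two complementary configurations. -/
theorem hasAlternatingPairs_of_reaches {U' : A → Prop} {q : ℕ}
    (hU : ∀ v, U (v + (x - y)) ↔ U v) (hU' : ∀ v, U' (v + (x - y)) ↔ U' v)
    (h0 : ¬ U 0) (h0' : ¬ U' 0)
    (hcompl : ∀ v ∉ AddSubgroup.zmultiples (x - y), U' v ↔ ¬ U v) (hxy : x ≠ y)
    (hpq : p + q + 1 = addOrderOf (x - y)) (h1 : Reaches x y U 0 p)
    (h2 : (1 ≤ p ∧ 1 ≤ q ∧ Reaches x y U' 0 q) ∨ (1 ≤ q ∧ Reaches x y U' 0 (q - 1)) ∨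
      (2 ≤ p ∧ q = 0 ∧ Reaches x y U' 0 0)) :
    HasAlternatingPairs (StepAdj x y) := by
  have hpair := fun {q' c : ℕ} => arcDisjointPair_stepMap (q := q') (c := c) hU hU' h0 h0' hcompl
    hxy (show p < addOrderOf (x - y) by omega)
  have hΛ : p • (x - y) + q • (x - y) + (x - y) = 0 := by
    rw [← add_nsmul, ← succ_nsmul, hpq, addOrderOf_nsmul_eq_zero]
  rcases h2 with ⟨hp, hq, h2⟩ | ⟨hq, h2⟩ | ⟨hp, hq, h2⟩
  · refine ⟨_, _, _, _, _, _, _, _,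
      hpair (q' := q) (c := p + 1) (by omega) (by omega) (by omega)
        (fun k _ _ _ => by omega) h1 h2,
      (hpair (q' := q) (c := p) (by omega) (by omega) (by omega)
        (fun k _ _ _ => by omega) h1 h2).symm, ?_, ?_⟩
    · refine sub_eq_zero.1 (Eq.trans ?_ hΛ)
      simp only [add_nsmul, one_nsmul]
      abel
    · refine (sub_eq_zero.1 (Eq.trans ?_ hΛ)).symm
      simp only [add_nsmul, one_nsmul]
      abel
  · obtain ⟨q, rfl⟩ := Nat.exists_eq_add_of_le' hq
    have hP := hpair (q' := q) (c := p + 1) (by omega) (by omega) (by omega)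
        (fun k _ _ _ => by omega) h1 h2
    refine ⟨_, _, _, _, _, _, _, _, hP, hP.symm, ?_, ?_⟩
    · refine sub_eq_zero.1 (Eq.trans ?_ hΛ)
      simp only [add_nsmul, one_nsmul]
      abel
    · refine (sub_eq_zero.1 (Eq.trans ?_ hΛ)).symm
      simp only [add_nsmul, one_nsmul]
      abel
  · subst hq
    refine ⟨_, _, _, _, _, _, _, _,
      hpair (q' := 0) (c := 1) (by omega) (by omega) (by omega)
        (fun k _ _ _ => by omega) h1 h2,
      (hpair (q' := 0) (c := p - 1) (by omega) (by omega) (by omega)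
        (fun k _ _ _ => by omega) h1 h2).symm, ?_, ?_⟩
    · obtain ⟨p, rfl⟩ := Nat.exists_eq_add_of_le' hp
      simp only [show p + 2 - 1 = p + 1 by omega, add_nsmul]
      abel
    · obtain ⟨p, rfl⟩ := Nat.exists_eq_add_of_le' hp
      rw [eq_comm, ← sub_eq_zero]
      simp only [show p + 2 - 1 = p + 1 by omega, add_nsmul, one_nsmul]
      abel

/-- A periodic orbit of `F` that avoids `t`. -/
structure IsAvoidingOrbit {V : Type*} (F : V → V) (t : V) (C : Set V) : Prop where
  nonempty : C.Nonempty
  notMem : t ∉ C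
  mapsTo : ∀ v ∈ C, F v ∈ C
  trans : ∀ v ∈ C, ∀ w ∈ C, ∃ k, F^[k] v = w

theorem IsAvoidingOrbit.iterate_mem {V : Type*} {F : V → V} {t : V} {C : Set V}
    (h : IsAvoidingOrbit F t C) {v : V} (hv : v ∈ C) (k : ℕ) : F^[k] v ∈ C := by
  induction k generalizing v with
  | zero => exact hv
  | succ k ih => exact ih (h.mapsTo v hv)

theorem exists_isAvoidingOrbit {V : Type*} [Finite V] {F : V → V} {t : V}
    (h : ¬ ∀ v, ∃ k, F^[k] v = t) : ∃ C, IsAvoidingOrbit F t C := by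
  push Not at h
  obtain ⟨v, hv⟩ := h
  obtain ⟨i, j, hij, he⟩ := Finite.exists_ne_map_eq_of_infinite fun k : ℕ => F^[k] v
  wlog hlt : i < j generalizing i j
  · exact this j i hij.symm he.symm (by omega)
  obtain ⟨d, rfl⟩ := Nat.exists_eq_add_of_lt hlt
  have hper : ∀ a, F^[a * (d + 1)] (F^[i] v) = F^[i] v := fun a => by
    have : Function.IsPeriodicPt F (d + 1) (F^[i] v) := by
      rw [Function.IsPeriodicPt, Function.IsFixedPt, ← Function.iterate_add_apply, he]
      congr 1
      omega
    exact this.const_mul a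
  refine ⟨Set.range fun k => F^[k] (F^[i] v), ⟨_, 0, rfl⟩, ?_, ?_, ?_⟩
  · rintro ⟨k, hk⟩
    exact hv (k + i) (by rw [Function.iterate_add_apply]; exact hk)
  · rintro _ ⟨k, rfl⟩
    exact ⟨k + 1, Function.iterate_succ_apply' _ _ _⟩
  · rintro _ ⟨a, rfl⟩ _ ⟨b, rfl⟩
    refine ⟨b + a * d, ?_⟩
    simp only
    rw [← Function.iterate_add_apply, show b + a * d + a = b + a * (d + 1) by ring,
      Function.iterate_add_apply, hper]

/-- An orbit moves within the cosets of `x - y` as if all its steps were `x`-steps. -/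
theorem exists_iterate_stepMap (v : A) (j : ℕ) :
    ∃ b ≤ j, (stepMap x y U t p)^[j] v + b • (x - y) = v + j • x ∧
      (b = 0 → ∀ i < j, ¬ IsYStep (x - y) U t p (v + i • x)) := by
  induction j with
  | zero => exact ⟨0, le_rfl, by simp⟩
  | succ j ih =>
    obtain ⟨b, hb, he, hb0⟩ := ih
    rw [Function.iterate_succ_apply', succ_nsmul, ← add_assoc, ← he]
    by_cases h : IsYStep (x - y) U t p ((stepMap x y U t p)^[j] v)
    · exact ⟨b + 1, by omega, by rw [stepMap_of_isYStep h, succ_nsmul]; abel, by simp⟩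
    · refine ⟨b, by omega, by rw [stepMap_of_not_isYStep h]; abel, ?_⟩
      rintro rfl i hi
      rcases Nat.lt_succ_iff_lt_or_eq.1 hi with hi | rfl
      · exact hb0 rfl i hi
      · rwa [← he, zero_nsmul, add_zero]

theorem exists_nsmul_eq_neg [Finite A] (g : A) (k : ℕ) : ∃ l : ℕ, l • g = -(k • g) := by
  refine ⟨(addOrderOf g - 1) * k, ?_⟩
  have h : 1 ≤ addOrderOf g := addOrderOf_pos g
  rw [eq_neg_iff_add_eq_zero, ← add_nsmul, ← Nat.succ_mul, Nat.succ_eq_add_one,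
    Nat.sub_add_cancel h, mul_comm, mul_nsmul', addOrderOf_nsmul_eq_zero, nsmul_zero]

theorem IsAvoidingOrbit.exists_add_nsmul_mem [Finite A]
    (hgen : ∀ v : A, ∃ j k : ℕ, v = j • x + k • (x - y)) {C : Set A}
    (hC : IsAvoidingOrbit (stepMap x y U t p) t C) (v : A) : ∃ k : ℕ, v + k • (x - y) ∈ C := by
  obtain ⟨c, hc⟩ := hC.nonempty
  obtain ⟨j, k, hjk⟩ := hgen (v - c)
  obtain ⟨b, -, hb, -⟩ := exists_iterate_stepMap (U := U) (t := t) (p := p) (x := x) (y := y) c j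
  obtain ⟨l, hl⟩ := exists_nsmul_eq_neg (x - y) (k + b)
  refine ⟨l, ?_⟩
  have : v + l • (x - y) = (stepMap x y U t p)^[j] c := by
    rw [hl, eq_add_of_sub_eq hjk, add_nsmul, eq_sub_of_add_eq hb]
    abel
  exact this ▸ hC.iterate_mem hc j

/-- If some orbit misses `0`, then trimming the block of `y`-steps to the part between the extreme
points `a` and `b` where that orbit meets it gives a configuration all of whose orbits pass
through the new end. -/
theorem IsAvoidingOrbit.reaches [Finite A]
    (hgen : ∀ v : A, ∃ j k : ℕ, v = j • x + k • (x - y))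
    (hU : ∀ v, U (v + (x - y)) ↔ U v) (h0 : ¬ U 0) (hp : p < addOrderOf (x - y)) {C : Set A}
    (hC : IsAvoidingOrbit (stepMap x y U 0 p) 0 C) {a b : ℕ} (ha1 : 1 ≤ a) (hab : a ≤ b)
    (hbp : b ≤ p) (ha : a • (x - y) ∈ C) (hb : b • (x - y) ∈ C)
    (hmin : ∀ k, 1 ≤ k → k ≤ p → k • (x - y) ∈ C → a ≤ k ∧ k ≤ b) :
    Reaches x y U 0 (b - a) := by
  refine reaches_zero_of_reaches hU a ?_
  set g := x - y with hg
  set s := a • g with hs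
  have hUg : ∀ k : ℕ, ¬ U (k • g) := fun k h => h0 (by
    rw [← zero_add (k • g), invariant_nsmul hU] at h; exact h)
  have hstep : ∀ v, (∃ k, (stepMap x y U s (b - a))^[k] (stepMap x y U s (b - a) v) = s) →
      ∃ k, (stepMap x y U s (b - a))^[k] v = s := fun v ⟨k, hk⟩ => ⟨k + 1, hk⟩
  have hsame : ∀ v ∈ C, v ≠ s → stepMap x y U s (b - a) v = stepMap x y U 0 p v := by
    intro v hv hvs
    have : IsYStep g U s (b - a) v ↔ IsYStep g U 0 p v := by
      refine or_congr Iff.rfl ⟨?_, ?_⟩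
      · rintro ⟨k, hk1, hk2, rfl⟩
        exact ⟨a + k, by omega, by omega, by rw [zero_add, add_nsmul]⟩
      · rintro ⟨k, hk1, hk2, rfl⟩
        rw [zero_add] at hv hvs ⊢
        obtain ⟨h1, h2⟩ := hmin k hk1 hk2 hv
        have : k ≠ a := fun h => hvs (by rw [h])
        exact ⟨k - a, by omega, by omega, by rw [hs, ← add_nsmul]; congr 1; omega⟩
    by_cases h : IsYStep g U 0 p v
    · rw [stepMap_of_isYStep h, stepMap_of_isYStep (this.2 h)]
    · rw [stepMap_of_not_isYStep h, stepMap_of_not_isYStep (mt this.1 h)]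
  have hmem : ∀ v ∈ C, ∃ k, (stepMap x y U s (b - a))^[k] v = s := by
    intro v hv
    obtain ⟨k, hk⟩ := hC.trans v hv s ha
    induction k generalizing v with
    | zero => exact ⟨0, hk⟩
    | succ k ih =>
      by_cases hvs : v = s
      · exact ⟨0, hvs⟩
      · exact hstep v (by rw [hsame v hv hvs]; exact ih _ (hC.mapsTo v hv) hk)
  have hmove : ∀ (v : A) (ρ : ℕ), v ≠ s → v + (ρ + 1) • g ∈ C →
      (∀ ρ' ≤ ρ, v + ρ' • g ∉ C) →
      stepMap x y U s (b - a) v + (ρ + 1) • g = stepMap x y U 0 p (v + (ρ + 1) • g) ∧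
        v + (ρ + 1) • g ≠ s ∨ stepMap x y U s (b - a) v + ρ • g ∈ C := by
    intro v ρ hvs hvC hρ
    by_cases hvg : v - s ∈ AddSubgroup.zmultiples g
    · obtain ⟨i, hi, hiv⟩ : ∃ i < addOrderOf g, i • g = v - s := by
        classical
        simpa using (isOfFinAddOrder_of_finite g).mem_zmultiples_iff_mem_range_addOrderOf.1 hvg
      obtain rfl : v = s + i • g := by rw [hiv]; abel
      have hadd : ∀ k, s + i • g + k • g = (a + i + k) • g := fun k => by
        rw [hs, add_nsmul, add_nsmul]
      have hi0 : i ≠ 0 := fun h => hvs (by simp [h])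
      have hib : i ≠ b - a := fun h => hρ 0 (by omega) (by
        rw [hadd, show a + i + 0 = b by omega]; exact hb)
      have hΛ : i + (ρ + 1) ≤ addOrderOf g := by
        by_contra hc
        refine hρ (addOrderOf g - i) (by omega) ?_
        rw [hadd, show a + i + (addOrderOf g - i) = a + addOrderOf g by omega, add_nsmul,
          addOrderOf_nsmul_eq_zero, add_zero]
        exact ha
      rcases lt_or_gt_of_ne hib with hlt | hgt
      · left
        have hlt' : i + (ρ + 1) ≤ b - a := by
          by_contra hc
          exact hρ (b - a - i) (by omega) (by
            rw [hadd, show a + i + (b - a - i) = b by omega]; exact hb)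
        have h1 : IsYStep g U s (b - a) (s + i • g) := Or.inr ⟨i, by omega, by omega, rfl⟩
        have h2 : IsYStep g U 0 p (s + i • g + (ρ + 1) • g) :=
          Or.inr ⟨a + i + (ρ + 1), by omega, by omega, by rw [hadd, zero_add]⟩
        rw [stepMap_of_isYStep h1, stepMap_of_isYStep h2]
        refine ⟨by abel, fun h => ?_⟩
        rw [add_assoc, ← add_nsmul, add_eq_left] at h
        exact nsmul_ne_zero_of_lt_addOrderOf (by omega) (by omega) h
      · have h1 : ¬ IsYStep g U s (b - a) (s + i • g) := by
          rintro (h | ⟨k, hk1, hk2, hk⟩)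
          · exact hUg (a + i + 0) (by rw [← hadd]; simpa using h)
          · have := nsmul_inj_of_lt hi (by omega) (add_left_cancel hk)
            omega
        rw [stepMap_of_not_isYStep h1]
        rcases hΛ.eq_or_lt with he | hlt
        · right
          have h2 : IsYStep g U 0 p s := Or.inr ⟨a, by omega, by omega, by simp [hs]⟩
          have h3 := hC.mapsTo s ha
          rw [stepMap_of_isYStep h2] at h3
          have : s + i • g + x + ρ • g = s + (i + (ρ + 1)) • g + y := by
            rw [add_nsmul, succ_nsmul, hg]; abel
          rw [this, he, addOrderOf_nsmul_eq_zero, add_zero]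
          exact h3
        · left
          have h2 : ¬ IsYStep g U 0 p (s + i • g + (ρ + 1) • g) := by
            rintro (h | ⟨k, hk1, hk2, hk⟩)
            · exact hUg _ (hadd _ ▸ h)
            · rw [zero_add] at hk
              obtain ⟨h3, h4⟩ := hmin k hk1 hk2 (hk ▸ hvC)
              obtain ⟨j, rfl⟩ := Nat.exists_eq_add_of_le h3
              rw [add_assoc, ← add_nsmul, add_nsmul _ a j] at hk
              have := nsmul_inj_of_lt hlt (by omega) (add_left_cancel hk)
              omega
          rw [stepMap_of_not_isYStep h2]
          refine ⟨by abel, fun h => ?_⟩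
          rw [add_assoc, ← add_nsmul, add_eq_left] at h
          exact nsmul_ne_zero_of_lt_addOrderOf (by omega) hlt h
    · left
      have h1 : IsYStep g U s (b - a) v ↔ U v := or_iff_left (by
        rintro ⟨k, -, -, rfl⟩
        exact hvg (by simp))
      have h2 : IsYStep g U 0 p (v + (ρ + 1) • g) ↔ U v := by
        refine (or_iff_left ?_).trans (invariant_nsmul hU _ _)
        rintro ⟨k, -, -, hk⟩
        refine hvg ?_
        rw [eq_sub_of_add_eq hk, zero_add, hs]
        exact sub_mem (sub_mem (AddSubgroup.nsmul_mem_zmultiples g k)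
          (AddSubgroup.nsmul_mem_zmultiples g _)) (AddSubgroup.nsmul_mem_zmultiples g a)
      refine ⟨?_, fun h => hvg ?_⟩
      · by_cases h : U v
        · rw [stepMap_of_isYStep (h1.2 h), stepMap_of_isYStep (h2.2 h)]
          abel
        · rw [stepMap_of_not_isYStep (mt h1.1 h), stepMap_of_not_isYStep (mt h2.1 h)]
          abel
      · rw [eq_sub_of_add_eq h, sub_sub_cancel_left]
        exact neg_mem (AddSubgroup.nsmul_mem_zmultiples g _)
  intro v
  obtain ⟨ρ, hρ⟩ := hC.exists_add_nsmul_mem hgen v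
  induction ρ using Nat.strong_induction_on generalizing v with
  | _ ρ ih =>
    obtain ⟨k, hk⟩ := hC.trans _ hρ s ha
    induction k generalizing v with
    | zero =>
      by_cases hvs : v = s
      · exact ⟨0, hvs⟩
      by_cases hlow : ∃ ρ' < ρ, v + ρ' • g ∈ C
      · obtain ⟨ρ', h1, h2⟩ := hlow
        exact ih ρ' h1 v h2
      push Not at hlow
      rcases ρ with _ | ρ
      · exact hmem v (by simpa using hρ)
      rcases hmove v ρ hvs hρ (fun ρ' h => hlow ρ' (by omega)) with ⟨-, h⟩ | h
      · exact absurd hk h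
      · exact hstep v (ih ρ (by omega) _ h)
    | succ k ihk =>
      by_cases hvs : v = s
      · exact ⟨0, hvs⟩
      by_cases hlow : ∃ ρ' < ρ, v + ρ' • g ∈ C
      · obtain ⟨ρ', h1, h2⟩ := hlow
        exact ih ρ' h1 v h2
      push Not at hlow
      rcases ρ with _ | ρ
      · exact hmem v (by simpa using hρ)
      rcases hmove v ρ hvs hρ (fun ρ' h => hlow ρ' (by omega)) with ⟨h, -⟩ | h
      · exact hstep v (ihk _ (h ▸ hC.mapsTo _ hρ) (by rw [h]; exact hk))
      · exact hstep v (ih ρ (by omega) _ h)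

theorem IsAvoidingOrbit.exists_reaches [Finite A]
    (hgen : ∀ v : A, ∃ j k : ℕ, v = j • x + k • (x - y))
    (hU : ∀ v, U (v + (x - y)) ↔ U v) (h0 : ¬ U 0) (hp : p < addOrderOf (x - y)) {C : Set A}
    (hC : IsAvoidingOrbit (stepMap x y U 0 p) 0 C) {k l : ℕ} (hk1 : 1 ≤ k) (hkp : k ≤ p)
    (hlp : l ≤ p) (hk : k • (x - y) ∈ C) (hl : l • (x - y) ∈ C) :
    ∃ d, l - k ≤ d ∧ d < p ∧ Reaches x y U 0 d := by
  classical
  have hex : ∃ k, 1 ≤ k ∧ k • (x - y) ∈ C := ⟨k, hk1, hk⟩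
  obtain ⟨ha1, ha⟩ := Nat.find_spec hex
  have hak := Nat.find_min' hex ⟨hk1, hk⟩
  have hmax : ∀ j ≤ p, j • (x - y) ∈ C →
      j ≤ Nat.findGreatest (fun j => j • (x - y) ∈ C) p := fun j h1 h2 =>
    Nat.le_findGreatest (P := fun j => j • (x - y) ∈ C) h1 h2
  have hB := Nat.findGreatest_spec (P := fun j => j • (x - y) ∈ C) hkp hk
  have hBp := Nat.findGreatest_le (P := fun j => j • (x - y) ∈ C) p
  have hkB := hmax k hkp hk
  have hlB := hmax l hlp hl
  refine ⟨_, ?_, ?_, hC.reaches hgen hU h0 hp ha1 (hak.trans hkB) hBp ha hB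
    fun j h1 h2 h3 => ⟨Nat.find_min' hex ⟨h1, h3⟩, hmax j h2 h3⟩⟩ <;> omega

theorem IsAvoidingOrbit.run_mem {C : Set A} (hC : IsAvoidingOrbit (stepMap x y U t p) t C) {v : A}
    (hv : v ∈ C) {j : ℕ} (hj : ∀ i < j, ¬ IsYStep (x - y) U t p (v + i • x)) :
    v + j • x ∈ C := by
  induction j with
  | zero => simpa using hv
  | succ j ih =>
    have := hC.mapsTo _ (ih fun i hi => hj i (by omega))
    rwa [stepMap_of_not_isYStep (hj j (by omega)), add_assoc, ← succ_nsmul] at this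

/-- If `F` moves by `a` outside `P` and by `b` on `P`, and every `a`-line meets `P`, then a closed
set meets `P` in every `a`-line. -/
theorem exists_mem_of_forall_exists_add_nsmul {B : Type*} [AddCommGroup B] {F : A → A}
    {P : A → Prop} {a b : A} {C : Set A} (hne : C.Nonempty) (hC : ∀ v ∈ C, F v ∈ C)
    (hFa : ∀ v ∈ C, ¬ P v → F v = v + a) (hFb : ∀ v ∈ C, P v → F v = v + b)
    (hP : ∀ v, ∃ i : ℕ, P (v + i • a)) (φ : A →+ B) (ha : φ a = 0)
    (hb : ∀ c : B, ∃ j : ℕ, c = j • φ b) (c : B) : ∃ w ∈ C, P w ∧ φ w = c := by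
  have hline : ∀ v ∈ C, ∃ w ∈ C, P w ∧ φ w = φ v := by
    intro v hv
    obtain ⟨i, hi⟩ := hP v
    induction i generalizing v with
    | zero => exact ⟨v, hv, by simpa using hi, rfl⟩
    | succ i ih =>
      by_cases h : P v
      · exact ⟨v, hv, h, rfl⟩
      · obtain ⟨w, h1, h2, h3⟩ := ih (F v) (hC v hv) (by
          rwa [hFa v hv h, add_assoc, ← succ_nsmul'])
        exact ⟨w, h1, h2, by rw [h3, hFa v hv h, map_add, ha, add_zero]⟩
  obtain ⟨v, hv⟩ := hne
  obtain ⟨j, hj⟩ := hb (c - φ v)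
  induction j generalizing v with
  | zero =>
    obtain ⟨w, h1, h2, h3⟩ := hline v hv
    refine ⟨w, h1, h2, ?_⟩
    rw [h3]
    exact (sub_eq_zero.1 (by simpa using hj)).symm
  | succ j ih =>
    obtain ⟨w, h1, h2, h3⟩ := hline v hv
    refine ih (F w) (hC w h1) ?_
    rw [hFb w h1 h2, map_add, h3, ← sub_sub, hj, succ_nsmul, add_sub_cancel_right]

end Steps

section Grid

/-- The first generator of the grid `ZMod m × ZMod n`. -/
abbrev gridX (m n : ℕ) : ZMod m × ZMod n := (1, 0)

/-- The second generator of the grid `ZMod m × ZMod n`. -/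
abbrev gridY (m n : ℕ) : ZMod m × ZMod n := (0, 1)

theorem nsmul_gridX_sub_gridY (m n k : ℕ) :
    k • (gridX m n - gridY m n) = ((k : ZMod m), -(k : ZMod n)) := by
  simp [gridX, gridY]

theorem nsmul_gridX (m n k : ℕ) : k • gridX m n = ((k : ZMod m), 0) := by simp [gridX]

theorem addOrderOf_gridX_sub_gridY (m n : ℕ) :
    addOrderOf (gridX m n - gridY m n) = Nat.lcm m n := by
  simp [gridX, gridY, Prod.addOrderOf, ZMod.addOrderOf_one]

theorem exists_eq_nsmul_gridX_add {m n : ℕ} [NeZero m] [NeZero n] (v : ZMod m × ZMod n) :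
    ∃ j k : ℕ, v = j • gridX m n + k • (gridX m n - gridY m n) := by
  refine ⟨(v.1 - ((-v.2).val : ℕ)).val, (-v.2).val, ?_⟩
  rw [nsmul_gridX_sub_gridY, nsmul_gridX]
  simp

theorem eq_of_cast_eq {n k l : ℕ} (h : (k : ZMod n) = l) (h1 : k < l + n) (h2 : l < k + n) :
    k = l := by
  rw [ZMod.natCast_eq_natCast_iff] at h
  rcases le_total k l with hkl | hkl
  · have := Nat.eq_zero_of_dvd_of_lt ((Nat.modEq_iff_dvd' hkl).1 h) (by omega)
    omega
  · have := Nat.eq_zero_of_dvd_of_lt ((Nat.modEq_iff_dvd' hkl).1 h.symm) (by omega)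
    omega

theorem eq_or_eq_add_of_cast_eq {n k l : ℕ} (h : (k : ZMod n) = l) (hl : l < n)
    (hk : k < 2 * n) : k = l ∨ k = l + n := by
  rcases lt_or_ge k n with hkn | hkn
  · exact Or.inl (eq_of_cast_eq h (by omega) (by omega))
  · exact Or.inr (eq_of_cast_eq (by rw [h]; simp) (by omega) (by omega))

theorem exists_add_nsmul_gridX_eq {m n : ℕ} [NeZero m] [NeZero n] (v : ZMod m × ZMod n) :
    ∃ i k : ℕ, k < n ∧ v + i • gridX m n = k • (gridX m n - gridY m n) := by
  refine ⟨(((-v.2).val : ℕ) - v.1 : ZMod m).val, (-v.2).val, ZMod.val_lt _, ?_⟩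
  rw [nsmul_gridX_sub_gridY, nsmul_gridX]
  ext <;> simp

variable {m n : ℕ}

theorem IsAvoidingOrbit.exists_isYStep_mem_row [NeZero n] {U : ZMod m × ZMod n → Prop} {p : ℕ}
    {C : Set (ZMod m × ZMod n)}
    (hC : IsAvoidingOrbit (stepMap (gridX m n) (gridY m n) U 0 p) 0 C)
    (hrow : ∀ v, ∃ i : ℕ, IsYStep (gridX m n - gridY m n) U 0 p (v + i • gridX m n) ∨
      v + i • gridX m n = 0) (c : ZMod n) :
    ∃ w ∈ C, IsYStep (gridX m n - gridY m n) U 0 p w ∧ w.2 = c := by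
  have hP : ∀ v ∈ C, IsYStep (gridX m n - gridY m n) U 0 p v ∨ v = 0 →
      IsYStep (gridX m n - gridY m n) U 0 p v := fun v hv h =>
    h.resolve_right fun h => hC.notMem (h ▸ hv)
  obtain ⟨w, h1, h2, h3⟩ := exists_mem_of_forall_exists_add_nsmul hC.nonempty hC.mapsTo
    (a := gridX m n) (b := gridY m n)
    (fun v _ h => stepMap_of_not_isYStep fun h' => h (Or.inl h'))
    (fun v hv h => stepMap_of_isYStep (hP v hv h)) hrow (AddMonoidHom.snd _ _) rfl
    (fun c => ⟨c.val, by simp [gridY]⟩) c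
  exact ⟨w, h1, hP w h1 h2, h3⟩

theorem IsAvoidingOrbit.exists_not_isYStep_mem_column [NeZero m] {U : ZMod m × ZMod n → Prop}
    {p : ℕ} {C : Set (ZMod m × ZMod n)}
    (hC : IsAvoidingOrbit (stepMap (gridX m n) (gridY m n) U 0 p) 0 C)
    (hcol : ∀ v, ∃ i : ℕ, ¬ IsYStep (gridX m n - gridY m n) U 0 p (v + i • gridY m n))
    (c : ZMod m) : ∃ w ∈ C, ¬ IsYStep (gridX m n - gridY m n) U 0 p w ∧ w.1 = c :=
  exists_mem_of_forall_exists_add_nsmul hC.nonempty hC.mapsTo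
    (a := gridY m n) (b := gridX m n)
    (fun v _ h => stepMap_of_isYStep (not_not.1 h))
    (fun v hv h => stepMap_of_not_isYStep h) hcol (AddMonoidHom.fst _ _) rfl
    (fun c => ⟨c.val, by simp [gridX]⟩) c

theorem two_mul_le_lcm (hn : 0 < n) (hm : 0 < m) (hmn : ¬ m ∣ n) : 2 * n ≤ Nat.lcm m n := by
  obtain ⟨c, hc⟩ := Nat.dvd_lcm_right m n
  have hpos := Nat.lcm_pos hm hn
  rcases c with _ | _ | c
  · omega
  · exact absurd (hc ▸ Nat.dvd_lcm_left m n) (by simpa using hmn)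
  · rw [hc]
    nlinarith

/-- A block of between `n - 1` and `2 * n - 2` consecutive `y`-steps works, up to shortening it
by one. -/
theorem reaches_empty_or [NeZero m] [NeZero n] (hn : 2 ≤ n) (hmn : ¬ m ∣ n) {p : ℕ} (h1 : n - 1 ≤ p)
    (h2 : p ≤ 2 * n - 2) :
    Reaches (gridX m n) (gridY m n) (fun _ => False) 0 p ∨
      (n ≤ p ∧ Reaches (gridX m n) (gridY m n) (fun _ => False) 0 (p - 1)) := by
  refine or_iff_not_imp_left.2 fun hR => ?_
  obtain ⟨C, hC⟩ := exists_isAvoidingOrbit hR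
  have hY : ∀ {v}, IsYStep (gridX m n - gridY m n) (fun _ => False) 0 p v ↔
      ∃ k : ℕ, 1 ≤ k ∧ k ≤ p ∧ v = ((k : ZMod m), -(k : ZMod n)) := fun {v} => by
    simp [IsYStep]
  have hrow : ∀ j < n, ∃ k : ℕ, 1 ≤ k ∧ k ≤ p ∧ (k = j ∨ k = j + n) ∧
      ((k : ZMod m), -(k : ZMod n)) ∈ C := by
    intro j hj
    obtain ⟨w, hw, hwY, hwj⟩ := hC.exists_isYStep_mem_row (fun v => by
      obtain ⟨i, k, hk, hv⟩ := exists_add_nsmul_gridX_eq v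
      refine ⟨i, ?_⟩
      rcases Nat.eq_zero_or_pos k with rfl | hk0
      · exact Or.inr (by simpa using hv)
      · exact Or.inl (Or.inr ⟨k, hk0, by omega, by rw [hv, zero_add]⟩)) (-(j : ZMod n))
    obtain ⟨k, hk1, hkp, rfl⟩ := hY.1 hwY
    exact ⟨k, hk1, hkp, eq_or_eq_add_of_cast_eq (neg_inj.1 hwj) hj (by omega), hw⟩
  have hnext : ∀ k : ℕ, k + 1 ≤ p → (((k + 1 : ℕ) : ZMod m), -((k + 1 : ℕ) : ZMod n)) ∈ C →
      ((k : ZMod m) + 1, -(k : ZMod n)) ∈ C := fun k hk h => by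
    have := hC.mapsTo _ h
    rw [stepMap_of_isYStep (hY.2 ⟨k + 1, by omega, hk, rfl⟩)] at this
    simpa using this
  have hm : 0 < m := NeZero.pos m
  have hr0 : 0 < n % m := Nat.pos_of_ne_zero fun h => hmn (Nat.dvd_of_mod_eq_zero h)
  have hrm : n % m < m := Nat.mod_lt _ hm
  have hnp : n ≤ p := by
    by_contra hc
    obtain ⟨k, hk1, hkp, hk, -⟩ := hrow 0 (by omega)
    omega
  refine ⟨hnp, ?_⟩
  obtain ⟨r, rfl⟩ := Nat.exists_eq_add_of_le hnp
  have hfirst : 1 • (gridX m n - gridY m n) ∈ C := by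
    obtain ⟨k, hk1, hkp, rfl | rfl, hk⟩ := hrow 1 (by omega)
    · rwa [nsmul_gridX_sub_gridY]
    · rw [add_comm 1 n] at hk hkp
      have h0 := hC.run_mem (j := m - n % m - 1) (hnext n hkp hk) fun i hi hT => by
        obtain ⟨k, hk1, hkp, hk⟩ := hY.1 hT
        rw [nsmul_gridX] at hk
        obtain ⟨e1, e2⟩ := Prod.ext_iff.1 hk
        have hkn : k = n := (eq_or_eq_add_of_cast_eq (n := n) (k := k) (l := 0)
          (by simpa using e2.symm) (by omega) (by omega)).elim (by omega) (by omega)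
        subst hkn
        have e3 : ((i + 1 : ℕ) : ZMod m) = 0 := by
          have : (k : ZMod m) + 1 + i = k := e1
          push_cast
          linear_combination this
        have := Nat.le_of_dvd (by omega) ((ZMod.natCast_eq_zero_iff _ _).1 e3)
        omega
      refine absurd ?_ hC.notMem
      convert h0 using 1
      rw [nsmul_gridX, Nat.sub_sub, Nat.cast_sub (by omega)]
      ext <;> simp
  have hlast : (n + r) • (gridX m n - gridY m n) ∈ C := by
    obtain ⟨k, hk1, hkp, hk', hk⟩ := hrow (r + 1) (by omega)
    obtain rfl : k = r + 1 := by omega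
    have h0 := hC.run_mem (j := n % m - 1) (hnext r hkp hk) fun i hi hT => by
      obtain ⟨k, hk1, hkp, hk⟩ := hY.1 hT
      rw [nsmul_gridX] at hk
      obtain ⟨e1, e2⟩ := Prod.ext_iff.1 hk
      have e3 : (r : ZMod m) + 1 + i = k := e1
      rcases eq_or_eq_add_of_cast_eq (n := n) (k := k) (l := r) (by simpa using e2.symm)
        (by omega) (by omega) with rfl | rfl
      · have e4 : ((i + 1 : ℕ) : ZMod m) = 0 := by
          push_cast
          linear_combination e3
        have := Nat.le_of_dvd (by omega) ((ZMod.natCast_eq_zero_iff _ _).1 e4)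
        omega
      · have e4 : ((i + 1 : ℕ) : ZMod m) = (n % m : ℕ) := by
          push_cast at e3 ⊢
          rw [ZMod.natCast_mod]
          linear_combination e3
        have := eq_of_cast_eq e4 (by omega) (by omega)
        omega
    convert h0 using 1
    rw [nsmul_gridX, nsmul_gridX_sub_gridY, Nat.cast_sub (by omega)]
    ext <;> simp [add_comm]
  have := hC.reaches exists_eq_nsmul_gridX_add (fun _ => Iff.rfl) not_false
    (by
      have := two_mul_le_lcm (NeZero.pos n) (NeZero.pos m) hmn
      rw [addOrderOf_gridX_sub_gridY]
      omega) le_rfl (by omega) le_rfl hfirst hlast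
    (fun k h1 h2 _ => ⟨h1, h2⟩)
  exact this

theorem zmultiples_invariant {A : Type*} [AddCommGroup A] (g v : A) :
    v + g ∉ AddSubgroup.zmultiples g ↔ v ∉ AddSubgroup.zmultiples g := by
  rw [AddSubgroup.add_mem_cancel_right _ (AddSubgroup.mem_zmultiples g)]

theorem exists_nsmul_of_mem_zmultiples {A : Type*} [AddCommGroup A] [Finite A] {g v : A}
    (hv : v ∈ AddSubgroup.zmultiples g) : ∃ k < addOrderOf g, v = k • g := by
  classical
  obtain ⟨k, hk, h⟩ : ∃ k < addOrderOf g, k • g = v := by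
    simpa using (isOfFinAddOrder_of_finite g).mem_zmultiples_iff_mem_range_addOrderOf.1 hv
  exact ⟨k, hk, h.symm⟩

theorem reaches_compl_sub [NeZero m] [NeZero n] :
    Reaches (gridX m n) (gridY m n) (· ∉ AddSubgroup.zmultiples (gridX m n - gridY m n)) 0
      (Nat.lcm m n - m) := by
  by_contra hR
  obtain ⟨C, hC⟩ := exists_isAvoidingOrbit hR
  have hΛ := addOrderOf_gridX_sub_gridY m n
  have hpos := Nat.lcm_pos (NeZero.pos m) (NeZero.pos n)
  have hle := Nat.le_of_dvd hpos (Nat.dvd_lcm_left m n)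
  obtain ⟨w, hw, hwY, hw1⟩ := hC.exists_not_isYStep_mem_column (fun v => by
    have hval := ZMod.val_lt (-v.1)
    obtain ⟨K, hK⟩ : ∃ K, K = m.lcm n - (-v.1).val := ⟨_, rfl⟩
    have hK1 : (K : ZMod m) = v.1 := by
      have : ((m.lcm n : ℕ) : ZMod m) = 0 :=
        (ZMod.natCast_eq_zero_iff _ _).2 (Nat.dvd_lcm_left m n)
      rw [hK, Nat.cast_sub (by omega), this]
      simp
    have hv : v + (-v.2 - (K : ZMod n)).val • gridY m n = K • (gridX m n - gridY m n) := by
      rw [nsmul_gridX_sub_gridY, hK1]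
      ext
      · simp
      · simp
        ring
    refine ⟨(-v.2 - (K : ZMod n)).val, ?_⟩
    rw [hv, hK]
    rintro (h | ⟨k, hk1, hkp, hk⟩)
    · exact h (AddSubgroup.nsmul_mem_zmultiples _ _)
    · rw [zero_add] at hk
      rcases Nat.eq_zero_or_pos (-v.1).val with h | h
      · rw [h, Nat.sub_zero, ← hΛ, addOrderOf_nsmul_eq_zero] at hk
        exact nsmul_ne_zero_of_lt_addOrderOf (by omega) (by rw [hΛ]; have := NeZero.pos m; omega)
          hk.symm
      · have := nsmul_inj_of_lt (by omega) (by omega) hk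
        omega) 0
  simp only [IsYStep, not_or, not_not, zero_add] at hwY
  obtain ⟨k, hk, rfl⟩ := exists_nsmul_of_mem_zmultiples hwY.1
  have hk0 : k ≠ 0 := fun h => hC.notMem (by simpa [h] using hw)
  have hkp : m.lcm n - m < k := by
    by_contra hc
    exact hwY.2 ⟨k, by omega, by omega, rfl⟩
  rw [nsmul_gridX_sub_gridY] at hw1
  have hdvd := Nat.dvd_sub (Nat.dvd_lcm_left m n) ((ZMod.natCast_eq_zero_iff k m).1 hw1)
  have := Nat.le_of_dvd (by omega) hdvd
  omega

theorem exists_reaches_compl [NeZero m] [NeZero n] (hmn : ¬ m ∣ n) (h2 : 2 * m ≤ n) :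
    ∃ p q, p + q + 1 = Nat.lcm m n ∧ n - 1 ≤ q ∧ q ≤ 2 * n - 2 ∧
      Reaches (gridX m n) (gridY m n) (· ∉ AddSubgroup.zmultiples (gridX m n - gridY m n)) 0 p := by
  have hΛ := addOrderOf_gridX_sub_gridY m n
  have hm := NeZero.pos m
  have hle := two_mul_le_lcm (NeZero.pos n) hm hmn
  by_cases hR : Reaches (gridX m n) (gridY m n)
      (· ∉ AddSubgroup.zmultiples (gridX m n - gridY m n)) 0 (m.lcm n - n)
  · exact ⟨_, n - 1, by omega, by omega, by omega, hR⟩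
  obtain ⟨C, hC⟩ := exists_isAvoidingOrbit hR
  set g := gridX m n - gridY m n with hg
  have hgmem : ∀ k : ℕ, k • g ∈ AddSubgroup.zmultiples g :=
    fun k => AddSubgroup.nsmul_mem_zmultiples g k
  have h0 : 0 • g ∉ C := by simpa using hC.notMem
  have hper : ∀ k, (k + m.lcm n) • g = k • g := fun k => by
    rw [add_nsmul, ← hΛ, addOrderOf_nsmul_eq_zero, add_zero]
  have hdesc : ∀ k, 1 ≤ k → k < m.lcm n → k • g ∈ C →
      ∃ b l, 1 ≤ b ∧ b ≤ m ∧ l + b = k + m.lcm n ∧ l • g ∈ C := by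
    intro k hk1 hkΛ hk
    obtain ⟨b, hbm, hb, hb0⟩ := exists_iterate_stepMap (x := gridX m n) (y := gridY m n)
      (U := (· ∉ AddSubgroup.zmultiples g)) (t := 0) (p := m.lcm n - n) (k • g) m
    refine ⟨b, k + m.lcm n - b, ?_, hbm, by omega, ?_⟩
    · refine Nat.one_le_iff_ne_zero.2 fun h => ?_
      rcases le_or_gt k (m.lcm n - n) with hkp | hkp
      · exact hb0 h 0 hm (Or.inr ⟨k, hk1, hkp, by rw [zero_nsmul, add_zero, zero_add]⟩)
      · refine hb0 h (n % m) (Nat.mod_lt _ hm)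
          (Or.inr ⟨k + n - m.lcm n, by omega, by omega, ?_⟩)
        rw [zero_add, ← hg, ← hper (k + n - m.lcm n),
          show k + n - m.lcm n + m.lcm n = k + n by omega, add_nsmul, hg,
          nsmul_gridX_sub_gridY m n n, nsmul_gridX]
        simp
    · have hmem := hC.iterate_mem hk m
      have hmx : m • gridX m n = 0 := by rw [nsmul_gridX]; simp
      have hkg : k • g = (k + m.lcm n - b) • g + b • g := by
        rw [← add_nsmul, Nat.sub_add_cancel (by omega), hper]
      rw [← hg, hmx, add_zero] at hb
      rwa [add_right_cancel (hb.trans hkg)] at hmem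
  classical
  have hex : ∃ k, 1 ≤ k ∧ k < m.lcm n ∧ k • g ∈ C := by
    obtain ⟨k, hk⟩ := hC.exists_add_nsmul_mem exists_eq_nsmul_gridX_add 0
    rw [zero_add] at hk
    obtain ⟨l, hl, h⟩ := exists_nsmul_of_mem_zmultiples (hgmem k)
    rw [← hg, h] at hk
    exact ⟨l, Nat.one_le_iff_ne_zero.2 fun h => h0 (h ▸ hk), hΛ ▸ hl, hk⟩
  obtain ⟨ha1, haΛ, ha⟩ := Nat.find_spec hex
  have hamin : ∀ k, 1 ≤ k → k < m.lcm n → k • g ∈ C → Nat.find hex ≤ k :=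
    fun k h1 h2 h3 => Nat.find_min' hex ⟨h1, h2, h3⟩
  generalize Nat.find hex = a at ha1 haΛ ha hamin
  obtain ⟨b, l, hb1, hbm, hlb, hl⟩ := hdesc a ha1 haΛ ha
  have hlΛ : l < m.lcm n := by
    by_contra hc
    obtain ⟨d, rfl⟩ := Nat.exists_eq_add_of_le' (not_lt.1 hc)
    rw [hper] at hl
    have : d ≠ 0 := fun h => h0 (h ▸ hl)
    have := hamin d (by omega) (by omega) hl
    omega
  have hex' : ∃ k, m.lcm n - n < k ∧ k • g ∈ C := ⟨l, by omega, hl⟩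
  obtain ⟨hc1, hc⟩ := Nat.find_spec hex'
  have hcl := Nat.find_min' hex' ⟨by omega, hl⟩
  have hcmin : ∀ k, m.lcm n - n < k → k • g ∈ C → Nat.find hex' ≤ k :=
    fun k h1 h2 => Nat.find_min' hex' ⟨h1, h2⟩
  generalize Nat.find hex' = c at hc1 hc hcl hcmin
  obtain ⟨b', l', hb1', hbm', hlb', hl'⟩ := hdesc c (by omega) (by omega) hc
  obtain ⟨e, rfl⟩ := Nat.exists_eq_add_of_le' (show m.lcm n ≤ l' by omega)
  rw [hper] at hl'
  have hep : e ≤ m.lcm n - n := by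
    by_contra h
    have := hcmin e (by omega) hl'
    omega
  obtain ⟨d, hd1, hd2, hd⟩ := hC.exists_reaches exists_eq_nsmul_gridX_add
    (fun v => zmultiples_invariant g v) (not_not.2 (zero_mem _)) (by rw [← hg, hΛ]; omega) ha1
    (by omega) hep ha hl'
  exact ⟨d, m.lcm n - 1 - d, by omega, by omega, by omega, hd⟩

/-- The sum of the coordinates, modulo `m`. -/
def gridLevel (h : m ∣ n) : ZMod m × ZMod n →+ ZMod m :=
  (AddMonoidHom.id _).coprod (ZMod.castHom h (ZMod m)).toAddMonoidHom

theorem gridLevel_apply (h : m ∣ n) (v : ZMod m × ZMod n) :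
    gridLevel h v = v.1 + ZMod.castHom h (ZMod m) v.2 := rfl

theorem gridLevel_mk (h : m ∣ n) (a : ZMod m) (k : ℕ) :
    gridLevel h (a, -(k : ZMod n)) = a - k := by
  rw [gridLevel_apply, map_neg, map_natCast, sub_eq_add_neg]

theorem gridLevel_gridX (h : m ∣ n) : gridLevel h (gridX m n) = 1 := by
  rw [gridLevel_apply, map_zero, add_zero]

theorem gridLevel_gridY (h : m ∣ n) : gridLevel h (gridY m n) = 1 := by
  rw [gridLevel_apply, map_one, zero_add]

theorem gridLevel_gridX_sub_gridY (h : m ∣ n) : gridLevel h (gridX m n - gridY m n) = 0 := by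
  rw [map_sub, gridLevel_gridX, gridLevel_gridY, sub_self]

theorem gridLevel_nsmul (h : m ∣ n) (k : ℕ) :
    gridLevel h (k • (gridX m n - gridY m n)) = 0 := by
  rw [map_nsmul, gridLevel_gridX_sub_gridY, nsmul_zero]

theorem gridLevel_invariant (h : m ∣ n) (v : ZMod m × ZMod n) :
    gridLevel h (v + (gridX m n - gridY m n)) = gridLevel h v := by
  rw [map_add, gridLevel_gridX_sub_gridY, add_zero]

theorem mem_zmultiples_of_gridLevel_eq_zero [NeZero n] (h : m ∣ n) {v : ZMod m × ZMod n}
    (hv : gridLevel h v = 0) : v ∈ AddSubgroup.zmultiples (gridX m n - gridY m n) := by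
  have : v = (-v.2).val • (gridX m n - gridY m n) := by
    rw [nsmul_gridX_sub_gridY]
    rw [gridLevel_apply] at hv
    ext
    · rw [ZMod.natCast_val, ← ZMod.castHom_apply (h := h), map_neg]
      exact eq_neg_of_add_eq_zero_left hv
    · simp
  rw [this]
  exact AddSubgroup.nsmul_mem_zmultiples _ _

theorem reaches_gridLevel_eq_one_or [NeZero n] (h : m ∣ n) (hm : 2 ≤ m) {p : ℕ} (hp : p < n) :
    Reaches (gridX m n) (gridY m n) (gridLevel h · = 1) 0 p ∨
      (1 ≤ p ∧ Reaches (gridX m n) (gridY m n) (gridLevel h · = 1) 0 (p - 1)) := by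
  have : NeZero m := ⟨by omega⟩
  refine or_iff_not_imp_left.2 fun hR => ?_
  obtain ⟨C, hC⟩ := exists_isAvoidingOrbit hR
  have hrow := hC.exists_isYStep_mem_row fun v => by
    obtain ⟨i, k, -, hv⟩ := exists_add_nsmul_gridX_eq v
    refine ⟨i + 1, Or.inl (Or.inl ?_)⟩
    rw [succ_nsmul, ← add_assoc, hv]
    simp only [map_add, gridLevel_nsmul, gridLevel_gridX, zero_add]
  have hrun : ∀ j ≤ p, (((j + 2 : ℕ) : ZMod m), -((j + 1 : ℕ) : ZMod n)) ∈ C →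
      j • (gridX m n - gridY m n) ∈ C := fun j hj hw => by
    have h1 := hC.mapsTo _ hw
    rw [stepMap_of_isYStep (Or.inl (by rw [gridLevel_mk]; push_cast; ring))] at h1
    have h2 := hC.run_mem (j := m - 2) h1 fun i hi hT => by
      have hne : ∀ k : ℕ, k < 2 → ((i + 2 : ℕ) : ZMod m) ≠ k := fun k hk he => by
        have := eq_of_cast_eq he (by omega) (by omega)
        omega
      rcases hT with hT | ⟨k, hk1, hkp, hk⟩
      · simp only [map_add, map_nsmul, gridLevel_mk, gridLevel_gridX, gridLevel_gridY] at hT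
        refine hne 1 (by omega) ?_
        push_cast [nsmul_eq_mul] at hT ⊢
        linear_combination hT
      · rw [zero_add, nsmul_gridX, nsmul_gridX_sub_gridY] at hk
        obtain ⟨e1, e2⟩ := Prod.ext_iff.1 hk
        obtain rfl : k = j := eq_of_cast_eq (n := n) (by simpa using e2.symm)
          (by omega) (by omega)
        refine hne 0 (by omega) ?_
        simp at e1
        push_cast
        linear_combination e1
    convert h2 using 1
    rw [nsmul_gridX, nsmul_gridX_sub_gridY, Nat.cast_sub hm]
    ext <;> simp
  have hlevel : ∀ (j : ℕ) (w : ZMod m × ZMod n), w.2 = -((j + 1 : ℕ) : ZMod n) →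
      gridLevel h w = 1 → w = (((j + 2 : ℕ) : ZMod m), -((j + 1 : ℕ) : ZMod n)) := by
    rintro j ⟨a, b⟩ rfl hw
    rw [gridLevel_mk] at hw
    ext
    · push_cast at hw ⊢
      linear_combination hw
    · rfl
  have hfirst : 1 ≤ p ∧ 1 • (gridX m n - gridY m n) ∈ C := by
    obtain ⟨w, hw, hwY | ⟨k, hk1, hkp, rfl⟩, hw2⟩ := hrow (-((0 + 1 : ℕ) : ZMod n))
    · rw [hlevel 0 w hw2 hwY] at hw
      exact absurd (by simpa using hrun 0 (by omega) hw) hC.notMem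
    · rw [zero_add, nsmul_gridX_sub_gridY] at hw2
      obtain rfl : k = 0 + 1 := eq_of_cast_eq (neg_inj.1 hw2) (by omega) (by omega)
      exact ⟨by omega, by simpa using hw⟩
  have hlast : p • (gridX m n - gridY m n) ∈ C := by
    obtain ⟨w, hw, hwY | ⟨k, hk1, hkp, rfl⟩, hw2⟩ := hrow (-((p + 1 : ℕ) : ZMod n))
    · rw [hlevel p w hw2 hwY] at hw
      exact hrun p le_rfl hw
    · rw [zero_add, nsmul_gridX_sub_gridY] at hw2
      have := eq_of_cast_eq (neg_inj.1 hw2) (by omega) (by omega)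
      omega
  have : Fact (1 < m) := ⟨hm⟩
  exact ⟨hfirst.1, hC.reaches exists_eq_nsmul_gridX_add
    (fun v => by rw [gridLevel_invariant]) (by rw [map_zero]; exact zero_ne_one)
    (by rwa [addOrderOf_gridX_sub_gridY, Nat.lcm_eq_right h]) le_rfl hfirst.1 le_rfl hfirst.2 hlast
    fun k h1 h2 _ => ⟨h1, h2⟩⟩

theorem reaches_gridLevel_ne_or [NeZero n] (h : m ∣ n) (hm : 2 ≤ m) :
    Reaches (gridX m n) (gridY m n) (fun v => gridLevel h v ≠ 0 ∧ gridLevel h v ≠ 1) 0 (n - 1) ∨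
      ∃ d, 1 ≤ d ∧ d < n - 1 ∧
        Reaches (gridX m n) (gridY m n) (fun v => gridLevel h v ≠ 0 ∧ gridLevel h v ≠ 1) 0 d := by
  have : NeZero m := ⟨by omega⟩
  have : Fact (1 < m) := ⟨hm⟩
  refine or_iff_not_imp_left.2 fun hR => ?_
  obtain ⟨C, hC⟩ := exists_isAvoidingOrbit hR
  have hmn := Nat.le_of_dvd (NeZero.pos n) h
  have hΛ := addOrderOf_gridX_sub_gridY m n
  rw [Nat.lcm_eq_right h] at hΛ
  have hmod : ∀ k : ℕ, (k % n) • (gridX m n - gridY m n) = k • (gridX m n - gridY m n) :=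
    fun k => by
      have := mod_addOrderOf_nsmul (gridX m n - gridY m n) k
      rwa [hΛ] at this
  have h0 : 0 • (gridX m n - gridY m n) ∉ C := by simpa using hC.notMem
  have hex : ∃ k, 1 ≤ k ∧ k < n ∧ k • (gridX m n - gridY m n) ∈ C := by
    obtain ⟨k, hk⟩ := hC.exists_add_nsmul_mem exists_eq_nsmul_gridX_add 0
    rw [zero_add, ← hmod] at hk
    exact ⟨k % n, Nat.one_le_iff_ne_zero.2 fun h => h0 (h ▸ hk), Nat.mod_lt _ (NeZero.pos n), hk⟩
  obtain ⟨k, hk1, hkn, hk⟩ := hex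
  have hkF := hC.mapsTo _ hk
  rw [stepMap_of_isYStep (Or.inr ⟨k, hk1, by omega, (zero_add _).symm⟩)] at hkF
  have hkF' := hC.mapsTo _ hkF
  have hlev : gridLevel h (k • (gridX m n - gridY m n) + gridY m n) = 1 := by
    rw [map_add, gridLevel_nsmul, gridLevel_gridY, zero_add]
  rw [stepMap_of_not_isYStep (by
    rintro (hT | ⟨j, -, -, hj⟩)
    · exact hT.2 hlev
    · rw [hj, zero_add, gridLevel_nsmul] at hlev
      exact zero_ne_one hlev)] at hkF'
  obtain ⟨b, hbm, hb, -⟩ := exists_iterate_stepMap (x := gridX m n) (y := gridY m n)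
    (U := fun v => gridLevel h v ≠ 0 ∧ gridLevel h v ≠ 1) (t := 0) (p := n - 1)
    (k • (gridX m n - gridY m n) + gridY m n + gridX m n) (m - 2)
  have hmem := hC.iterate_mem hkF' (m - 2)
  have hl : (k + n - 1 - b) • (gridX m n - gridY m n) ∈ C := by
    convert hmem using 1
    refine add_right_cancel (b := b • (gridX m n - gridY m n)) (Eq.trans ?_ hb.symm)
    have hx : (2 + (m - 2)) • gridX m n = 0 := by
      rw [Nat.add_sub_cancel' hm, nsmul_gridX]
      simp
    have hg : (k + n - 1 - b) • (gridX m n - gridY m n) + b • (gridX m n - gridY m n) +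
        (gridX m n - gridY m n) = k • (gridX m n - gridY m n) := by
      rw [← add_nsmul, ← succ_nsmul, show k + n - 1 - b + b + 1 = k + n by omega, ← hmod]
      rw [Nat.add_mod_right, hmod]
    rw [← hg]
    rw [add_nsmul, two_nsmul] at hx
    refine sub_eq_zero.1 (Eq.trans ?_ (neg_eq_zero.2 hx))
    abel
  obtain ⟨l, hl1, hln, hlk, hl⟩ : ∃ l, 1 ≤ l ∧ l < n ∧ l ≠ k ∧
      l • (gridX m n - gridY m n) ∈ C := by
    rw [← hmod] at hl
    refine ⟨_, Nat.one_le_iff_ne_zero.2 fun h => h0 (h ▸ hl), Nat.mod_lt _ (NeZero.pos n),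
      fun h => ?_, hl⟩
    rcases lt_or_ge (k + n - 1 - b) n with hc | hc
    · rw [Nat.mod_eq_of_lt hc] at h
      omega
    · rw [Nat.mod_eq_sub_mod hc, Nat.mod_eq_of_lt (by omega)] at h
      omega
  have hU : ∀ v, (gridLevel h (v + (gridX m n - gridY m n)) ≠ 0 ∧
      gridLevel h (v + (gridX m n - gridY m n)) ≠ 1) ↔
      (gridLevel h v ≠ 0 ∧ gridLevel h v ≠ 1) := fun v => by rw [gridLevel_invariant]
  have hU0 : ¬ (gridLevel h 0 ≠ 0 ∧ gridLevel h 0 ≠ 1) := fun hc => hc.1 (map_zero _)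
  rcases lt_or_gt_of_ne hlk with hlt | hlt
  · obtain ⟨d, h1, h2, h3⟩ := hC.exists_reaches exists_eq_nsmul_gridX_add hU hU0 (by omega)
      hl1 (by omega) (show k ≤ n - 1 by omega) hl hk
    exact ⟨d, by omega, h2, h3⟩
  · obtain ⟨d, h1, h2, h3⟩ := hC.exists_reaches exists_eq_nsmul_gridX_add hU hU0 (by omega)
      hk1 (by omega) (show l ≤ n - 1 by omega) hk hl
    exact ⟨d, by omega, h2, h3⟩

theorem gridX_ne_gridY (hm : 2 ≤ m) : gridX m n ≠ gridY m n := by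
  have : Fact (1 < m) := ⟨hm⟩
  exact fun h => one_ne_zero (congrArg Prod.fst h)

theorem hasAlternatingPairs_gridAdj_of_dvd (h : m ∣ n) (hm : 2 ≤ m) (hn : 3 ≤ n) :
    HasAlternatingPairs (GridAdj m n) := by
  have : NeZero n := ⟨by omega⟩
  have : Fact (1 < m) := ⟨hm⟩
  have hΛ := addOrderOf_gridX_sub_gridY m n
  rw [Nat.lcm_eq_right h] at hΛ
  have hkey := fun {p q : ℕ} => hasAlternatingPairs_of_reaches (p := p) (q := q)
    (x := gridX m n) (y := gridY m n)
    (U := fun v => gridLevel h v ≠ 0 ∧ gridLevel h v ≠ 1) (U' := (gridLevel h · = 1))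
    (fun v => by rw [gridLevel_invariant]) (fun v => by rw [gridLevel_invariant])
    (fun hc => hc.1 (map_zero _)) (by rw [map_zero]; exact zero_ne_one)
    (fun v hv => by
      have := mt (mem_zmultiples_of_gridLevel_eq_zero h) hv
      tauto) (gridX_ne_gridY hm)
  rcases reaches_gridLevel_ne_or h hm with h1 | ⟨d, hd1, hdn, h1⟩
  · refine hkey (q := 0) (by omega) h1 (Or.inr (Or.inr ⟨by omega, rfl, ?_⟩))
    exact (reaches_gridLevel_eq_one_or h hm (by omega)).resolve_right (by omega)
  · refine hkey (q := n - 1 - d) (by omega) h1 ?_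
    rcases reaches_gridLevel_eq_one_or h hm (show n - 1 - d < n by omega) with h2 | h2
    · exact Or.inl ⟨hd1, by omega, h2⟩
    · exact Or.inr (Or.inl h2)

theorem hasAlternatingPairs_gridAdj_of_reaches (hm : 2 ≤ m) (hn : 2 ≤ n) (hmn : ¬ m ∣ n) {p q : ℕ}
    (hpq : p + q + 1 = Nat.lcm m n) (hq1 : n - 1 ≤ q) (hq2 : q ≤ 2 * n - 2)
    (h : Reaches (gridX m n) (gridY m n)
      (· ∉ AddSubgroup.zmultiples (gridX m n - gridY m n)) 0 p) :
    HasAlternatingPairs (GridAdj m n) := by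
  have : NeZero m := ⟨by omega⟩
  have : NeZero n := ⟨by omega⟩
  have hle := two_mul_le_lcm (n := n) (m := m) (by omega) (by omega) hmn
  refine hasAlternatingPairs_of_reaches
    (U := (· ∉ AddSubgroup.zmultiples (gridX m n - gridY m n))) (U' := fun _ => False)
    (zmultiples_invariant _) (fun _ => Iff.rfl) (not_not.2 (zero_mem _)) not_false
    (fun v hv => iff_of_false not_false (not_not.2 hv)) (gridX_ne_gridY hm)
    (hpq.trans (addOrderOf_gridX_sub_gridY m n).symm) h ?_
  rcases reaches_empty_or hn hmn hq1 hq2 with h2 | h2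
  · exact Or.inl ⟨by omega, by omega, h2⟩
  · exact Or.inr (Or.inl ⟨by omega, h2.2⟩)

theorem hasAlternatingPairs_gridAdj_or (hm : 2 ≤ m) (hn : 2 ≤ n) (h : ¬ (m = 2 ∧ n = 2)) :
    HasAlternatingPairs (GridAdj m n) ∨ HasAlternatingPairs (GridAdj n m) := by
  wlog hle : m ≤ n generalizing m n
  · exact (this hn hm (by tauto) (by omega)).symm
  have : NeZero m := ⟨by omega⟩
  have : NeZero n := ⟨by omega⟩
  by_cases hdvd : m ∣ n
  · exact Or.inl (hasAlternatingPairs_gridAdj_of_dvd hdvd hm (by omega))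
  rcases le_or_gt (2 * m) n with h2 | h2
  · obtain ⟨p, q, hpq, hq1, hq2, hp⟩ := exists_reaches_compl hdvd h2
    exact Or.inl (hasAlternatingPairs_gridAdj_of_reaches hm hn hdvd hpq hq1 hq2 hp)
  · have hne : m ≠ n := fun h => hdvd (h ▸ dvd_rfl)
    have hnm : ¬ n ∣ m := fun h => by
      have := Nat.le_of_dvd (by omega) h
      omega
    have := Nat.le_of_dvd (Nat.lcm_pos (NeZero.pos n) (NeZero.pos m)) (Nat.dvd_lcm_left n m)
    exact Or.inr (hasAlternatingPairs_gridAdj_of_reaches hn hm hnm (q := n - 1) (by omega)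
      (by omega) (by omega) reaches_compl_sub)

end Grid

/-- The Cartesian product of `r ≥ 4` directed cycles of lengths `n₁, …, n_r ≥ 2`, i.e. the
Cayley digraph of `ℤ_{n₁} × ⋯ × ℤ_{n_r}` with respect to the standard generators,
has two arc-disjoint hamiltonian paths. -/
theorem two_arc_disjoint_hamiltonian_paths_product (r : ℕ) (hr : 4 ≤ r)
    (n : Fin r → ℕ) (hn : ∀ i, 2 ≤ n i) :
    ∃ v v' : Fin (∏ i, n i) → (∀ i, ZMod (n i)),
      IsHamPathOn (Set.range fun i => Pi.single i (1 : ZMod (n i))) (∏ i, n i) v ∧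
      IsHamPathOn (Set.range fun i => Pi.single i (1 : ZMod (n i))) (∏ i, n i) v' ∧
      Disjoint (ArcSet (∏ i, n i) v) (ArcSet (∏ i, n i) v') := by
  by_cases h : ∀ i, n i = 2
  · exact exists_paths_of_forall_eq_two n h
  push Not at h
  obtain ⟨i, hi⟩ := h
  have : Nontrivial (Fin r) := Fin.nontrivial_iff_two_le.2 (by omega)
  obtain ⟨j, hij⟩ := exists_ne i
  rcases hasAlternatingPairs_gridAdj_or (hn i) (hn j) (by tauto) with h | h
  · exact h.exists_paths n hn hij
  · exact h.exists_paths n hn hij.symm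
end

section
/- Let m, n, r ≥ 2 be integers. If (i) at least one of the Cayley digraphs Cay(ℤ_m × ℤ_n; e₁, e₂), Cay(ℤ_m × ℤ_r; e₁, e₂), Cay(ℤ_n × ℤ_r; e₁, e₂) has a hamiltonian cycle, or (ii) m, n, r do not all have the same parity, or (iii) at least one of m, n, r equals 2, then the Cayley digraph Cay(ℤ_m × ℤ_n × ℤ_r; e₁, e₂, e₃) (the Cartesian product of directed cycles of lengths m, n, r) has two arc-disjoint hamiltonian paths. -/
/-- `u : ℤ_{pq} → ℤ_p × ℤ_q` is a hamiltonian cycle of `Cay(ℤ_p × ℤ_q; e₁, e₂)`. -/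
def IsHamCycle2 (p q : ℕ) (u : ZMod (p * q) → ZMod p × ZMod q) : Prop :=
  Function.Bijective u ∧
    ∀ i : ZMod (p * q), u (i + 1) - u i ∈ ({(1, 0), (0, 1)} : Set (ZMod p × ZMod q))

/-- `f 0, …, f (N - 1)` is a walk from `x` to `y` along the generators `a`, `b`
that visits every element. -/
structure IsTour {B : Type*} [AddCommGroup B] (a b : B) (N : ℕ) (x y : B) (f : ℕ → B) :
    Prop where
  start : f 0 = x
  finish : f (N - 1) = y
  surj : ∀ p, ∃ k < N, f k = p
  step : ∀ k, k + 1 < N → f (k + 1) - f k = a ∨ f (k + 1) - f k = b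

/-- There are arc-disjoint tours from `x` to `y` and from `x'` to `y'`. -/
def HasTours {B : Type*} [AddCommGroup B] (a b : B) (N : ℕ) (x x' y y' : B) : Prop :=
  ∃ f f' : ℕ → B, IsTour a b N x y f ∧ IsTour a b N x' y' f' ∧
    ∀ k l, k + 1 < N → l + 1 < N → f k = f' l → f (k + 1) ≠ f' (l + 1)

lemma HasTours.symm {B : Type*} [AddCommGroup B] {a b : B} {N : ℕ} {x x' y y' : B}
    (h : HasTours a b N x x' y y') : HasTours a b N x' x y' y := by
  obtain ⟨f, f', hf, hf', hd⟩ := h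
  exact ⟨f', f, hf', hf, fun k l hk hl h1 h2 => hd l k hl hk h1.symm h2.symm⟩

lemma succ_div_mod_cases {M : ℕ} (hM : 0 < M) (i : ℕ) :
    ((i + 1) / M = i / M + 1 ∧ (i + 1) % M = 0 ∧ i % M = M - 1) ∨
      ((i + 1) / M = i / M ∧ (i + 1) % M = i % M + 1) := by
  have h1 := Nat.div_add_mod i M
  have h2 := Nat.mod_lt i hM
  rcases Nat.lt_or_ge (i % M + 1) M with h | h
  · right
    have h3 : i + 1 = (i % M + 1) + M * (i / M) := by omega
    rw [h3, Nat.add_mul_div_left _ _ hM, Nat.add_mul_mod_self_left, Nat.div_eq_of_lt h,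
      Nat.mod_eq_of_lt h]
    simp
  · left
    have h3 : i + 1 = M * (i / M + 1) := by rw [mul_add]; omega
    rw [h3, Nat.mul_div_cancel_left _ hM, Nat.mul_mod_right]
    exact ⟨rfl, rfl, by omega⟩

/-- Running through tours of consecutive layers gives a hamiltonian path. -/
def layeredPath {m n : ℕ} (r M : ℕ) (f : ℕ → ℕ → ZMod m × ZMod n) (i : ℕ) :
    ZMod m × ZMod n × ZMod r :=
  ((f (i / M) (i % M)).1, (f (i / M) (i % M)).2, ((i / M : ℕ) : ZMod r))

lemma isHamPathOn_layeredPath {m n r : ℕ} (hm : 2 ≤ m) (hn : 2 ≤ n) (hr : 2 ≤ r)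
    (s : ℕ → ZMod m × ZMod n) (f : ℕ → ℕ → ZMod m × ZMod n)
    (hf : ∀ z, IsTour (1, 0) (0, 1) (m * n) (s z) (s (z + 1)) (f z)) :
    IsHamPathOn ({(1, 0, 0), (0, 1, 0), (0, 0, 1)} : Set (ZMod m × ZMod n × ZMod r))
      (m * n * r) (fun i => layeredPath r (m * n) f i) := by
  have hM : 0 < m * n := by positivity
  have : NeZero m := ⟨by omega⟩
  have : NeZero n := ⟨by omega⟩
  have : NeZero r := ⟨by omega⟩
  refine ⟨?_, ?_⟩
  · rw [Fintype.bijective_iff_surjective_and_card]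
    constructor
    · rintro ⟨p, q, z⟩
      obtain ⟨k, hk, hfk⟩ := (hf z.val).surj (p, q)
      have hz := ZMod.val_lt z
      refine ⟨⟨k + m * n * z.val, ?_⟩, ?_⟩
      · nlinarith
      · simp [layeredPath, Nat.add_mul_div_left _ _ hM, Nat.div_eq_of_lt hk,
          Nat.mod_eq_of_lt hk, hfk]
    · simp [ZMod.card, mul_assoc]
  · intro i h
    rcases succ_div_mod_cases hM i with ⟨h1, h2, h3⟩ | ⟨h1, h2⟩
    · have e1 := (hf (i / (m * n))).finish
      have e2 := (hf (i / (m * n) + 1)).start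
      simp [layeredPath, h1, h2, h3, e1, e2]
    · have h4 : i % (m * n) + 1 < m * n := by rw [← h2]; exact Nat.mod_lt _ hM
      have := (hf (i / (m * n))).step _ h4
      simp only [layeredPath, h1, h2]
      simp only [Prod.ext_iff, Prod.fst_sub, Prod.snd_sub] at this
      rcases this with ⟨e1, e2⟩ | ⟨e1, e2⟩ <;> simp [e1, e2]

theorem exists_paths_of_hasTours {m n r : ℕ} (hm : 2 ≤ m) (hn : 2 ≤ n) (hr : 2 ≤ r)
    (S : ZMod m × ZMod n → ZMod m × ZMod n → Prop) (hS0 : ∃ x x', S x x')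
    (hS : ∀ x x', S x x' → ∃ y y', S y y' ∧ y ≠ y' ∧
      HasTours ((1, 0) : ZMod m × ZMod n) (0, 1) (m * n) x x' y y') :
    ∃ v v' : Fin (m * n * r) → ZMod m × ZMod n × ZMod r,
      IsHamPathOn ({(1, 0, 0), (0, 1, 0), (0, 0, 1)} : Set (ZMod m × ZMod n × ZMod r))
        (m * n * r) v ∧
      IsHamPathOn ({(1, 0, 0), (0, 1, 0), (0, 0, 1)} : Set (ZMod m × ZMod n × ZMod r))
        (m * n * r) v' ∧
      Disjoint (ArcSet (m * n * r) v) (ArcSet (m * n * r) v') := by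
  have hM : 0 < m * n := by positivity
  have : Fact (1 < r) := ⟨hr⟩
  obtain ⟨x, x', hxx⟩ := hS0
  let T := {p : (ZMod m × ZMod n) × (ZMod m × ZMod n) // S p.1 p.2}
  have hT : ∀ q : T, ∃ q' : T, q'.1.1 ≠ q'.1.2 ∧
      HasTours ((1, 0) : ZMod m × ZMod n) (0, 1) (m * n) q.1.1 q.1.2 q'.1.1 q'.1.2 := by
    rintro ⟨⟨x, x'⟩, hx⟩
    obtain ⟨y, y', hy, hne, hL⟩ := hS x x' hx
    exact ⟨⟨(y, y'), hy⟩, hne, hL⟩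
  choose nx hne f f' hf hf' hd using hT
  let st : ℕ → T := fun k => nx^[k] ⟨(x, x'), hxx⟩
  have hst : ∀ k, st (k + 1) = nx (st k) := fun k => Function.iterate_succ_apply' _ _ _
  refine ⟨fun i => layeredPath r (m * n) (fun z => f (st z)) i,
    fun i => layeredPath r (m * n) (fun z => f' (st z)) i,
    isHamPathOn_layeredPath hm hn hr (fun z => (st z).1.1) _ fun z => ?_,
    isHamPathOn_layeredPath hm hn hr (fun z => (st z).1.2) _ fun z => ?_, ?_⟩
  · simpa only [hst] using hf (st z)
  · simpa only [hst] using hf' (st z)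
  · rw [Set.disjoint_left]
    rintro p ⟨i, hi, rfl⟩ ⟨j, hj, e⟩
    simp only [layeredPath, Prod.mk.injEq] at e
    obtain ⟨⟨e1, e2, e3⟩, e4, e5, e6⟩ := e
    have hlt : ∀ k, k < m * n * r → k / (m * n) < r := fun k hk =>
      Nat.div_lt_of_lt_mul hk
    have hinj : ∀ k l, k < m * n * r → l < m * n * r →
        ((k / (m * n) : ℕ) : ZMod r) = ((l / (m * n) : ℕ) : ZMod r) →
        k / (m * n) = l / (m * n) := by
      intro k l hk hl h
      have := (ZMod.natCast_eq_natCast_iff' _ _ _).1 h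
      rwa [Nat.mod_eq_of_lt (hlt k hk), Nat.mod_eq_of_lt (hlt l hl)] at this
    have h1 := hinj i j (by omega) (by omega) e3
    have h2 := hinj (i + 1) (j + 1) hi hj e6
    rw [← h1] at e1 e2
    rw [← h2] at e4 e5
    rcases succ_div_mod_cases hM i with ⟨h3, h4, h5⟩ | ⟨h3, h4⟩ <;>
      rcases succ_div_mod_cases hM j with ⟨h6, h7, h8⟩ | ⟨h6, h7⟩
    · rw [h5, h8, (hf _).finish, (hf' _).finish] at e2
      rw [h5, h8, (hf _).finish, (hf' _).finish] at e1
      exact hne _ (Prod.ext e1 e2)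
    · omega
    · omega
    · rw [h3, h4, h7] at e4 e5
      refine hd (st (i / (m * n))) (i % (m * n)) (j % (m * n)) ?_ ?_ (Prod.ext e1 e2)
        (Prod.ext e4 e5)
      · rw [← h4]; exact Nat.mod_lt _ hM
      · rw [← h7]; exact Nat.mod_lt _ hM

/-- The conclusion is symmetric in the first two factors. -/
theorem exists_paths_swap {m n r : ℕ}
    (h : ∃ v v' : Fin (n * m * r) → ZMod n × ZMod m × ZMod r,
      IsHamPathOn ({(1, 0, 0), (0, 1, 0), (0, 0, 1)} : Set (ZMod n × ZMod m × ZMod r))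
        (n * m * r) v ∧
      IsHamPathOn ({(1, 0, 0), (0, 1, 0), (0, 0, 1)} : Set (ZMod n × ZMod m × ZMod r))
        (n * m * r) v' ∧
      Disjoint (ArcSet (n * m * r) v) (ArcSet (n * m * r) v')) :
    ∃ v v' : Fin (m * n * r) → ZMod m × ZMod n × ZMod r,
      IsHamPathOn ({(1, 0, 0), (0, 1, 0), (0, 0, 1)} : Set (ZMod m × ZMod n × ZMod r))
        (m * n * r) v ∧
      IsHamPathOn ({(1, 0, 0), (0, 1, 0), (0, 0, 1)} : Set (ZMod m × ZMod n × ZMod r))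
        (m * n * r) v' ∧
      Disjoint (ArcSet (m * n * r) v) (ArcSet (m * n * r) v') := by
  rw [mul_comm n m] at h
  let σ : ZMod n × ZMod m × ZMod r → ZMod m × ZMod n × ZMod r := fun p => (p.2.1, p.1, p.2.2)
  have hσ : Function.Bijective σ :=
    Function.bijective_iff_has_inverse.2 ⟨fun p => (p.2.1, p.1, p.2.2), fun _ => rfl, fun _ => rfl⟩
  have key : ∀ v : Fin (m * n * r) → ZMod n × ZMod m × ZMod r,
      IsHamPathOn ({(1, 0, 0), (0, 1, 0), (0, 0, 1)} : Set (ZMod n × ZMod m × ZMod r))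
        (m * n * r) v →
      IsHamPathOn ({(1, 0, 0), (0, 1, 0), (0, 0, 1)} : Set (ZMod m × ZMod n × ZMod r))
        (m * n * r) (σ ∘ v) := by
    rintro v ⟨hv, hs⟩
    refine ⟨hσ.comp hv, fun i h => ?_⟩
    have := hs i h
    simp only [Set.mem_insert_iff, Set.mem_singleton_iff, Prod.ext_iff, Prod.fst_sub,
      Prod.snd_sub] at this
    simp only [Set.mem_insert_iff, Set.mem_singleton_iff, Prod.ext_iff, Prod.fst_sub,
      Prod.snd_sub, Function.comp, σ]
    tauto
  obtain ⟨v, v', hv, hv', hd⟩ := h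
  refine ⟨σ ∘ v, σ ∘ v', key v hv, key v' hv', ?_⟩
  rw [Set.disjoint_left] at hd ⊢
  rintro p ⟨i, hi, rfl⟩ ⟨j, hj, e⟩
  simp only [Prod.mk.injEq, Function.comp] at e
  exact hd ⟨i, hi, rfl⟩ ⟨j, hj, Prod.ext (hσ.1 e.1) (hσ.1 e.2)⟩

/-- If the number of special labels is `e = gcd M c - 1`, then the shift by `c` relates all labels
modulo `M`. -/
lemma labels_related_of_gcd {R : ℕ → ℕ → Prop} (hR : Equivalence R) {M c e : ℕ}
    (hM : 0 < M) (hg : Nat.gcd M c = e + 1)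
    (hS : ∀ t, e < t → t < M → R t ((t + c) % M))
    (hI : ∀ i < e, R (i + 1) ((i + c) % M)) :
    ∀ t < M, R t 0 := by
  have hgM : e + 1 ∣ M := hg ▸ Nat.gcd_dvd_left M c
  have hgc : e + 1 ∣ c := hg ▸ Nat.gcd_dvd_right M c
  have heM : e + 1 ≤ M := Nat.le_of_dvd hM hgM
  have hmodc : ∀ t, (t + c) % (e + 1) = t % (e + 1) := fun t => by
    obtain ⟨d, rfl⟩ := hgc
    exact Nat.add_mul_mod_self_left _ _ _
  -- every label is related to the label at most `e` in its class modulo `e + 1`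
  have reach : ∀ l t, t < M → (t + l * c) % M ≤ e → R t (t % (e + 1)) := by
    intro l
    induction l with
    | zero =>
      intro t ht h
      rw [zero_mul, add_zero, Nat.mod_eq_of_lt ht] at h
      rw [Nat.mod_eq_of_lt (by omega)]
      exact hR.refl _
    | succ l ih =>
      intro t ht h
      rcases Nat.lt_or_ge e t with h1 | h1
      · have h2 := ih ((t + c) % M) (Nat.mod_lt _ hM) (by
          rw [Nat.mod_add_mod]
          convert h using 2
          ring)
        rw [Nat.mod_mod_of_dvd _ hgM, hmodc] at h2
        exact hR.trans (hS t h1 ht) h2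
      · rw [Nat.mod_eq_of_lt (by omega)]
        exact hR.refl _
  have all : ∀ t < M, R t (t % (e + 1)) := by
    intro t ht
    have hlt : t % (e + 1) < e + 1 := Nat.mod_lt _ (by omega)
    obtain ⟨l, hl⟩ : ∃ l : ℕ, (t + l * c) ≡ t % (e + 1) [MOD M] := by
      obtain ⟨k, hk⟩ : ∃ k, t + k = t % (e + 1) + M * t ∧ e + 1 ∣ k := by
        have h1 := Nat.div_add_mod t (e + 1)
        have h2 : t ≤ M * t := Nat.le_mul_of_pos_left t hM
        refine ⟨t % (e + 1) + M * t - t, by omega, ?_⟩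
        rw [show t % (e + 1) + M * t - t = M * t - (e + 1) * (t / (e + 1)) by omega]
        exact Nat.dvd_sub (hgM.mul_right _) (Dvd.intro _ rfl)
      obtain ⟨q, rfl⟩ := hk.2
      rcases heM.eq_or_lt with h | h
      · refine ⟨0, ?_⟩
        rw [← h, zero_mul, add_zero]
        exact (Nat.mod_modEq _ _).symm
      · obtain ⟨x, -, hx⟩ := Nat.exists_mul_mod_eq_gcd (n := c) (k := M)
          (by rwa [Nat.gcd_comm, hg])
        rw [Nat.gcd_comm, hg] at hx
        refine ⟨x * q, ?_⟩
        have h1 : c * x ≡ e + 1 [MOD M] := by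
          rw [Nat.ModEq, hx, Nat.mod_eq_of_lt h]
        calc t + x * q * c = t + c * x * q := by ring
          _ ≡ t + (e + 1) * q [MOD M] := (h1.mul_right q).add_left t
          _ = t % (e + 1) + M * t := hk.1
          _ ≡ t % (e + 1) [MOD M] := by simp [Nat.ModEq]
    exact reach l t ht (by
      rw [Nat.ModEq] at hl
      rw [hl, Nat.mod_eq_of_lt (by omega)]
      omega)
  have hshift : ∀ i ≤ e, R ((i + c) % M) i := by
    intro i hi
    have := all ((i + c) % M) (Nat.mod_lt _ hM)
    rwa [Nat.mod_mod_of_dvd _ hgM, hmodc, Nat.mod_eq_of_lt (by omega : i < e + 1)] at this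
  have hsp : ∀ i ≤ e, R i 0 := by
    intro i
    induction i with
    | zero => intro _; exact hR.refl _
    | succ i ih =>
      intro hi
      exact hR.trans (hI i (by omega)) (hR.trans (hshift i (by omega)) (ih (by omega)))
  intro t ht
  exact hR.trans (all t ht) (hsp _ (by have := Nat.mod_lt t (by omega : 0 < e + 1); omega))

lemma labels_related_of_even {R : ℕ → ℕ → Prop} (hR : Equivalence R) {M e : ℕ}
    (he : Even e) (heM : e < M)
    (hS : ∀ t, e < t → t < M → R t ((t + (M - 1)) % M))
    (hI : ∀ i < e, R (i + 1) ((i + (M - 1)) % M)) :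
    ∀ t < M, R t 0 := by
  have hmod : ∀ t, 0 < t → t ≤ M → (t + (M - 1)) % M = t - 1 := by
    intro t h1 h2
    rw [show t + (M - 1) = (t - 1) + M by omega, Nat.add_mod_right, Nat.mod_eq_of_lt (by omega)]
  have heven : ∀ k, 2 * k ≤ e → R (2 * k) 0 := by
    intro k
    induction k with
    | zero => intro _; exact hR.refl _
    | succ k ih =>
      intro hk
      have := hI (2 * k + 1) (by omega)
      rw [hmod _ (by omega) (by omega)] at this
      exact hR.trans this (ih (by omega))
  have hge : ∀ k, e + k < M → R (e + k) 0 := by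
    intro k
    induction k with
    | zero =>
      intro _
      obtain ⟨j, rfl⟩ := he
      have := heven j (by omega)
      rwa [two_mul] at this
    | succ k ih =>
      intro hk
      have := hS (e + (k + 1)) (by omega) hk
      rw [hmod _ (by omega) (by omega)] at this
      exact hR.trans this (ih (by omega))
  have hodd : ∀ k, 2 * k + 1 ≤ e → R (2 * k + 1) 0 := by
    intro k
    induction k with
    | zero =>
      intro hk
      have := hI 0 (by omega)
      rw [Nat.zero_add (M - 1), Nat.mod_eq_of_lt (by omega)] at this
      have h2 := hge (M - 1 - e) (by omega)
      rw [show e + (M - 1 - e) = M - 1 by omega] at h2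
      rw [Nat.zero_add] at this ⊢
      exact hR.trans this h2
    | succ k ih =>
      intro hk
      have := hI (2 * (k + 1)) (by omega)
      rw [hmod _ (by omega) (by omega)] at this
      exact hR.trans this (ih (by omega))
  intro t ht
  rcases Nat.lt_or_ge t e with h | h
  · rcases Nat.even_or_odd' t with ⟨k, rfl | rfl⟩
    · exact heven k h.le
    · exact hodd k h.le
  · have := hge (t - e) (by omega)
    rwa [show e + (t - e) = t by omega] at this

/-- `π` is `φ` precomposed with the cyclic permutation `p L ↦ ⋯ ↦ p 1 ↦ p 0 ↦ p L`. -/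
structure IsShift {B : Type*} (φ : B → B) (p : ℕ → B) (L : ℕ) (π : B → B) : Prop where
  first : π (p 0) = φ (p L)
  succ : ∀ t < L, π (p (t + 1)) = φ (p t)
  off : ∀ x, (∀ t ≤ L, x ≠ p t) → π x = φ x

lemma exists_isShift {B : Type*} (φ : Equiv.Perm B) (p : ℕ → B) (L : ℕ)
    (hp : ∀ s t, s < t → t ≤ L → p s ≠ p t) : ∃ π : Equiv.Perm B, IsShift φ p L π := by
  classical
  induction L with
  | zero => exact ⟨φ, rfl, fun t ht => absurd ht (Nat.not_lt_zero t), fun _ _ => rfl⟩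
  | succ L ih =>
    obtain ⟨π, h1, h2, h3⟩ := ih fun s t h h' => hp s t h (by omega)
    refine ⟨(Equiv.swap (p 0) (p (L + 1))).trans π, ?_, fun t ht => ?_, fun x hx => ?_⟩
    · simp only [Equiv.trans_apply, Equiv.swap_apply_left]
      exact h3 _ fun t ht => (hp t (L + 1) (by omega) le_rfl).symm
    · simp only [Equiv.trans_apply]
      rcases Nat.lt_succ_iff_lt_or_eq.1 ht with h | rfl
      · rw [Equiv.swap_apply_of_ne_of_ne (hp 0 (t + 1) (by omega) (by omega)).symm
          (hp (t + 1) (L + 1) (by omega) le_rfl), h2 t h]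
      · rw [Equiv.swap_apply_right, h1]
    · simp only [Equiv.trans_apply]
      rw [Equiv.swap_apply_of_ne_of_ne (hx 0 (by omega)) (hx (L + 1) le_rfl),
        h3 x fun t ht => hx t (by omega)]

lemma exists_pow_apply_eq {B : Type*} [Fintype B] {π : Equiv.Perm B}
    (h : ∀ p q, π.SameCycle p q) (x : B) : ∀ p, ∃ k < Fintype.card B, (π ^ k) x = p := by
  classical
  intro p
  have hc : π.IsCycleOn (Finset.univ : Finset B) :=
    ⟨by simp, fun p _ q _ => h p q⟩
  exact hc.exists_pow_eq (Finset.mem_univ x) (Finset.mem_univ p)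

lemma HasTours.add_right {B : Type*} [AddCommGroup B] {a b : B} {N : ℕ}
    {x x' y y' : B} (h : HasTours a b N x x' y y') (c : B) :
    HasTours a b N (x + c) (x' + c) (y + c) (y' + c) := by
  obtain ⟨f, f', hf, hf', hd⟩ := h
  have key : ∀ {f : ℕ → B} {x y : B}, IsTour a b N x y f →
      IsTour a b N (x + c) (y + c) (fun k => f k + c) := fun {f x y} hf =>
    ⟨by rw [hf.start], by rw [hf.finish], fun p => by
      obtain ⟨k, hk, h⟩ := hf.surj (p - c)
      exact ⟨k, hk, by rw [h, sub_add_cancel]⟩, fun k hk => by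
        rw [add_sub_add_right_eq_sub]; exact hf.step k hk⟩
  refine ⟨_, _, key hf, key hf', fun k l hk hl e e' => ?_⟩
  exact hd k l hk hl (add_right_cancel e) (add_right_cancel e')

section Tours

variable {B : Type*} [AddCommGroup B] [Fintype B] {a b : B}

lemma isTour_of_perm {π : Equiv.Perm B} (h : ∀ p q, π.SameCycle p q) {x y : B} (hy : π y = x)
    (hs : ∀ p, p ≠ y → π p = p + a ∨ π p = p + b) :
    IsTour a b (Fintype.card B) x y (fun k => (π ^ k) x) ∧
      ∀ k, k + 1 < Fintype.card B → (π ^ k) x ≠ y := by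
  have hsurj := exists_pow_apply_eq h x
  have hinj : ∀ k l, k < Fintype.card B → l < Fintype.card B → (π ^ k) x = (π ^ l) x → k = l := by
    have : Function.Bijective (fun k : Fin (Fintype.card B) => (π ^ (k : ℕ)) x) := by
      rw [Fintype.bijective_iff_surjective_and_card]
      refine ⟨fun p => ?_, by simp⟩
      obtain ⟨k, hk, h⟩ := hsurj p
      exact ⟨⟨k, hk⟩, h⟩
    intro k l hk hl h
    exact Fin.mk.inj_iff.1 (this.1 (a₁ := ⟨k, hk⟩) (a₂ := ⟨l, hl⟩) h)
  have hfin : ∀ k < Fintype.card B, (π ^ k) x = y → k + 1 = Fintype.card B := by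
    intro k hk h
    by_contra hne
    have := hinj (k + 1) 0 (by omega) (by omega)
      (by rw [pow_succ', Equiv.Perm.mul_apply, h, hy]; simp)
    omega
  have hne : ∀ k, k + 1 < Fintype.card B → (π ^ k) x ≠ y := fun k hk h => by
    have := hfin k (by omega) h
    omega
  refine ⟨⟨by simp, ?_, hsurj, fun k hk => ?_⟩, hne⟩
  · obtain ⟨k, hk, h⟩ := hsurj y
    rw [← hfin k hk h, Nat.add_sub_cancel, h]
  · rw [pow_succ', Equiv.Perm.mul_apply, sub_eq_iff_eq_add', sub_eq_iff_eq_add']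
    exact hs _ (hne k hk)

lemma hasTours_of_perms {π π' : Equiv.Perm B} (h : ∀ p q, π.SameCycle p q)
    (h' : ∀ p q, π'.SameCycle p q) {x y x' y' : B} (hy : π y = x) (hy' : π' y' = x')
    (hs : ∀ p, p ≠ y → π p = p + a ∨ π p = p + b)
    (hs' : ∀ p, p ≠ y' → π' p = p + a ∨ π' p = p + b)
    (hd : ∀ p, p ≠ y → p ≠ y' → π p ≠ π' p) :
    HasTours a b (Fintype.card B) x x' y y' := by
  obtain ⟨h1, h2⟩ := isTour_of_perm h hy hs
  obtain ⟨h3, h4⟩ := isTour_of_perm h' hy' hs'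
  refine ⟨_, _, h1, h3, fun k l hk hl e => ?_⟩
  simp only [pow_succ', Equiv.Perm.mul_apply] at e ⊢
  rw [← e]
  exact hd _ (h2 k hk) (e ▸ h4 l hl)

lemma hasTours_of_isShift {φ ψ : B → B}
    (hφ : ∀ x, (φ x = x + a ∧ ψ x = x + b) ∨ (φ x = x + b ∧ ψ x = x + a))
    (hu : ∀ k : ℤ, φ (k • (a - b)) = k • (a - b) + a ∧ ψ (k • (a - b)) = k • (a - b) + b)
    {L L' : ℕ} (hL : L ≤ L') (hL' : L' ≤ L + 1) (hab : a ≠ b)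
    {π π' : Equiv.Perm B} (h : ∀ p q, π.SameCycle p q) (h' : ∀ p q, π'.SameCycle p q)
    {i : ℕ} (hi : i = L' ∨ i = L + 1)
    (hπ : IsShift φ (fun t => t • (a - b)) L π)
    (hπ' : IsShift ψ (fun t => i • (a - b) - t • (a - b)) L' π') :
    HasTours a b (Fintype.card B) (L • (a - b) + a) (i • (a - b) - L' • (a - b) + b)
      0 (i • (a - b)) := by
  have hun : ∀ k : ℕ, φ (k • (a - b)) = k • (a - b) + a := fun k => by
    simpa using (hu k).1
  have hun' : ∀ k : ℕ, ψ (i • (a - b) - k • (a - b)) = i • (a - b) - k • (a - b) + b := fun k => by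
    simpa [sub_smul] using (hu (i - k)).2
  -- on its inner special points `π` uses `b`, and `π'` uses `a`
  have hin : ∀ t < L, π ((t + 1) • (a - b)) = (t + 1) • (a - b) + b := fun t ht => by
    rw [hπ.succ t ht, hun, succ_nsmul]; abel
  have hin' : ∀ t < L', π' (i • (a - b) - (t + 1) • (a - b)) =
      i • (a - b) - (t + 1) • (a - b) + a := fun t ht => by
    rw [hπ'.succ t ht, hun', succ_nsmul]; abel
  have hidx : ∀ t ≤ i, t • (a - b) = i • (a - b) - (i - t) • (a - b) := fun t ht => by
    rw [eq_sub_iff_add_eq, ← add_smul]; congr 1; omega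
  have hπc : ∀ x, x ≠ 0 → (π x = x + b ∧ ∃ t < L, x = (t + 1) • (a - b)) ∨
      (π x = φ x ∧ ∀ t ≤ L, x ≠ t • (a - b)) := by
    intro x hx
    by_cases hx' : ∀ t ≤ L, x ≠ t • (a - b)
    · exact Or.inr ⟨hπ.off x hx', hx'⟩
    · push Not at hx'
      obtain ⟨t, ht, rfl⟩ := hx'
      rcases t with _ | t
      · simp at hx
      · exact Or.inl ⟨hin t (by omega), t, by omega, rfl⟩
  have hπc' : ∀ x, x ≠ i • (a - b) →
      (π' x = x + a ∧ ∃ t < L', x = i • (a - b) - (t + 1) • (a - b)) ∨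
      (π' x = ψ x ∧ ∀ t ≤ L', x ≠ i • (a - b) - t • (a - b)) := by
    intro x hx
    by_cases hx' : ∀ t ≤ L', x ≠ i • (a - b) - t • (a - b)
    · exact Or.inr ⟨hπ'.off x hx', hx'⟩
    · push Not at hx'
      obtain ⟨t, ht, rfl⟩ := hx'
      rcases t with _ | t
      · simp at hx
      · exact Or.inl ⟨hin' t (by omega), t, by omega, rfl⟩
  refine hasTours_of_perms h h' ?_ ?_ (fun p hp => ?_) (fun p hp => ?_) (fun p hp hp' e => ?_)
  · have := hπ.first
    rw [hun] at this
    simpa using this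
  · have := hπ'.first
    rw [hun'] at this
    simpa using this
  · rcases hπc p hp with h | h
    · exact Or.inr h.1
    · rcases hφ p with h3 | h3 <;> simp [h.1, h3.1]
  · rcases hπc' p hp with h | h
    · exact Or.inl h.1
    · rcases hφ p with h3 | h3 <;> simp [h.1, h3.2]
  · rcases hπc p hp with ⟨h1, t, ht, h2⟩ | ⟨h1, h2⟩ <;>
      rcases hπc' p hp' with ⟨h3, s, hs, h4⟩ | ⟨h3, h4⟩
    · rw [h1, h3] at e
      exact hab (add_left_cancel e).symm
    · exact h4 (i - (t + 1)) (by omega) (h2.trans (hidx (t + 1) (by omega)))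
    · refine h2 (i - (s + 1)) (by omega) (h4.trans ?_)
      rw [hidx (i - (s + 1)) (by omega), show i - (i - (s + 1)) = s + 1 by omega]
    · rw [h1, h3] at e
      rcases hφ p with h5 | h5 <;> rw [h5.1, h5.2] at e
      · exact hab (add_left_cancel e)
      · exact hab (add_left_cancel e).symm

theorem exists_hasTours_of_transitive {φ ψ : Equiv.Perm B}
    (hφ : ∀ x, (φ x = x + a ∧ ψ x = x + b) ∨ (φ x = x + b ∧ ψ x = x + a))
    (hu : ∀ k : ℤ, φ (k • (a - b)) = k • (a - b) + a ∧ ψ (k • (a - b)) = k • (a - b) + b)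
    {L L' : ℕ} (hL : L ≤ L') (hL' : L' ≤ L + 1) (hpos : 0 < L')
    (hord : ∀ k : ℕ, 0 < k → k ≤ L + 1 → k • (a - b) ≠ 0)
    (hP : ∀ π : Equiv.Perm B, IsShift φ (fun t => t • (a - b)) L π → ∀ p q, π.SameCycle p q)
    (hP' : ∀ (i : ℕ) (π : Equiv.Perm B),
      IsShift ψ (fun t => i • (a - b) - t • (a - b)) L' π → ∀ p q, π.SameCycle p q)
    (x x' : B) (hx : x' - x = -((L + 1) • (a - b)) ∨ x' - x = L' • (a - b)) :
    ∃ y y', (y' - y = -((L + 1) • (a - b)) ∨ y' - y = L' • (a - b)) ∧ y ≠ y' ∧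
      HasTours a b (Fintype.card B) x x' y y' := by
  have hab : a ≠ b := fun h => hord 1 one_pos (by omega) (by simp [h])
  have hlt : ∀ s t, s < t → t ≤ L + 1 → s • (a - b) ≠ t • (a - b) := by
    intro s t hst ht e
    refine hord (t - s) (by omega) (by omega) ?_
    rw [sub_nsmul _ hst.le, e, add_neg_cancel]
  obtain ⟨π, hπ⟩ := exists_isShift φ (fun t => t • (a - b)) L
    fun s t hst ht => hlt s t hst (by omega)
  have hex : ∀ i : ℕ, ∃ π' : Equiv.Perm B, IsShift ψ (fun t => i • (a - b) - t • (a - b)) L' π' :=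
    fun i => exists_isShift ψ _ L' fun s t hst ht e =>
      hlt s t hst (by omega) (sub_right_injective e)
  have hmk : ∀ i, i = L' ∨ i = L + 1 → HasTours a b (Fintype.card B) (L • (a - b) + a)
      (i • (a - b) - L' • (a - b) + b) 0 (i • (a - b)) := fun i hi => by
    obtain ⟨π', hπ'⟩ := hex i
    exact hasTours_of_isShift hφ hu hL hL' hab (hP π hπ) (hP' i π' hπ') hi hπ hπ'
  rcases hx with hx | hx
  · have key := (hmk L' (Or.inl rfl)).add_right (x - (L • (a - b) + a))
    rw [show L • (a - b) + a + (x - (L • (a - b) + a)) = x by abel,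
      show L' • (a - b) - L' • (a - b) + b + (x - (L • (a - b) + a)) = x' by
        rw [sub_eq_iff_eq_add] at hx
        rw [hx, succ_nsmul]; abel] at key
    refine ⟨_, _, Or.inr ?_, ?_, key⟩
    · abel
    · simpa [eq_comm] using hord L' hpos hL'
  · have key := ((hmk (L + 1) (Or.inr rfl)).add_right (x' - (L • (a - b) + a))).symm
    rw [show L • (a - b) + a + (x' - (L • (a - b) + a)) = x' by abel,
      show (L + 1) • (a - b) - L' • (a - b) + b + (x' - (L • (a - b) + a)) = x by
        rw [sub_eq_iff_eq_add] at hx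
        rw [hx, succ_nsmul]; abel] at key
    refine ⟨_, _, Or.inl ?_, ?_, key⟩
    · abel
    · simpa using hord (L + 1) (by omega) le_rfl

end Tours

section Labels

variable {B : Type*} {π : Equiv.Perm B}

/-- Labels of the special points are related as soon as the runs between them are known. -/
lemma label_relations {F G : ℕ → B} {M e q : ℕ} (hq : 0 < q) (heM : e < M)
    (hF : ∀ t, t + 1 < M + e → π.SameCycle (F (t + 1)) (G t))
    (run1 : ∀ k < e, π.SameCycle (G k) (F (M + k)))
    (run2 : ∀ k < e, π.SameCycle (G (M + k)) (F ((k + q) % M)))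
    (run3 : ∀ k, e ≤ k → k < M → π.SameCycle (G k) (F ((k + q) % M))) :
    (∀ t, e < t → t < M → π.SameCycle (F t) (F ((t + (q - 1)) % M))) ∧
      (∀ i < e, π.SameCycle (F (i + 1)) (F ((i + (q - 1)) % M))) ∧
      ∀ t < M + e, ∃ t' < M, π.SameCycle (F t) (F t') := by
  have hM : 0 < M := by omega
  have top : ∀ i < e, π.SameCycle (F (M + i)) (F ((i + (q - 1)) % M)) := by
    intro i hi
    rcases i with _ | i
    · have h1 := hF (M - 1) (by omega)
      have h2 := run3 (M - 1) (by omega) (by omega)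
      rw [show M - 1 + 1 = M by omega] at h1
      rw [show M - 1 + q = q - 1 + M by omega, Nat.add_mod_right] at h2
      simpa using h1.trans h2
    · have h2 := run2 i (by omega)
      rw [show i + q = i + 1 + (q - 1) by omega] at h2
      exact (hF (M + i) (by omega)).trans h2
  refine ⟨fun t h1 h2 => ?_, fun i hi => ?_, fun t ht => ?_⟩
  · obtain ⟨t, rfl⟩ : ∃ k, t = k + 1 := ⟨t - 1, by omega⟩
    have h3 := run3 t (by omega) (by omega)
    rw [show t + q = t + 1 + (q - 1) by omega] at h3
    exact (hF t (by omega)).trans h3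
  · exact ((hF i (by omega)).trans (run1 i hi)).trans (top i hi)
  · rcases Nat.lt_or_ge t M with h | h
    · exact ⟨t, h, .refl _ _⟩
    · obtain ⟨i, rfl⟩ := Nat.exists_eq_add_of_le h
      exact ⟨_, Nat.mod_lt _ hM, top i (by omega)⟩

lemma sameCycle_of_labels {F : ℕ → B} {M e c : ℕ} (heM : e < M)
    (hc : Nat.gcd M c = e + 1 ∨ Even e ∧ c = M - 1)
    (hS : ∀ t, e < t → t < M → π.SameCycle (F t) (F ((t + c) % M)))
    (hI : ∀ i < e, π.SameCycle (F (i + 1)) (F ((i + c) % M)))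
    (hcov : ∀ x, ∃ t < M, π.SameCycle x (F t)) : ∀ x y, π.SameCycle x y := by
  have hR : Equivalence fun s t => π.SameCycle (F s) (F t) :=
    ⟨fun _ => .refl _ _, fun h => h.symm, fun h h' => h.trans h'⟩
  have key : ∀ t < M, π.SameCycle (F t) (F 0) := by
    rcases hc with hc | ⟨he, rfl⟩
    · exact labels_related_of_gcd hR (by omega) hc hS hI
    · exact labels_related_of_even hR he heM hS hI
  intro x y
  obtain ⟨s, hs, hx⟩ := hcov x
  obtain ⟨t, ht, hy⟩ := hcov y
  exact (hx.trans (key s hs)).trans (hy.trans (key t ht)).symm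

end Labels

section Grid

variable {B : Type*} [AddCommGroup B] {s s' : B} {h q : ℕ}

/-- `s` and `s'` are independent of orders `h` and `q`, and generate. -/
structure IsGrid (s s' : B) (h q : ℕ) : Prop where
  zero_iff : ∀ i j : ℤ, i • s + j • s' = 0 ↔ (h : ℤ) ∣ i ∧ (q : ℤ) ∣ j
  gen : ∀ x, ∃ i j : ℤ, x = i • s + j • s'

lemma IsGrid.swap (hg : IsGrid s s' h q) : IsGrid s' s q h :=
  ⟨fun i j => by rw [add_comm, hg.zero_iff, and_comm], fun x => by
    obtain ⟨i, j, rfl⟩ := hg.gen x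
    exact ⟨j, i, add_comm _ _⟩⟩

lemma IsGrid.zsmul_sub_eq_zero_iff (hg : IsGrid s s' h q) (k : ℤ) :
    k • (s - s') = 0 ↔ (h : ℤ) ∣ k ∧ (q : ℤ) ∣ k := by
  rw [show k • (s - s') = k • s + (-k) • s' by rw [smul_sub, neg_smul, sub_eq_add_neg],
    hg.zero_iff, dvd_neg]

lemma IsGrid.diagonal_eq_iff (hg : IsGrid s s' h q) (w : B) (k t i : ℕ) :
    w + k • (s - s') + i • s = w + t • (s - s') ↔
      ∃ y z : ℤ, (t : ℤ) = k + q * y ∧ (i : ℤ) = q * y + h * z := by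
  have key : w + k • (s - s') + i • s = w + t • (s - s') ↔
      ((i : ℤ) + k - t) • s + ((t : ℤ) - k) • s' = 0 := by
    rw [← sub_eq_zero]
    refine Eq.congr_left ?_
    simp only [sub_smul, add_smul, smul_sub, natCast_zsmul]
    abel
  rw [key, hg.zero_iff]
  constructor
  · rintro ⟨⟨z, hz⟩, y, hy⟩
    exact ⟨y, z, by omega, by omega⟩
  · rintro ⟨y, z, h1, h2⟩
    exact ⟨⟨z, by omega⟩, y, by omega⟩

variable {π : Equiv.Perm B} {w : B} {L : ℕ}

lemma sameCycle_run (hg : IsGrid s s' h q)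
    (hπ : IsShift (· + s) (fun t => w + t • (s - s')) L π) {k l t : ℕ} (hl : 0 < l)
    (hno : ∀ i y z : ℤ, 0 < i → i < l → i = q * y + h * z → 0 ≤ k + q * y → k + q * y ≤ L → False)
    (ht : ∃ y z : ℤ, (t : ℤ) = k + q * y ∧ (l : ℤ) = q * y + h * z) :
    π.SameCycle (w + k • (s - s') + s) (w + t • (s - s')) := by
  rw [← (hg.diagonal_eq_iff w k t l).2 ht]
  have key : ∀ i : ℕ, i + 1 ≤ l →
      π.SameCycle (w + k • (s - s') + s) (w + k • (s - s') + (i + 1) • s) := by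
    intro i
    induction i with
    | zero => intro _; simpa using Equiv.Perm.SameCycle.refl _ _
    | succ i ih =>
      intro hi
      have h1 : π (w + k • (s - s') + (i + 1) • s) = w + k • (s - s') + (i + 1 + 1) • s := by
        rw [hπ.off, succ_nsmul _ (i + 1), add_assoc]
        rintro t ht e
        obtain ⟨y, z, h1, h2⟩ := (hg.diagonal_eq_iff w k t (i + 1)).1 e
        exact hno _ y z (by omega) (by omega) h2 (by omega) (by omega)
      rw [← h1]
      exact (ih (by omega)).trans ((Equiv.Perm.SameCycle.refl _ _).apply_right)
  obtain ⟨i, rfl⟩ : ∃ i, l = i + 1 := ⟨l - 1, by omega⟩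
  exact key i le_rfl

lemma sameCycle_reach (hg : IsGrid s s' h q) (hh : 0 < h) (hq : 0 < q) (hL : q ≤ L + 1)
    (hπ : IsShift (· + s) (fun t => w + t • (s - s')) L π) (x : B) :
    ∃ t ≤ L, π.SameCycle x (w + t • (s - s')) := by
  have key : ∀ (k : ℕ) (x : B), (∃ t ≤ L, x + k • s = w + t • (s - s')) →
      ∃ t ≤ L, π.SameCycle x (w + t • (s - s')) := by
    intro k
    induction k with
    | zero =>
      rintro x ⟨t, ht, e⟩
      exact ⟨t, ht, by rw [← e, zero_smul, add_zero]⟩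
    | succ k ih =>
      rintro x ⟨t, ht, e⟩
      by_cases hx : ∀ t ≤ L, x ≠ w + t • (s - s')
      · obtain ⟨t', ht', hc⟩ := ih (x + s) ⟨t, ht, by rw [← e, succ_nsmul]; abel⟩
        refine ⟨t', ht', ?_⟩
        rw [← hπ.off x hx] at hc
        exact Equiv.Perm.sameCycle_apply_left.1 hc
      · push Not at hx
        obtain ⟨t, ht, rfl⟩ := hx
        exact ⟨t, ht, .refl _ _⟩
  obtain ⟨i, j, hx⟩ := hg.gen (x - w)
  have hq' : (0 : ℤ) < q := by exact_mod_cast hq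
  have hh' : (0 : ℤ) < h := by exact_mod_cast hh
  have h1 := Int.emod_nonneg (-j) hq'.ne'
  have h2 := Int.emod_lt_of_pos (-j) hq'
  obtain ⟨t, ht⟩ := Int.eq_ofNat_of_zero_le h1
  have h3 := Int.emod_nonneg (t - i) hh'.ne'
  obtain ⟨k, hk⟩ := Int.eq_ofNat_of_zero_le h3
  refine key k x ⟨t, by omega, ?_⟩
  rw [← sub_eq_zero, show x + k • s - (w + t • (s - s')) = (i + k - t) • s + (j + t) • s' by
    rw [show x = w + (x - w) by abel, hx]
    simp only [sub_smul, add_smul, smul_sub, natCast_zsmul]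
    abel, hg.zero_iff]
  constructor
  · rw [← hk, Int.emod_def]
    exact ⟨-((t - i) / h), by ring⟩
  · rw [← ht, Int.emod_def]
    exact ⟨-(-j / q), by ring⟩

end Grid

section Grid

variable {B : Type*} [AddCommGroup B] {s s' : B} {h q : ℕ} {π : Equiv.Perm B} {w : B}

lemma transitive_of_runs (hg : IsGrid s s' h q) (hh : 0 < h) (hq : 0 < q) {M e : ℕ}
    (hqM : q ≤ M) (heM : e < M)
    (hc : Nat.gcd M (q - 1) = e + 1 ∨ Even e ∧ q - 1 = M - 1)
    (hπ : IsShift (· + s) (fun t => w + t • (s - s')) (M + e - 1) π)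
    (run1 : ∀ k < e, π.SameCycle (w + k • (s - s') + s) (w + (M + k) • (s - s')))
    (run2 : ∀ k < e, π.SameCycle (w + (M + k) • (s - s') + s) (w + ((k + q) % M) • (s - s')))
    (run3 : ∀ k, e ≤ k → k < M →
      π.SameCycle (w + k • (s - s') + s) (w + ((k + q) % M) • (s - s'))) :
    ∀ x y, π.SameCycle x y := by
  obtain ⟨hS, hI, htop⟩ := label_relations (F := fun t => w + t • (s - s'))
    (G := fun t => w + t • (s - s') + s) hq heM (fun t ht => by
      have := hπ.succ t (by omega)
      rw [← this]
      exact (Equiv.Perm.SameCycle.refl _ _).apply_right) run1 run2 run3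
  refine sameCycle_of_labels heM hc hS hI fun x => ?_
  obtain ⟨t, ht, h1⟩ := sameCycle_reach hg hh hq (by omega) hπ x
  obtain ⟨t', ht', h2⟩ := htop t (by omega)
  exact ⟨t', ht', h1.trans h2⟩

lemma transitive_of_not_dvd (hg : IsGrid s s' h q) (hh : 0 < h) (hhq : ¬ h ∣ q) {e : ℕ}
    (heq : e < q) (he : Even e)
    (hπ : IsShift (· + s) (fun t => w + t • (s - s')) (q + e - 1) π) :
    ∀ x y, π.SameCycle x y := by
  have h1 := Nat.div_add_mod q h
  have h2 := Nat.mod_lt q hh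
  have h3 : 0 < q % h := Nat.pos_of_ne_zero fun h0 => hhq (Nat.dvd_of_mod_eq_zero h0)
  set ρ := q % h
  set κ := q / h
  zify at h1
  have hh' : (1 : ℤ) ≤ h := by exact_mod_cast hh
  have hq' : (1 : ℤ) ≤ q := by omega
  -- a multiple of `h` is either nonpositive or at least `h`
  have hmul : ∀ z : ℤ, h * z ≤ -h ∨ h * z = 0 ∨ h ≤ h * z := fun z => by
    rcases lt_trichotomy z 0 with hz | rfl | hz
    · left; nlinarith
    · simp
    · right; right; nlinarith
  have hqmul : ∀ y : ℤ, q * y ≤ -(2 * q) ∨ q * y = -q ∨ q * y = 0 ∨ q * y = q ∨ 2 * q ≤ q * y := by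
    intro y
    rcases (by omega : y ≤ -2 ∨ y = -1 ∨ y = 0 ∨ y = 1 ∨ 2 ≤ y) with hy | rfl | rfl | rfl | hy
    · left; nlinarith
    · simp
    · simp
    · simp
    · right; right; right; right; nlinarith
  refine transitive_of_runs hg hh (by omega) le_rfl heq (Or.inr ⟨he, rfl⟩) hπ
    (fun k hk => ?_) (fun k hk => ?_) (fun k hk hk' => ?_)
  · refine sameCycle_run hg hπ (l := ρ) h3 ?_ ⟨1, -κ, by push_cast; ring, by linarith⟩
    intro i y z hi hi' hiy h4 h5
    have h6 := hqmul y
    have h7 := hmul z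
    have h8 := hmul (z + κ)
    rw [mul_add] at h8
    omega
  · rw [Nat.add_mod_right, Nat.mod_eq_of_lt (by omega)]
    refine sameCycle_run hg hπ (l := h - ρ) (by omega) ?_
      ⟨-1, κ + 1, by push_cast; ring, by rw [mul_add]; omega⟩
    intro i y z hi hi' hiy h4 h5
    have h6 := hqmul y
    have h7 := hmul z
    have h8 := hmul (z - κ)
    rw [mul_sub] at h8
    omega
  · rw [Nat.add_mod_right, Nat.mod_eq_of_lt (by omega)]
    refine sameCycle_run hg hπ (l := h) hh ?_ ⟨0, 1, by ring, by ring⟩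
    intro i y z hi hi' hiy h4 h5
    have h6 := hqmul y
    have h7 := hmul z
    omega

lemma transitive_of_lt_of_lt (hg : IsGrid s s' h q) {Z e : ℕ} (hq : 0 < q)
    (hZ : (Z + 1) * q < h) (hZ' : h < (Z + 2) * q)
    (heq : e < q) (hc : Nat.gcd ((Z + 2) * q) (q - 1) = e + 1)
    (hπ : IsShift (· + s) (fun t => w + t • (s - s')) ((Z + 2) * q + e - 1) π) :
    ∀ x y, π.SameCycle x y := by
  have hM : (Z + 2) * q = (Z + 1) * q + q := by ring
  have hA : q ≤ (Z + 1) * q := Nat.le_mul_of_pos_left q (by omega)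
  obtain ⟨A, hAdef⟩ : ∃ A : ℕ, A = (Z + 1) * q := ⟨_, rfl⟩
  rw [hM] at hπ hc hZ'
  rw [← hAdef] at hπ hc hZ hZ' hA
  zify at hAdef
  have hh' : (1 : ℤ) ≤ h := by omega
  have hq' : (1 : ℤ) ≤ q := by omega
  have hqA : (q : ℤ) * (Z + 1) = A := by rw [hAdef]; ring
  have hmul : ∀ z : ℤ, h * z ≤ -(2 * h) ∨ h * z = -h ∨ h * z = 0 ∨ h * z = h ∨ 2 * h ≤ h * z := by
    intro z
    rcases (by omega : z ≤ -2 ∨ z = -1 ∨ z = 0 ∨ z = 1 ∨ 2 ≤ z) with hz | rfl | rfl | rfl | hz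
    · left; nlinarith
    · simp
    · simp
    · simp
    · right; right; right; right; nlinarith
  have hqmul : ∀ y : ℤ, q * y ≤ -A - 2 * q ∨ q * y = -A - q ∨ q * y = -A ∨
      (-A + q ≤ q * y ∧ q * y ≤ -q) ∨ q * y = 0 ∨ (q ≤ q * y ∧ q * y ≤ A - q) ∨
      q * y = A ∨ q * y = A + q ∨ A + 2 * q ≤ q * y := fun y => by
    rw [← hqA]
    rcases (by omega : y ≤ -(Z + 1) - 2 ∨ y = -(Z + 1) - 1 ∨ y = -(Z + 1) ∨
      (-(Z + 1) + 1 ≤ y ∧ y ≤ -1) ∨ y = 0 ∨ (1 ≤ y ∧ y ≤ Z) ∨ y = Z + 1 ∨ y = Z + 1 + 1 ∨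
      Z + 1 + 2 ≤ y) with hy | rfl | rfl | hy | rfl | hy | rfl | rfl | hy
    · left; nlinarith
    · right; left; ring
    · right; right; left; ring
    · right; right; right; left; constructor <;> nlinarith
    · simp
    · right; right; right; right; right; left; constructor <;> nlinarith
    · simp
    · right; right; right; right; right; right; right; left; ring
    · right; right; right; right; right; right; right; right; nlinarith
  refine transitive_of_runs hg (by omega) (by omega) (Nat.le_add_left q A) (by omega) (Or.inl hc) hπ
    (fun k hk => ?_) (fun k hk => ?_) (fun k hk hk' => ?_)
  · refine sameCycle_run hg hπ (l := A + q - h) (by omega) ?_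
      ⟨Z + 1 + 1, -1, by rw [mul_add, hqA]; omega, by rw [mul_add, hqA]; omega⟩
    intro i y z hi hi' hiy h4 h5
    have h6 := hqmul y
    have h7 := hmul z
    omega
  · rw [Nat.mod_eq_of_lt (by omega)]
    refine sameCycle_run hg hπ (l := h - A) (by omega) ?_
      ⟨-(Z + 1), 1, by rw [mul_neg, hqA]; omega, by rw [mul_neg, hqA]; omega⟩
    intro i y z hi hi' hiy h4 h5
    have h6 := hqmul y
    have h7 := hmul z
    omega
  · rcases Nat.lt_or_ge k A with hkA | hkA
    · rw [Nat.mod_eq_of_lt (by omega)]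
      refine sameCycle_run hg hπ (l := q) hq ?_ ⟨1, 0, by push_cast; ring, by ring⟩
      intro i y z hi hi' hiy h4 h5
      have h6 := hqmul y
      have h7 := hmul z
      omega
    · rw [show k + q = k - A + (A + q) by omega, Nat.add_mod_right, Nat.mod_eq_of_lt (by omega)]
      refine sameCycle_run hg hπ (l := h - A) (by omega) ?_
        ⟨-(Z + 1), 1, by rw [mul_neg, hqA]; omega, by rw [mul_neg, hqA]; omega⟩
      intro i y z hi hi' hiy h4 h5
      have h6 := hqmul y
      have h7 := hmul z
      omega

end Grid

section Grid

variable {B : Type*} [AddCommGroup B] {s s' : B} {m n : ℕ}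

/-- The permutation that adds `s`, except on the fibre of `-1` under `ι`, where it adds `s'`. -/
def fibrePerm (ι : B →+ ZMod m) (s s' : B) (hs : ι s = 1) (hs' : ι s' = 1) : Equiv.Perm B where
  toFun x := if ι x = -1 then x + s' else x + s
  invFun x := if ι x = 0 then x - s' else x - s
  left_inv x := by
    by_cases h : ι x = -1
    · simp [h, hs']
    · have : ι x + 1 ≠ 0 := fun h' => h (eq_neg_of_add_eq_zero_left h')
      simp [h, hs, this]
  right_inv x := by
    by_cases h : ι x = 0
    · simp [h, hs']
    · simp [h, hs, sub_eq_neg_self]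

lemma fibrePerm_apply (ι : B →+ ZMod m) (hs : ι s = 1) (hs' : ι s' = 1) (x : B) :
    fibrePerm ι s s' hs hs' x = if ι x = -1 then x + s' else x + s := rfl

lemma map_fibrePerm (ι : B →+ ZMod m) (hs : ι s = 1) (hs' : ι s' = 1) (x : B) :
    ι (fibrePerm ι s s' hs hs' x) = ι x + 1 := by
  rw [fibrePerm_apply]
  split_ifs <;> simp [hs, hs']

lemma natCast_ne_zero_of_lt {k : ℕ} (hk : 0 < k) (hkm : k < m) : (k : ZMod m) ≠ 0 := by
  rw [Ne, ZMod.natCast_eq_zero_iff]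
  exact fun h => absurd (Nat.le_of_dvd hk h) (by omega)

lemma transitive_fibre (ι : B →+ ZMod m) (hm : 2 ≤ m) (hs : ι s = 1) (hs' : ι s' = 1)
    (hker : ∀ x, ι x = 0 → ∃ k : ℤ, x = k • (s - s'))
    (hord : ∀ k : ℤ, k • (s - s') = 0 ↔ (n : ℤ) ∣ k)
    {c e : ℕ} (hcs : m • s = (c + 1) • (s - s')) (hen : e < n)
    (hc : Nat.gcd n c = e + 1 ∨ Even e ∧ c = n - 1) {w : B} (hw : ι w = 0) {π : Equiv.Perm B}
    (hπ : IsShift (fibrePerm ι s s' hs hs') (fun t => w + t • (s - s')) e π) :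
    ∀ x y, π.SameCycle x y := by
  have hd : ι (s - s') = 0 := by simp [hs, hs']
  have hF : ∀ t : ℕ, ι (w + t • (s - s')) = 0 := fun t => by
    rw [map_add, map_nsmul, hd, hw, smul_zero, add_zero]
  have hfar : ∀ x, ι x ≠ 0 → π x = fibrePerm ι s s' hs hs' x := fun x hx =>
    hπ.off x fun t _ e => hx (e ▸ hF t)
  have h1 : (0 : ZMod m) ≠ -1 := by
    have : Fact (1 < m) := ⟨hm⟩
    exact fun h => one_ne_zero (neg_eq_zero.1 h.symm)
  have hFs : ∀ t : ℕ, fibrePerm ι s s' hs hs' (w + t • (s - s')) = w + t • (s - s') + s :=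
    fun t => by rw [fibrePerm_apply, hF, if_neg h1]
  have hperiod : ∀ t : ℕ, w + (t % n) • (s - s') = w + t • (s - s') := fun t => by
    rw [add_right_inj, ← sub_eq_zero, ← natCast_zsmul, ← natCast_zsmul, ← sub_smul, hord]
    push_cast
    rw [Int.emod_def]
    exact ⟨-(t / n), by ring⟩
  -- the orbit leads from one zero of `ι` to the next
  have run : ∀ t : ℕ, π.SameCycle (w + t • (s - s') + s) (w + ((t + c) % n) • (s - s')) := by
    intro t
    have key : ∀ i, i + 1 < m →
        π.SameCycle (w + t • (s - s') + s) (w + t • (s - s') + (i + 1) • s) := by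
      intro i
      induction i with
      | zero => intro _; simpa using Equiv.Perm.SameCycle.refl _ _
      | succ i ih =>
        intro hi
        refine (ih (by omega)).trans ?_
        have h2 : ι (w + t • (s - s') + (i + 1) • s) = ((i + 1 : ℕ) : ZMod m) := by
          rw [map_add, hF, map_nsmul, hs]; simp
        have h3 := hfar (w + t • (s - s') + (i + 1) • s)
          (by rw [h2]; exact natCast_ne_zero_of_lt (by omega) (by omega))
        rw [fibrePerm_apply, h2, if_neg, add_assoc (w + t • (s - s')), ← succ_nsmul] at h3
        · rw [← h3]
          exact (Equiv.Perm.SameCycle.refl _ _).apply_right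
        · intro h4
          refine natCast_ne_zero_of_lt (m := m) (k := i + 1 + 1) (by omega) (by omega) ?_
          rw [Nat.cast_succ, h4, neg_add_cancel]
    refine (key (m - 2) (by omega)).trans ?_
    have h2 : ι (w + t • (s - s') + (m - 2 + 1) • s) = -1 := by
      rw [map_add, hF, map_nsmul, hs, eq_neg_iff_add_eq_zero, zero_add, nsmul_one, ← Nat.cast_succ,
        show (m - 2 + 1).succ = m by omega, ZMod.natCast_self]
    have h3 := hfar (w + t • (s - s') + (m - 2 + 1) • s) (by rw [h2]; exact h1.symm)
    rw [fibrePerm_apply, if_pos h2] at h3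
    have h4 : w + t • (s - s') + (m - 2 + 1) • s + s' = w + (t + c) • (s - s') := by
      have h5 : (m - 2 + 1) • s + s = (c + 1) • (s - s') := by
        rw [← hcs, ← succ_nsmul]; congr 1; omega
      rw [add_smul t c, add_assoc, add_assoc, add_right_inj, add_right_inj, eq_sub_of_add_eq h5,
        succ_nsmul]
      abel
    rw [hperiod, ← h4, ← h3]
    exact (Equiv.Perm.SameCycle.refl _ _).apply_right
  refine sameCycle_of_labels (F := fun t => w + t • (s - s')) hen hc
    (fun t het htn => ?_) (fun i hi => ?_) fun x => ?_
  · have h2 : π (w + t • (s - s')) = w + t • (s - s') + s := by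
      rw [hπ.off, hFs]
      intro t' ht' e'
      rw [add_right_inj, ← sub_eq_zero, ← natCast_zsmul, ← natCast_zsmul, ← sub_smul, hord] at e'
      obtain ⟨k, hk⟩ := e'
      have := Int.eq_zero_of_abs_lt_dvd ⟨k, hk⟩ (by rw [abs_lt]; omega)
      omega
    have := run t
    rw [← h2] at this
    exact Equiv.Perm.sameCycle_apply_left.1 this
  · have h2 := hπ.succ i hi
    rw [hFs] at h2
    have := run i
    rw [← h2] at this
    exact Equiv.Perm.sameCycle_apply_left.1 this
  · have hzero : ∀ x, ι x = 0 → ∃ t < n, π.SameCycle x (w + t • (s - s')) := by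
      intro x hx
      obtain ⟨k, hk⟩ := hker (x - w) (by rw [map_sub, hx, hw, sub_zero])
      have hn : (0 : ℤ) < n := by omega
      have h2 := Int.emod_nonneg k hn.ne'
      have h3 := Int.emod_lt_of_pos k hn
      obtain ⟨t, ht⟩ := Int.eq_ofNat_of_zero_le h2
      refine ⟨t, by omega, ?_⟩
      have : x = w + t • (s - s') := by
        rw [← sub_eq_iff_eq_add', hk, ← sub_eq_zero, ← natCast_zsmul, ← sub_smul, hord, ← ht,
          Int.emod_def]
        exact ⟨k / n, by ring⟩
      rw [this]
    have key : ∀ (k : ℕ) (x : B), ι x + k = 0 → ∃ t < n, π.SameCycle x (w + t • (s - s')) := by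
      intro k
      induction k with
      | zero => exact fun x hx => hzero x (by simpa using hx)
      | succ k ih =>
        intro x hx
        by_cases hx0 : ι x = 0
        · exact hzero x hx0
        · obtain ⟨t, ht, hc⟩ := ih (π x) (by
            rw [hfar x hx0, map_fibrePerm, ← hx]
            push_cast; ring)
          exact ⟨t, ht, Equiv.Perm.sameCycle_apply_left.1 hc⟩
    have : NeZero m := ⟨by omega⟩
    exact key (-ι x).val x (by simp)

end Grid

lemma isGrid_prod (m n : ℕ) : IsGrid ((1, 0) : ZMod m × ZMod n) (0, 1) m n where
  zero_iff i j := by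
    simp [Prod.ext_iff, ZMod.intCast_zmod_eq_zero_iff_dvd]
  gen x := by
    obtain ⟨i, hi⟩ := ZMod.intCast_surjective x.1
    obtain ⟨j, hj⟩ := ZMod.intCast_surjective x.2
    exact ⟨i, j, by simp [hi, hj]⟩

/-- The choice of the numbers of special points of the two paths. -/
lemma exists_shift_lengths {m n : ℕ} (hm : 2 ≤ m) (hmn : m < n) (hdvd : ¬ m ∣ n) :
    ∃ Z e j : ℕ, (Z + 1) * m < n ∧ n < (Z + 2) * m ∧ e < m ∧
      Nat.gcd ((Z + 2) * m) (m - 1) = e + 1 ∧ j < n ∧ Even j ∧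
      n + j ≤ (Z + 2) * m + e ∧ (Z + 2) * m + e ≤ n + j + 1 := by
  have h1 := Nat.div_add_mod n m
  have h2 := Nat.mod_lt n (by omega : 0 < m)
  have h3 : 0 < n % m := Nat.pos_of_ne_zero fun h0 => hdvd (Nat.dvd_of_mod_eq_zero h0)
  have h4 : 0 < n / m := Nat.div_pos hmn.le (by omega)
  obtain ⟨Z, hZ⟩ : ∃ Z, n / m = Z + 1 := ⟨n / m - 1, by omega⟩
  rw [hZ, mul_comm] at h1
  have hcop : Nat.gcd ((Z + 2) * m) (m - 1) = Nat.gcd (Z + 2) (m - 1) :=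
    Nat.Coprime.gcd_mul_right_cancel _ (by
      have : Nat.Coprime (m - 1 + 1) (m - 1) := by simp
      rwa [show m - 1 + 1 = m by omega] at this)
  have hgpos : 0 < Nat.gcd (Z + 2) (m - 1) := Nat.gcd_pos_of_pos_left _ (by omega)
  obtain ⟨e, he⟩ : ∃ e, Nat.gcd (Z + 2) (m - 1) = e + 1 :=
    ⟨Nat.gcd (Z + 2) (m - 1) - 1, by omega⟩
  have hle1 := Nat.le_of_dvd (by omega) (Nat.gcd_dvd_right (Z + 2) (m - 1))
  have hle2 := Nat.le_of_dvd (by omega) (Nat.gcd_dvd_left (Z + 2) (m - 1))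
  have hM : (Z + 2) * m = (Z + 1) * m + m := by ring
  have hN : (Z + 2) * m + e < 2 * n := by
    rcases Nat.eq_zero_or_pos Z with h0 | hZ0
    · have : (Z + 1) * m = m := by rw [h0, zero_add, one_mul]
      omega
    · have : 2 * m ≤ (Z + 1) * m := Nat.mul_le_mul_right m (by omega)
      omega
  exact ⟨Z, e, ((Z + 2) * m + e - n) / 2 * 2, by omega, by omega, by omega, by rw [hcop, he],
    by omega, by simp, by omega, by omega⟩

theorem exists_paths_of_not_dvd {m n r : ℕ} (hm : 2 ≤ m) (hn : 2 ≤ n) (hr : 2 ≤ r) (hmn : m < n)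
    (hdvd : ¬ m ∣ n) :
    ∃ v v' : Fin (m * n * r) → ZMod m × ZMod n × ZMod r,
      IsHamPathOn ({(1, 0, 0), (0, 1, 0), (0, 0, 1)} : Set (ZMod m × ZMod n × ZMod r))
        (m * n * r) v ∧
      IsHamPathOn ({(1, 0, 0), (0, 1, 0), (0, 0, 1)} : Set (ZMod m × ZMod n × ZMod r))
        (m * n * r) v' ∧
      Disjoint (ArcSet (m * n * r) v) (ArcSet (m * n * r) v') := by
  have : NeZero m := ⟨by omega⟩
  have : NeZero n := ⟨by omega⟩
  obtain ⟨Z, e, j, hZ, hZ', he, hg, hj, hj2, h1, h2⟩ := exists_shift_lengths hm hmn hdvd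
  have hgrid := isGrid_prod m n
  set a : ZMod m × ZMod n := (1, 0)
  set b : ZMod m × ZMod n := (0, 1)
  have hcard : Fintype.card (ZMod m × ZMod n) = m * n := by simp [ZMod.card]
  refine exists_paths_of_hasTours hm hn hr (fun x x' =>
    x' - x = -((n + j - 1 + 1) • (a - b)) ∨ x' - x = ((Z + 2) * m + e - 1) • (a - b))
    ⟨0, ((Z + 2) * m + e - 1) • (a - b), Or.inr (sub_zero _)⟩ ?_
  rw [← hcard]
  refine exists_hasTours_of_transitive (a := a) (b := b)
    (φ := Equiv.addRight a) (ψ := Equiv.addRight b)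
    (fun x => Or.inl ⟨rfl, rfl⟩) (fun k => ⟨rfl, rfl⟩) (by omega) (by omega) (by omega) ?_ ?_ ?_
  · intro k hk hk' h0
    rw [← natCast_zsmul, hgrid.zsmul_sub_eq_zero_iff] at h0
    obtain ⟨h3, c, hc⟩ := h0
    rcases (by omega : c ≤ 0 ∨ c = 1 ∨ 2 ≤ c) with hc' | rfl | hc'
    · nlinarith
    · rw [mul_one] at hc
      rw [hc] at h3
      exact hdvd (by exact_mod_cast h3)
    · have : (n : ℤ) * 2 ≤ n * c := by nlinarith
      omega
  · intro π hπ
    refine transitive_of_not_dvd (w := 0) hgrid (by omega) hdvd hj hj2 ?_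
    simpa using hπ
  · intro i π hπ
    refine transitive_of_lt_of_lt (w := i • (a - b)) hgrid.swap (by omega) hZ hZ' he hg ?_
    have : (fun t : ℕ => i • (a - b) - t • (a - b)) = fun t => i • (a - b) + t • (b - a) := by
      funext t
      rw [← neg_sub a b, smul_neg, sub_eq_add_neg]
    rw [← this]
    exact hπ

theorem exists_paths_of_dvd {m n r : ℕ} (hm : 2 ≤ m) (hn : 2 ≤ n) (hr : 2 ≤ r)
    (hdvd : m ∣ n) :
    ∃ v v' : Fin (m * n * r) → ZMod m × ZMod n × ZMod r,
      IsHamPathOn ({(1, 0, 0), (0, 1, 0), (0, 0, 1)} : Set (ZMod m × ZMod n × ZMod r))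
        (m * n * r) v ∧
      IsHamPathOn ({(1, 0, 0), (0, 1, 0), (0, 0, 1)} : Set (ZMod m × ZMod n × ZMod r))
        (m * n * r) v' ∧
      Disjoint (ArcSet (m * n * r) v) (ArcSet (m * n * r) v') := by
  have : NeZero m := ⟨by omega⟩
  have : NeZero n := ⟨by omega⟩
  have : Fact (1 < m) := ⟨hm⟩
  have hmn : m ≤ n := Nat.le_of_dvd (by omega) hdvd
  have hgrid := isGrid_prod m n
  have ha : (m : ℕ) • ((1, 0) : ZMod m × ZMod n) = 0 := by simp
  let ι : ZMod m × ZMod n →+ ZMod m :=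
    AddMonoidHom.fst _ _ + (ZMod.castHom hdvd (ZMod m)).toAddMonoidHom.comp (AddMonoidHom.snd _ _)
  have hιa : ι (1, 0) = 1 := by simp [ι]
  have hιb : ι (0, 1) = 1 := by simpa [ι] using ZMod.cast_one hdvd
  set a : ZMod m × ZMod n := (1, 0)
  set b : ZMod m × ZMod n := (0, 1)
  have hab : a ≠ b := by simp [a, b]
  have hcard : Fintype.card (ZMod m × ZMod n) = m * n := by simp [ZMod.card]
  have hord : ∀ k : ℤ, k • (a - b) = 0 ↔ (n : ℤ) ∣ k := fun k => by
    rw [hgrid.zsmul_sub_eq_zero_iff]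
    exact ⟨And.right, fun h => ⟨(Int.natCast_dvd_natCast.2 hdvd).trans h, h⟩⟩
  have hord' : ∀ k : ℤ, k • (b - a) = 0 ↔ (n : ℤ) ∣ k := fun k => by
    rw [← neg_sub a b, smul_neg, neg_eq_zero, hord]
  have hker : ∀ x, ι x = 0 → ∃ k : ℤ, x = k • (a - b) := by
    intro x hx
    obtain ⟨i, j, rfl⟩ := hgrid.gen x
    rw [map_add, map_zsmul, map_zsmul, hιa, hιb, ← add_smul, zsmul_one,
      ZMod.intCast_zmod_eq_zero_iff_dvd] at hx
    refine ⟨-j, ?_⟩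
    rw [← sub_eq_zero, show i • a + j • b - -j • (a - b) = (i + j) • a + (0 : ℤ) • b by
      simp only [smul_sub, add_smul, neg_smul, zero_smul]; abel, hgrid.zero_iff]
    exact ⟨hx, dvd_zero _⟩
  have hker' : ∀ x, ι x = 0 → ∃ k : ℤ, x = k • (b - a) := fun x hx => by
    obtain ⟨k, hk⟩ := hker x hx
    exact ⟨-k, by rw [hk, ← neg_sub a b, smul_neg, neg_smul, neg_neg]⟩
  have hι0 : ∀ k : ℤ, ι (k • (a - b)) = 0 := fun k => by
    rw [map_zsmul, map_sub, hιa, hιb, sub_self, smul_zero]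
  have h01 : (0 : ZMod m) ≠ -1 := fun h => one_ne_zero (neg_eq_zero.1 h.symm)
  let φ := fibrePerm ι a b hιa hιb
  let ψ := fibrePerm ι b a hιb hιa
  have hφ : ∀ x, (φ x = x + a ∧ ψ x = x + b) ∨ (φ x = x + b ∧ ψ x = x + a) := fun x => by
    by_cases h : ι x = -1 <;> simp [φ, ψ, fibrePerm_apply, h]
  have hgpos : 0 < Nat.gcd n (m - 1) := Nat.gcd_pos_of_pos_left _ (by omega)
  obtain ⟨e', he'⟩ : ∃ e', Nat.gcd n (m - 1) = e' + 1 := ⟨Nat.gcd n (m - 1) - 1, by omega⟩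
  have hle := Nat.le_of_dvd (by omega) (Nat.gcd_dvd_right n (m - 1))
  have hP : ∀ (e : ℕ) (π : Equiv.Perm (ZMod m × ZMod n)), Even e → e ≤ e' →
      IsShift φ (fun t => t • (a - b)) e π → ∀ p q, π.SameCycle p q := by
    intro e π he hee hπ
    refine transitive_fibre ι hm hιa hιb hker hord (c := n - 1) (e := e) (w := 0) ?_ (by omega)
      (Or.inr ⟨he, rfl⟩) (map_zero ι) ?_
    · rw [show n - 1 + 1 = n by omega, ha, ← natCast_zsmul, eq_comm, hord]
    · simpa using hπ
  have hP' : ∀ (i : ℕ) (π : Equiv.Perm (ZMod m × ZMod n)),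
      IsShift ψ (fun t => i • (a - b) - t • (a - b)) e' π → ∀ p q, π.SameCycle p q := by
    intro i π hπ
    refine transitive_fibre ι hm hιb hιa hker' hord' (c := m - 1) (e := e') (w := i • (a - b)) ?_
      (by omega) (Or.inl he') (by simpa using hι0 i) ?_
    · rw [show m - 1 + 1 = m by omega, smul_sub, ha, sub_zero]
    · have : (fun t : ℕ => i • (a - b) - t • (a - b)) = fun t => i • (a - b) + t • (b - a) := by
        funext t
        rw [← neg_sub a b, smul_neg, sub_eq_add_neg]
      rw [← this]
      exact hπ
  rcases Nat.eq_zero_or_pos e' with rfl | hpos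
  · have hφt := hP 0 φ (by simp) le_rfl ⟨rfl, by simp, fun _ _ => rfl⟩
    have hψt := hP' 0 ψ ⟨rfl, by simp, fun _ _ => rfl⟩
    refine exists_paths_of_hasTours hm hn hr (fun x x' => ι x ≠ ι x') ⟨0, a, ?_⟩ ?_
    · rw [map_zero, hιa]; exact zero_ne_one
    · intro x x' hx
      have h1 : ι x = ι (φ.symm x) + 1 := by
        rw [← map_fibrePerm ι hιa hιb]; exact congrArg ι (φ.apply_symm_apply x).symm
      have h2 : ι x' = ι (ψ.symm x') + 1 := by
        rw [← map_fibrePerm ι hιb hιa]; exact congrArg ι (ψ.apply_symm_apply x').symm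
      have hne : ι (φ.symm x) ≠ ι (ψ.symm x') := fun h => hx (by rw [h1, h2, h])
      refine ⟨φ.symm x, ψ.symm x', hne, fun h => hne (congrArg ι h), ?_⟩
      rw [← hcard]
      refine hasTours_of_perms hφt hψt (φ.apply_symm_apply x) (ψ.apply_symm_apply x')
        (fun p _ => ?_) (fun p _ => ?_) (fun p _ _ h => ?_)
      · exact (hφ p).imp And.left And.left
      · exact (hφ p).symm.imp And.right And.right
      · rcases hφ p with h5 | h5 <;> rw [h5.1, h5.2] at h
        · exact hab (add_left_cancel h)
        · exact hab (add_left_cancel h).symm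
  · obtain ⟨e, he, hee, hee'⟩ : ∃ e, Even e ∧ e ≤ e' ∧ e' ≤ e + 1 :=
      ⟨e' / 2 * 2, by simp, by omega, by omega⟩
    refine exists_paths_of_hasTours hm hn hr (fun x x' =>
      x' - x = -((e + 1) • (a - b)) ∨ x' - x = e' • (a - b))
      ⟨0, e' • (a - b), Or.inr (sub_zero _)⟩ ?_
    rw [← hcard]
    refine exists_hasTours_of_transitive (φ := φ) (ψ := ψ) hφ (fun k => ?_) hee hee' hpos
      (fun k hk hk' h0 => ?_) (fun π => hP e π he hee) hP'
    · simp only [φ, ψ, fibrePerm_apply, hι0, if_neg h01, and_self]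
    · rw [← natCast_zsmul, hord, Int.natCast_dvd_natCast] at h0
      have := Nat.le_of_dvd hk h0
      omega

theorem exists_two_disjoint_paths {m n r : ℕ} (hm : 2 ≤ m) (hn : 2 ≤ n) (hr : 2 ≤ r) (hmn : m ≤ n) :
    ∃ v v' : Fin (m * n * r) → ZMod m × ZMod n × ZMod r,
      IsHamPathOn ({(1, 0, 0), (0, 1, 0), (0, 0, 1)} : Set (ZMod m × ZMod n × ZMod r))
        (m * n * r) v ∧
      IsHamPathOn ({(1, 0, 0), (0, 1, 0), (0, 0, 1)} : Set (ZMod m × ZMod n × ZMod r))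
        (m * n * r) v' ∧
      Disjoint (ArcSet (m * n * r) v) (ArcSet (m * n * r) v') := by
  by_cases hdvd : m ∣ n
  · exact exists_paths_of_dvd hm hn hr hdvd
  · exact exists_paths_of_not_dvd hm hn hr
      (lt_of_le_of_ne hmn fun h => hdvd (h ▸ dvd_refl m)) hdvd

/-- If one of the pairwise Cartesian products of directed cycles of lengths `m`, `n`, `r`
has a hamiltonian cycle, or `m, n, r` do not all have the same parity, or one of them
equals `2`, then `Cay(ℤ_m × ℤ_n × ℤ_r; e₁, e₂, e₃)` has two arc-disjoint hamiltonian paths. -/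
theorem two_arc_disjoint_hamiltonian_paths_3cycles (m n r : ℕ)
    (hm : 2 ≤ m) (hn : 2 ≤ n) (hr : 2 ≤ r)
    (h : (∃ u, IsHamCycle2 m n u) ∨ (∃ u, IsHamCycle2 m r u) ∨ (∃ u, IsHamCycle2 n r u) ∨
         ¬(m % 2 = n % 2 ∧ n % 2 = r % 2) ∨ m = 2 ∨ n = 2 ∨ r = 2) :
    ∃ v v' : Fin (m * n * r) → ZMod m × ZMod n × ZMod r,
      IsHamPathOn ({(1, 0, 0), (0, 1, 0), (0, 0, 1)} : Set (ZMod m × ZMod n × ZMod r))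
        (m * n * r) v ∧
      IsHamPathOn ({(1, 0, 0), (0, 1, 0), (0, 0, 1)} : Set (ZMod m × ZMod n × ZMod r))
        (m * n * r) v' ∧
      Disjoint (ArcSet (m * n * r) v) (ArcSet (m * n * r) v') := by
  rcases le_total m n with hmn | hmn
  · exact exists_two_disjoint_paths hm hn hr hmn
  · exact exists_paths_swap (exists_two_disjoint_paths hn hm hr hmn)
end

section
/- Let {a, b} be a 2-element generating set of a finite abelian group G. If Cay(G; a, b) has hamiltonian paths P and P′ satisfying |δ_b(P) − δ_a(P′)| ≤ 1 (equivalently, δ_b(P) + δ_b(P′) ∈ {|G|, |G|−1, |G|−2}), then Cay(G; a, b) has two arc-disjoint hamiltonian paths. -/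
/-- `v : Fin N → G` is a hamiltonian path of the Cayley digraph `Cay(G; a, b)`. -/
def IsHamPath {G : Type*} [AddCommGroup G] (a b : G) (N : ℕ) (v : Fin N → G) : Prop :=
  Function.Bijective v ∧
    ∀ (i : ℕ) (h : i + 1 < N),
      v ⟨i + 1, h⟩ - v ⟨i, Nat.lt_of_succ_lt h⟩ ∈ ({a, b} : Set G)

/-- The number of indices `i` with `v (i+1) - v i = s`. -/
noncomputable def delta {G : Type*} [AddCommGroup G] (N : ℕ) (v : Fin N → G) (s : G) : ℕ :=
  Nat.card {i : ℕ // ∃ h : i + 1 < N, v ⟨i + 1, h⟩ - v ⟨i, Nat.lt_of_succ_lt h⟩ = s}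

section HamiltonianSequences

lemma count_le_and_lt (s t q : ℕ) [DecidablePred fun r => s ≤ r ∧ r < t] :
    Nat.count (fun r => s ≤ r ∧ r < t) q = min t q - s := by
  induction q with
  | zero => simp
  | succ q ih => rw [Nat.count_succ, ih]; split_ifs <;> omega

variable {G : Type*} [AddCommGroup G] {a b : G} {u : ℕ → G}

open scoped Classical in
lemma delta_eq_count {N : ℕ} {v : Fin N → G} (hu : ∀ i : Fin N, u i = v i) (s : G) :
    delta N v s = Nat.count (fun l => u (l + 1) = u l + s) (N - 1) := by
  rw [delta, Nat.count_eq_card_filter_range]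
  refine Nat.subtype_card _ fun i => ?_
  rw [Finset.mem_filter, Finset.mem_range]
  constructor
  · rintro ⟨h, hs⟩
    have hi : i + 1 < N := by omega
    exact ⟨hi, by rw [← hu, ← hu, hs]; simp⟩
  · rintro ⟨h, hs⟩
    rw [← hu, ← hu] at hs
    exact ⟨by omega, by rw [← hs]; simp⟩

/-- The first `|G|` terms of `u : ℕ → G` form a hamiltonian path of `Cay(G; a, b)`. -/
structure IsHamSeq [Fintype G] (a b : G) (u : ℕ → G) : Prop where
  inj : ∀ j l, j < Fintype.card G → l < Fintype.card G → u j = u l → j = l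
  step : ∀ j, j + 1 < Fintype.card G → u (j + 1) = u j + a ∨ u (j + 1) = u j + b

/-- The number of cosets of `⟨b - a⟩` met by the multiples of `a`. -/
noncomputable def numCosets (a b : G) : ℕ :=
  addOrderOf (QuotientAddGroup.mk a : G ⧸ AddSubgroup.zmultiples (b - a))

lemma mk_eq_mk_iff_exists_nsmul [Finite G] {c x y : G} :
    (QuotientAddGroup.mk x : G ⧸ AddSubgroup.zmultiples c) = QuotientAddGroup.mk y ↔
      ∃ e < addOrderOf c, y = x + e • c := by
  classical
  rw [QuotientAddGroup.eq, ← mem_multiples_iff_mem_zmultiples,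
    mem_multiples_iff_mem_range_addOrderOf]
  simp only [Finset.mem_image, Finset.mem_range]
  refine exists_congr fun e => and_congr_right fun _ => ?_
  constructor
  · intro h; rw [h]; abel
  · intro h; rw [h]; abel

lemma numCosets_pos [Finite G] : 0 < numCosets a b := addOrderOf_pos _

lemma numCosets_mul_addOrderOf [Fintype G] (hgen : AddSubgroup.closure {a, b} = ⊤) :
    numCosets a b * addOrderOf (b - a) = Fintype.card G := by
  rw [← Nat.card_eq_fintype_card,
    AddSubgroup.card_eq_card_quotient_mul_card_addSubgroup (AddSubgroup.zmultiples (b - a)),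
    Nat.card_zmultiples, numCosets]
  congr 1
  refine addOrderOf_eq_card_of_forall_mem_zmultiples fun x => ?_
  obtain ⟨x, rfl⟩ := QuotientAddGroup.mk_surjective x
  have hx : x ∈ AddSubgroup.closure {a, b} := hgen ▸ AddSubgroup.mem_top x
  induction hx using AddSubgroup.closure_induction with
  | mem x hx =>
    rcases hx with rfl | rfl
    · exact AddSubgroup.mem_zmultiples _
    · convert AddSubgroup.mem_zmultiples _ using 1
      rw [QuotientAddGroup.eq, AddSubgroup.mem_zmultiples_iff]
      exact ⟨-1, by simp; abel⟩
  | zero => exact AddSubgroup.zero_mem _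
  | add x y _ _ hx hy => exact AddSubgroup.add_mem _ hx hy
  | neg x _ hx => exact AddSubgroup.neg_mem _ hx

lemma mk_add_nsmul_eq_iff (x : G) (j l : ℕ) :
    (QuotientAddGroup.mk (x + j • a) : G ⧸ AddSubgroup.zmultiples (b - a)) =
      QuotientAddGroup.mk (x + l • a) ↔ j ≡ l [MOD numCosets a b] := by
  rw [QuotientAddGroup.mk_add, QuotientAddGroup.mk_add, add_right_inj,
    QuotientAddGroup.mk_nsmul, QuotientAddGroup.mk_nsmul, nsmul_eq_nsmul_iff_modEq, numCosets]

lemma mk_sub_eq_mk_add_nsmul_iff [Finite G] (x : G) (j : ℕ) :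
    (QuotientAddGroup.mk (x - a) : G ⧸ AddSubgroup.zmultiples (b - a)) =
      QuotientAddGroup.mk (x + j • a) ↔ j % numCosets a b = numCosets a b - 1 := by
  have hx : x + j • a = x - a + (j + 1) • a := by rw [add_nsmul, one_nsmul]; abel
  have hx0 : x - a = x - a + 0 • a := by simp
  rw [hx]
  nth_rw 1 [hx0]
  rw [mk_add_nsmul_eq_iff, Nat.ModEq, Nat.zero_mod]
  have hm : 0 < numCosets a b := numCosets_pos
  generalize numCosets a b = m at *
  have hj := Nat.mod_lt j hm
  rcases Nat.lt_or_ge 1 m with h | h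
  · rw [Nat.add_mod_eq_ite, Nat.mod_eq_of_lt h]
    generalize j % m = r at *
    split_ifs
    · omega
    · have : r ≠ m - 1 := by omega
      simp [this]
  · obtain rfl : m = 1 := by omega
    simp [Nat.mod_one]

variable [Fintype G]

namespace IsHamSeq

lemma exists_eq (hu : IsHamSeq a b u) (x : G) : ∃ j < Fintype.card G, u j = x := by
  have hinj : Function.Injective fun i : Fin (Fintype.card G) => u i :=
    fun i j h => Fin.ext (hu.inj _ _ i.2 j.2 h)
  obtain ⟨i, hi⟩ := ((Fintype.bijective_iff_injective_and_card _).2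
    ⟨hinj, Fintype.card_fin _⟩).2 x
  exact ⟨i, i.2, hi⟩

lemma mk_eq (hu : IsHamSeq a b u) {j : ℕ} (hj : j < Fintype.card G) :
    (QuotientAddGroup.mk (u j) : G ⧸ AddSubgroup.zmultiples (b - a)) =
      QuotientAddGroup.mk (u 0 + j • a) := by
  induction j with
  | zero => simp
  | succ j ih =>
    have hb : (QuotientAddGroup.mk b : G ⧸ AddSubgroup.zmultiples (b - a)) =
        QuotientAddGroup.mk a := by
      rw [QuotientAddGroup.eq, AddSubgroup.mem_zmultiples_iff]
      exact ⟨-1, by simp; abel⟩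
    have h : (QuotientAddGroup.mk (u (j + 1)) : G ⧸ AddSubgroup.zmultiples (b - a)) =
        QuotientAddGroup.mk (u j) + QuotientAddGroup.mk a := by
      rcases hu.step j hj with h | h <;> rw [h, QuotientAddGroup.mk_add]
      rw [hb]
    rw [h, ih (by omega), add_nsmul, one_nsmul, ← add_assoc,
      QuotientAddGroup.mk_add (N := AddSubgroup.zmultiples (b - a)) (u 0 + j • a) a]

lemma mk_eq_mk_iff (hu : IsHamSeq a b u) {j l : ℕ} (hj : j < Fintype.card G)
    (hl : l < Fintype.card G) :
    (QuotientAddGroup.mk (u j) : G ⧸ AddSubgroup.zmultiples (b - a)) =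
      QuotientAddGroup.mk (u l) ↔ j ≡ l [MOD numCosets a b] := by
  rw [hu.mk_eq hj, hu.mk_eq hl, mk_add_nsmul_eq_iff]

lemma mod_eq_iff_exists (hu : IsHamSeq a b u) {j : ℕ} (hj : j < Fintype.card G) :
    j % numCosets a b = numCosets a b - 1 ↔
      ∃ e < addOrderOf (b - a), u j = u 0 - a + e • (b - a) := by
  rw [← mk_eq_mk_iff_exists_nsmul, hu.mk_eq hj, mk_sub_eq_mk_add_nsmul_iff]

lemma step_b_of_eq_add (hab : a ≠ b) (hu : IsHamSeq a b u) {j l : ℕ}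
    (hj : j + 1 < Fintype.card G) (hl : l + 1 < Fintype.card G)
    (hb : u (j + 1) = u j + b) (h : u l = u j + (b - a)) : u (l + 1) = u l + b := by
  refine (hu.step l hl).resolve_left fun ha => ?_
  have : u (l + 1) = u (j + 1) := by rw [ha, h, hb]; abel
  have hlj : l = j := by simpa using hu.inj _ _ hl hj this
  subst hlj
  exact hab (sub_eq_zero.1 (by simpa using h)).symm

lemma card_pred_mod (hgen : AddSubgroup.closure {a, b} = ⊤) :
    (Fintype.card G - 1) % numCosets a b = numCosets a b - 1 := by
  have hn : 0 < addOrderOf (b - a) := addOrderOf_pos _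
  have hm : 0 < numCosets a b := numCosets_pos
  rw [← numCosets_mul_addOrderOf hgen]
  obtain ⟨n, hn'⟩ := Nat.exists_eq_add_of_le' hn
  rw [hn', Nat.mul_succ, Nat.add_sub_assoc hm, Nat.mul_add_mod]
  exact Nat.mod_eq_of_lt (by omega)

/-- Away from the coset of the terminal vertex, the direction depends only on the coset. -/
lemma step_b_of_modEq (hab : a ≠ b) (hgen : AddSubgroup.closure {a, b} = ⊤)
    (hu : IsHamSeq a b u) {j l : ℕ} (hj : j + 1 < Fintype.card G)
    (hl : l + 1 < Fintype.card G) (hjl : j ≡ l [MOD numCosets a b])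
    (hs : j % numCosets a b ≠ numCosets a b - 1) (hb : u (j + 1) = u j + b) :
    u (l + 1) = u l + b := by
  obtain ⟨e, -, he⟩ := mk_eq_mk_iff_exists_nsmul.1
    ((hu.mk_eq_mk_iff (j := j) (l := l) (by omega) (by omega)).2 hjl)
  have key : ∀ e : ℕ, ∀ l < Fintype.card G, u l = u j + e • (b - a) →
      l + 1 < Fintype.card G ∧ u (l + 1) = u l + b := by
    intro e
    induction e with
    | zero =>
      intro l hl h
      obtain rfl : l = j := hu.inj _ _ hl (by omega) (by simpa using h)
      exact ⟨hj, hb⟩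
    | succ e ih =>
      intro l hl h
      obtain ⟨p, hp, hpe⟩ := hu.exists_eq (u j + e • (b - a))
      obtain ⟨hp1, hpb⟩ := ih p hp hpe
      have hl1 : l + 1 < Fintype.card G := by
        by_contra hcon
        have hl' : l = Fintype.card G - 1 := by omega
        have hmod : j ≡ l [MOD numCosets a b] := by
          rw [← hu.mk_eq_mk_iff (by omega) hl, h, QuotientAddGroup.eq,
            AddSubgroup.mem_zmultiples_iff]
          exact ⟨(e + 1 : ℕ), by rw [natCast_zsmul]; abel⟩
        rw [Nat.ModEq, hl', card_pred_mod hgen] at hmod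
        exact hs hmod
      refine ⟨hl1, hu.step_b_of_eq_add hab hp1 hl1 hpb ?_⟩
      rw [h, hpe, add_nsmul, one_nsmul, add_assoc]
  exact (key e l (by omega) he).2

/-- On the coset of the terminal vertex, the vertices travelling by `b` come before the terminal
vertex and those travelling by `a` after it. -/
lemma exists_terminal (hab : a ≠ b) (hgen : AddSubgroup.closure {a, b} = ⊤)
    (hu : IsHamSeq a b u) :
    ∃ d < addOrderOf (b - a), u (Fintype.card G - 1) = u 0 - a + d • (b - a) ∧
      ∀ e < addOrderOf (b - a), ∀ j, j + 1 < Fintype.card G → u j = u 0 - a + e • (b - a) →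
        e ≠ d ∧ (u (j + 1) = u j + b ↔ e < d) := by
  have hN : 0 < Fintype.card G := Fintype.card_pos
  obtain ⟨d, hd, hud⟩ := (hu.mod_eq_iff_exists (j := Fintype.card G - 1) (by omega)).1
    (card_pred_mod hgen)
  have hne : ∀ e < addOrderOf (b - a), e ≠ d → ∀ j < Fintype.card G,
      u j = u 0 - a + e • (b - a) → j + 1 < Fintype.card G := by
    intro e he hed j hj h
    by_contra hcon
    obtain rfl : j = Fintype.card G - 1 := by omega
    rw [hud, add_right_inj] at h
    exact hed (nsmul_injOn_Iio_addOrderOf he hd h.symm)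
  have hlt : ∀ e < d, ∀ j, j + 1 < Fintype.card G → u j = u 0 - a + e • (b - a) →
      u (j + 1) = u j + b := by
    intro e
    induction e with
    | zero =>
      intro _ j hj h
      refine (hu.step j hj).resolve_left fun ha => ?_
      have := hu.inj (j + 1) 0 hj hN (by rw [ha, h]; simp)
      omega
    | succ e ih =>
      intro he j hj h
      obtain ⟨p, hp, hpe⟩ := hu.exists_eq (u 0 - a + e • (b - a))
      have hp1 := hne e (by omega) (by omega) p hp hpe
      refine hu.step_b_of_eq_add hab hp1 hj (ih (by omega) p hp1 hpe) ?_
      rw [h, hpe, add_nsmul, one_nsmul, add_assoc]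
  have hgt : ∀ f e : ℕ, e + f + 1 = addOrderOf (b - a) → d < e → ∀ j, j + 1 < Fintype.card G →
      u j = u 0 - a + e • (b - a) → u (j + 1) ≠ u j + b := by
    intro f
    induction f with
    | zero =>
      intro e he hde j hj h hb
      have hz : (e + 1) • (b - a) = 0 := by
        rw [show e + 1 = addOrderOf (b - a) by omega, addOrderOf_nsmul_eq_zero]
      have := hu.inj (j + 1) 0 hj hN (by
        rw [hb, h]
        calc u 0 - a + e • (b - a) + b = u 0 + (e + 1) • (b - a) := by
              rw [add_nsmul, one_nsmul]; abel
          _ = u 0 := by rw [hz, add_zero])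
      omega
    | succ f ih =>
      intro e he hde j hj h hb
      obtain ⟨p, hp, hpe⟩ := hu.exists_eq (u 0 - a + (e + 1) • (b - a))
      have hp1 := hne (e + 1) (by omega) (by omega) p hp hpe
      refine ih (e + 1) (by omega) (by omega) p hp1 hpe (hu.step_b_of_eq_add hab hj hp1 hb ?_)
      rw [h, hpe, add_nsmul, one_nsmul, add_assoc]
  refine ⟨d, hd, hud, fun e he j hj h => ?_⟩
  have hed : e ≠ d := by
    rintro rfl
    have := hu.inj j (Fintype.card G - 1) (by omega) (by omega) (h.trans hud.symm)
    omega
  refine ⟨hed, fun hb => ?_, fun hlt' => hlt e hlt' j hj h⟩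
  by_contra hcon
  exact hgt (addOrderOf (b - a) - e - 1) e (by omega) (by omega) j hj h hb

open scoped Classical in
lemma eq_add_count (hu : IsHamSeq a b u) {j : ℕ} (hj : j < Fintype.card G) :
    u j = u 0 + j • a + Nat.count (fun l => u (l + 1) = u l + b) j • (b - a) := by
  induction j with
  | zero => simp
  | succ j ih =>
    rw [Nat.count_succ]
    have hj' := ih (by omega)
    generalize Nat.count (fun l => u (l + 1) = u l + b) j = s at hj' ⊢
    split_ifs with h
    · rw [h, hj']
      simp only [add_nsmul, one_nsmul]
      abel
    · rw [(hu.step j hj).resolve_right h, hj']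
      simp only [add_nsmul, one_nsmul, zero_nsmul]
      abel

open scoped Classical in
lemma exists_count_block (hab : a ≠ b) (hgen : AddSubgroup.closure {a, b} = ⊤)
    (hu : IsHamSeq a b u) {q : ℕ} (hq : q < addOrderOf (b - a)) :
    ∃ s ≤ q, Nat.count (fun l => u (l + 1) = u l + b)
        (numCosets a b * q + (numCosets a b - 1)) =
      s + (q + 1) * Nat.count (fun l => u (l + 1) = u l + b) (numCosets a b - 1) := by
  have hm : 0 < numCosets a b := numCosets_pos
  induction q with
  | zero => exact ⟨0, le_rfl, by simp⟩
  | succ q ih =>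
    obtain ⟨s, hs, h⟩ := ih (by omega)
    have hcard : numCosets a b * (q + 1) + numCosets a b ≤ Fintype.card G := by
      rw [← numCosets_mul_addOrderOf hgen, ← Nat.mul_succ]
      exact Nat.mul_le_mul_left _ hq
    have hblock : Nat.count (fun r => u (numCosets a b * (q + 1) + r + 1) =
          u (numCosets a b * (q + 1) + r) + b) (numCosets a b - 1) =
        Nat.count (fun l => u (l + 1) = u l + b) (numCosets a b - 1) := by
      simp only [Nat.count_eq_card_filter_range]
      congr 1
      refine Finset.filter_congr fun r hr => ?_
      rw [Finset.mem_range] at hr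
      have hmod : numCosets a b * (q + 1) + r ≡ r [MOD numCosets a b] := by
        simp [Nat.ModEq]
      have hr' : r % numCosets a b = r := Nat.mod_eq_of_lt (by omega)
      refine ⟨hu.step_b_of_modEq hab hgen (by omega) (by omega) hmod ?_,
        hu.step_b_of_modEq hab hgen (by omega) (by omega) hmod.symm ?_⟩
      · rw [hmod, hr']; omega
      · rw [hr']; omega
    rw [Nat.count_add, hblock, show numCosets a b * (q + 1) =
      numCosets a b * q + (numCosets a b - 1) + 1 by rw [Nat.mul_succ]; omega, Nat.count_succ, h]
    split_ifs
    · exact ⟨s + 1, by omega, by ring⟩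
    · exact ⟨s, by omega, by ring⟩

open scoped Classical in
/-- Rearranging the directions chosen on the cosets without the terminal vertex, and translating,
turns a hamiltonian path into another one. -/
lemma reorder (hab : a ≠ b) (hgen : AddSubgroup.closure {a, b} = ⊤) (hu : IsHamSeq a b u)
    (K : ℕ → Prop) (g : G)
    (hK : Nat.count K (numCosets a b - 1) =
      Nat.count (fun l => u (l + 1) = u l + b) (numCosets a b - 1)) :
    ∃ w, IsHamSeq a b w ∧ w 0 = g ∧
      (∀ j, j + 1 < Fintype.card G → j % numCosets a b ≠ numCosets a b - 1 →
        (w (j + 1) = w j + b ↔ K (j % numCosets a b))) ∧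
      ∀ j, j + 1 < Fintype.card G → j % numCosets a b = numCosets a b - 1 →
        w j = g - u 0 + u j ∧ (w (j + 1) = w j + b ↔ u (j + 1) = u j + b) := by
  have hm : 0 < numCosets a b := numCosets_pos
  obtain ⟨w, hw⟩ : ∃ w : ℕ → G, ∀ j, w j = g - u 0 + u j +
      (Nat.count K (j % numCosets a b) • (b - a) -
        Nat.count (fun l => u (l + 1) = u l + b) (j % numCosets a b) • (b - a)) :=
    ⟨_, fun _ => rfl⟩
  have hnonspecial : ∀ j, j + 1 < Fintype.card G → j % numCosets a b ≠ numCosets a b - 1 →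
      w (j + 1) = w j + if K (j % numCosets a b) then b else a := by
    intro j hj hjm
    have hlt := Nat.mod_lt j hm
    have hsucc : (j + 1) % numCosets a b = j % numCosets a b + 1 := by
      rw [← Nat.mod_add_mod, Nat.mod_eq_of_lt (by omega)]
    have hle := Nat.mod_le j (numCosets a b)
    have hiff : u (j % numCosets a b + 1) = u (j % numCosets a b) + b ↔ u (j + 1) = u j + b :=
      ⟨hu.step_b_of_modEq hab hgen (by omega) hj (Nat.mod_modEq _ _) (by rwa [Nat.mod_mod]),
        hu.step_b_of_modEq hab hgen hj (by omega) (Nat.mod_modEq _ _).symm hjm⟩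
    rw [hw, hw, hsucc, Nat.count_succ, Nat.count_succ]
    simp only [hiff]
    by_cases h : u (j + 1) = u j + b
    · rw [if_pos h, h]
      split_ifs <;> simp only [add_nsmul, one_nsmul, zero_nsmul] <;> abel
    · rw [if_neg h, (hu.step j hj).resolve_right h]
      split_ifs <;> simp only [add_nsmul, one_nsmul, zero_nsmul] <;> abel
  have hspecial : ∀ j, j + 1 < Fintype.card G → j % numCosets a b = numCosets a b - 1 →
      w j = g - u 0 + u j ∧ w (j + 1) = g - u 0 + u (j + 1) := by
    intro j hj hjm
    have hsucc : (j + 1) % numCosets a b = 0 := by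
      rw [← Nat.mod_add_mod, hjm, Nat.sub_add_cancel hm, Nat.mod_self]
    refine ⟨by rw [hw, hjm, hK, sub_self, add_zero], ?_⟩
    rw [hw, hsucc, Nat.count_zero, Nat.count_zero, sub_self, add_zero]
  refine ⟨w, ⟨fun j l hj hl h => ?_, fun j hj => ?_⟩, ?_, fun j hj hjm => ?_,
    fun j hj hjm => ?_⟩
  · have hmod : j ≡ l [MOD numCosets a b] := by
      rw [← hu.mk_eq_mk_iff hj hl, ← sub_eq_zero, ← QuotientAddGroup.mk_sub]
      have hc (i : ℕ) : (QuotientAddGroup.mk (u i) : G ⧸ AddSubgroup.zmultiples (b - a)) =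
          QuotientAddGroup.mk (w i - (g - u 0)) := by
        rw [QuotientAddGroup.eq, hw]
        have := AddSubgroup.sub_mem _
          (AddSubgroup.nsmul_mem_zmultiples (b - a) (Nat.count K (i % numCosets a b)))
          (AddSubgroup.nsmul_mem_zmultiples (b - a)
            (Nat.count (fun l => u (l + 1) = u l + b) (i % numCosets a b)))
        convert this using 1
        abel
      rw [QuotientAddGroup.mk_sub, hc j, hc l, h, sub_self]
    rw [hw, hw, hmod] at h
    exact hu.inj j l hj hl (by simpa using h)
  · by_cases hjm : j % numCosets a b = numCosets a b - 1
    · obtain ⟨h1, h2⟩ := hspecial j hj hjm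
      rw [h1, h2, add_assoc, add_assoc, add_right_inj, add_right_inj]
      exact hu.step j hj
    · rw [hnonspecial j hj hjm]
      split_ifs
      · exact Or.inr rfl
      · exact Or.inl rfl
  · simp [hw]
  · rw [hnonspecial j hj hjm, add_right_inj]
    split_ifs with h <;> simp [h, hab]
  · obtain ⟨h1, h2⟩ := hspecial j hj hjm
    refine ⟨h1, ?_⟩
    rw [h1, h2, add_assoc, add_right_inj]

open scoped Classical in
/-- The number `n * k + d` of `b`-arcs in a hamiltonian path, where `n` is the order of `b - a`,
determines the behaviour on the terminal coset, whereas the `k` other cosets travelling by `b`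
can be prescribed at will. -/
lemma exists_shape (hab : a ≠ b) (hgen : AddSubgroup.closure {a, b} = ⊤)
    (hu : IsHamSeq a b u) :
    ∃ k d, k ≤ numCosets a b - 1 ∧ d < addOrderOf (b - a) ∧
      Nat.count (fun l => u (l + 1) = u l + b) (Fintype.card G - 1) =
        addOrderOf (b - a) * k + d ∧
      ∀ (K : ℕ → Prop) (g : G), Nat.count K (numCosets a b - 1) = k →
        ∃ w, IsHamSeq a b w ∧ w 0 = g ∧
          (∀ j, j + 1 < Fintype.card G → j % numCosets a b ≠ numCosets a b - 1 →
            (w (j + 1) = w j + b ↔ K (j % numCosets a b))) ∧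
          ∀ j, j + 1 < Fintype.card G → j % numCosets a b = numCosets a b - 1 →
            ∃ e < addOrderOf (b - a), w j = g - a + e • (b - a) ∧ e ≠ d ∧
              (w (j + 1) = w j + b ↔ e < d) := by
  have hm : 0 < numCosets a b := numCosets_pos
  have hn : 0 < addOrderOf (b - a) := addOrderOf_pos _
  obtain ⟨d, hd, hud, hspec⟩ := hu.exists_terminal hab hgen
  refine ⟨_, d, Nat.count_le (fun l => u (l + 1) = u l + b), hd, ?_, fun K g hK => ?_⟩
  · obtain ⟨s, hs, hcount⟩ := hu.exists_count_block hab hgen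
      (Nat.sub_lt hn Nat.one_pos : addOrderOf (b - a) - 1 < addOrderOf (b - a))
    have hcard : numCosets a b * (addOrderOf (b - a) - 1) + (numCosets a b - 1) =
        Fintype.card G - 1 := by
      rw [← numCosets_mul_addOrderOf hgen, Nat.mul_sub_one, ← Nat.add_sub_assoc hm,
        Nat.sub_add_cancel (Nat.le_mul_of_pos_right _ hn)]
    rw [hcard, Nat.sub_add_cancel hn] at hcount
    have hpos : 0 < Fintype.card G := Fintype.card_pos
    have h := hu.eq_add_count (j := Fintype.card G - 1) (by omega)
    rw [hcount, hud, add_nsmul, mul_nsmul, addOrderOf_nsmul_eq_zero, nsmul_zero, add_zero,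
      sub_nsmul a hpos, card_nsmul_eq_zero, one_nsmul, zero_add, ← sub_eq_add_neg,
      add_right_inj] at h
    have hds : d = s := nsmul_injOn_Iio_addOrderOf hd (show s < addOrderOf (b - a) by omega) h
    rw [hcount, hds, add_comm]
  · obtain ⟨w, hw, hw0, hw1, hw2⟩ := hu.reorder hab hgen K g hK
    refine ⟨w, hw, hw0, hw1, fun j hj hjm => ?_⟩
    obtain ⟨h1, h2⟩ := hw2 j hj hjm
    obtain ⟨e, he, hue⟩ := (hu.mod_eq_iff_exists (by omega)).1 hjm
    obtain ⟨hed, hiff⟩ := hspec e he j hj hue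
    refine ⟨e, he, ?_, hed, h2.trans hiff⟩
    rw [h1, hue]
    abel

/-- Equal vertices of two paths, the second starting one `a`-step later, have shifted positions. -/
lemma mod_eq_mod_succ {w w' : ℕ → G} (hw : IsHamSeq a b w) (hw' : IsHamSeq a b w')
    (h0 : w' 0 = w 0 + a) {j l : ℕ} (hj : j < Fintype.card G) (hl : l < Fintype.card G)
    (h : w j = w' l) :
    j % numCosets a b =
      if l % numCosets a b = numCosets a b - 1 then 0 else l % numCosets a b + 1 := by
  have hm : 0 < numCosets a b := numCosets_pos
  have hmod : j ≡ l + 1 [MOD numCosets a b] := by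
    rw [← mk_add_nsmul_eq_iff (w 0), ← hw.mk_eq hj, h, hw'.mk_eq hl, h0, add_nsmul, one_nsmul,
      add_assoc, add_comm a]
  have hlt := Nat.mod_lt l hm
  rw [hmod, ← Nat.mod_add_mod]
  split_ifs with hs
  · rw [hs, Nat.sub_add_cancel hm, Nat.mod_self]
  · exact Nat.mod_eq_of_lt (by omega)

open scoped Classical in
lemma exists_arcDisjoint (hab : a ≠ b) (hgen : AddSubgroup.closure {a, b} = ⊤) {u' : ℕ → G}
    (hu : IsHamSeq a b u) (hu' : IsHamSeq a b u')
    (hle : Nat.count (fun l => u (l + 1) = u l + b) (Fintype.card G - 1) +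
      Nat.count (fun l => u' (l + 1) = u' l + b) (Fintype.card G - 1) ≤ Fintype.card G)
    (hge : Fintype.card G ≤ Nat.count (fun l => u (l + 1) = u l + b) (Fintype.card G - 1) +
      Nat.count (fun l => u' (l + 1) = u' l + b) (Fintype.card G - 1) + 2) :
    ∃ w w', IsHamSeq a b w ∧ IsHamSeq a b w' ∧
      ∀ j l, j + 1 < Fintype.card G → l + 1 < Fintype.card G → w j = w' l →
        w (j + 1) ≠ w' (l + 1) := by
  obtain ⟨k, d, hk, hd, hc, hshape⟩ := hu.exists_shape hab hgen
  obtain ⟨k', d', hk', hd', hc', hshape'⟩ := hu'.exists_shape hab hgen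
  have hm : 0 < numCosets a b := numCosets_pos
  have hn2 : 2 ≤ addOrderOf (b - a) := by
    have h1 : 0 < addOrderOf (b - a) := addOrderOf_pos _
    have h2 : addOrderOf (b - a) ≠ 1 := by
      rw [Ne, AddMonoid.addOrderOf_eq_one_iff, sub_eq_zero]
      exact hab.symm
    omega
  have hcases : (k + k' = numCosets a b ∧ d = 0 ∧ d' = 0) ∨
      (k + k' + 1 = numCosets a b ∧ d + d' ≤ addOrderOf (b - a) ∧
        addOrderOf (b - a) ≤ d + d' + 2) ∨
      (k + k' + 2 = numCosets a b ∧ d + 1 = addOrderOf (b - a) ∧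
        d' + 1 = addOrderOf (b - a)) := by
    rw [hc, hc', ← numCosets_mul_addOrderOf hgen] at hle hge
    clear hshape hshape' hc hc'
    generalize numCosets a b = m at *
    generalize addOrderOf (b - a) = n at *
    have hp1 : k + k' ≤ m := by
      by_contra hcon
      have := Nat.mul_le_mul_left n (show m + 1 ≤ k + k' by omega)
      nlinarith
    have hp2 : m ≤ k + k' + 2 := by
      by_contra hcon
      have := Nat.mul_le_mul_left n (show k + k' + 3 ≤ m by omega)
      nlinarith
    obtain rfl | rfl | rfl : m = k + k' ∨ m = k + k' + 1 ∨ m = k + k' + 2 := by omega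
    · refine Or.inl ⟨rfl, ?_⟩
      have : (k + k') * n = n * k + n * k' := by ring
      omega
    · refine Or.inr (Or.inl ⟨rfl, ?_⟩)
      have : (k + k' + 1) * n = n * k + n * k' + n := by ring
      omega
    · refine Or.inr (Or.inr ⟨rfl, ?_⟩)
      have : (k + k' + 2) * n = n * k + n * k' + 2 * n := by ring
      omega
  rcases hcases with ⟨hkk, rfl, rfl⟩ | ⟨hkk, hdd⟩ | ⟨hkk, hdn, hdn'⟩
  · obtain ⟨w, hw, hw0, hw1, hw2⟩ := hshape (fun r => 0 ≤ r ∧ r < k) 0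
      (by rw [count_le_and_lt]; omega)
    obtain ⟨w', hw', hw0', hw1', hw2'⟩ :=
      hshape' (fun r => k - 1 ≤ r ∧ r < numCosets a b) a (by rw [count_le_and_lt]; omega)
    refine ⟨w, w', hw, hw', fun j l hj hl h h' => ?_⟩
    have hiff : w (j + 1) = w j + b ↔ w' (l + 1) = w' l + b := by rw [h, h']
    have hmod := hw.mod_eq_mod_succ hw' (hw0'.trans (by rw [hw0, zero_add])) (by omega) (by omega) h
    have hjlt := Nat.mod_lt j hm
    have hllt := Nat.mod_lt l hm
    by_cases hjm : j % numCosets a b = numCosets a b - 1 <;>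
      by_cases hlm : l % numCosets a b = numCosets a b - 1
    · rw [if_pos hlm] at hmod
      omega
    · obtain ⟨e, he, -, hed, hwe⟩ := hw2 j hj hjm
      rw [hwe, hw1' l hl hlm] at hiff
      rw [if_neg hlm] at hmod
      omega
    · obtain ⟨e, he, -, hed, hwe⟩ := hw2' l hl hlm
      rw [hwe, hw1 j hj hjm] at hiff
      rw [if_pos hlm] at hmod
      omega
    · rw [hw1 j hj hjm, hw1' l hl hlm] at hiff
      rw [if_neg hlm] at hmod
      omega
  · obtain ⟨s, hs⟩ : ∃ s, (s = d ∧ d + d' = addOrderOf (b - a)) ∨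
        (s = d + 1 ∧ d + d' < addOrderOf (b - a)) := by
      rcases hdd.1.eq_or_lt with h | h
      · exact ⟨d, Or.inl ⟨rfl, h⟩⟩
      · exact ⟨d + 1, Or.inr ⟨rfl, h⟩⟩
    obtain ⟨w, hw, hw0, hw1, hw2⟩ := hshape (fun r => 0 ≤ r ∧ r < k) 0
      (by rw [count_le_and_lt]; omega)
    obtain ⟨w', hw', hw0', hw1', hw2'⟩ :=
      hshape' (fun r => k ≤ r ∧ r < numCosets a b) (s • (b - a)) (by rw [count_le_and_lt]; omega)
    refine ⟨w, w', hw, hw', fun j l hj hl h h' => ?_⟩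
    have hiff : w (j + 1) = w j + b ↔ w' (l + 1) = w' l + b := by rw [h, h']
    have hmod : j % numCosets a b = l % numCosets a b := by
      rw [← Nat.ModEq, ← mk_add_nsmul_eq_iff (w 0), ← hw.mk_eq (by omega), h,
        hw'.mk_eq (by omega), hw0, hw0', QuotientAddGroup.eq, AddSubgroup.mem_zmultiples_iff]
      exact ⟨-s, by rw [neg_zsmul, natCast_zsmul]; abel⟩
    have hllt := Nat.mod_lt l hm
    by_cases hjm : j % numCosets a b = numCosets a b - 1
    · obtain ⟨e, he, hwj, hed, hwe⟩ := hw2 j hj hjm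
      obtain ⟨e', he', hwl, hed', hwe'⟩ := hw2' l hl (hmod ▸ hjm)
      rw [hwe, hwe'] at hiff
      have heq : e • (b - a) = (s + e') • (b - a) := by
        rw [hwj, hwl] at h
        rw [add_nsmul, ← sub_eq_zero]
        rw [← sub_eq_zero] at h
        rw [← h]
        abel
      rw [nsmul_eq_nsmul_iff_modEq, Nat.ModEq, Nat.mod_eq_of_lt he] at heq
      have hsd := Nat.mod_add_div (s + e') (addOrderOf (b - a))
      rw [← heq] at hsd
      have hq : (s + e') / addOrderOf (b - a) < 2 :=
        Nat.div_lt_of_lt_mul (by omega)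
      generalize (s + e') / addOrderOf (b - a) = q at *
      interval_cases q <;> omega
    · rw [hw1 j hj hjm, hw1' l hl (hmod ▸ hjm)] at hiff
      omega
  · obtain ⟨w, hw, hw0, hw1, hw2⟩ := hshape (fun r => 1 ≤ r ∧ r < k + 1) 0
      (by rw [count_le_and_lt]; omega)
    obtain ⟨w', hw', hw0', hw1', hw2'⟩ :=
      hshape' (fun r => k ≤ r ∧ r < numCosets a b - 2) a (by rw [count_le_and_lt]; omega)
    refine ⟨w, w', hw, hw', fun j l hj hl h h' => ?_⟩
    have hiff : w (j + 1) = w j + b ↔ w' (l + 1) = w' l + b := by rw [h, h']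
    have hmod := hw.mod_eq_mod_succ hw' (hw0'.trans (by rw [hw0, zero_add])) (by omega) (by omega) h
    have hjlt := Nat.mod_lt j hm
    have hllt := Nat.mod_lt l hm
    by_cases hjm : j % numCosets a b = numCosets a b - 1 <;>
      by_cases hlm : l % numCosets a b = numCosets a b - 1
    · rw [if_pos hlm] at hmod
      omega
    · obtain ⟨e, he, -, hed, hwe⟩ := hw2 j hj hjm
      rw [hwe, hw1' l hl hlm] at hiff
      rw [if_neg hlm] at hmod
      omega
    · obtain ⟨e, he, -, hed, hwe⟩ := hw2' l hl hlm
      rw [hwe, hw1 j hj hjm] at hiff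
      rw [if_pos hlm] at hmod
      omega
    · rw [hw1 j hj hjm, hw1' l hl hlm] at hiff
      rw [if_neg hlm] at hmod
      omega

end IsHamSeq

namespace IsHamSeq

open scoped Classical in
lemma count_add_count (hab : a ≠ b) (hu : IsHamSeq a b u) {j : ℕ} (hj : j < Fintype.card G) :
    Nat.count (fun l => u (l + 1) = u l + a) j + Nat.count (fun l => u (l + 1) = u l + b) j =
      j := by
  induction j with
  | zero => simp
  | succ j ih =>
    have := ih (by omega)
    rw [Nat.count_succ, Nat.count_succ]
    rcases hu.step j hj with h | h
    · rw [if_pos h, if_neg (by rw [h, add_right_inj]; exact hab)]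
      omega
    · rw [if_pos h, if_neg (by rw [h, add_right_inj]; exact hab.symm)]
      omega

lemma isHamPath (hu : IsHamSeq a b u) :
    IsHamPath a b (Fintype.card G) fun i : Fin (Fintype.card G) => u i := by
  refine ⟨(Fintype.bijective_iff_injective_and_card _).2
    ⟨fun i j h => Fin.ext (hu.inj _ _ i.2 j.2 h), Fintype.card_fin _⟩, fun i h => ?_⟩
  rcases hu.step i h with h | h <;> simp [h]

end IsHamSeq

lemma IsHamPath.exists_isHamSeq {v : Fin (Fintype.card G) → G}
    (hv : IsHamPath a b (Fintype.card G) v) :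
    ∃ u, IsHamSeq a b u ∧ ∀ i : Fin (Fintype.card G), u i = v i := by
  obtain ⟨u, hu⟩ : ∃ u : ℕ → G, ∀ i : Fin (Fintype.card G), u i = v i :=
    ⟨fun i => if h : i < Fintype.card G then v ⟨i, h⟩ else 0, fun i => by simp⟩
  refine ⟨u, ⟨fun j l hj hl h => ?_, fun j hj => ?_⟩, hu⟩
  · have := hv.1.1 ((hu ⟨j, hj⟩).symm.trans (h.trans (hu ⟨l, hl⟩)))
    simpa using this
  · have h := hv.2 j hj
    rw [← hu, ← hu] at h
    rcases h with h | h
    · exact Or.inl (by rw [← h]; simp)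
    · exact Or.inr (by rw [← Set.mem_singleton_iff.1 h]; simp)

end HamiltonianSequences

/-- If `Cay(G; a, b)` has hamiltonian paths `P`, `P'` with `|δ_b(P) − δ_a(P')| ≤ 1`,
then it has two arc-disjoint hamiltonian paths. -/
theorem arc_disjoint_of_close_delta {G : Type*} [AddCommGroup G] [Fintype G] (a b : G)
    (hab : a ≠ b) (hgen : AddSubgroup.closure {a, b} = ⊤)
    (v v' : Fin (Fintype.card G) → G)
    (hv : IsHamPath a b (Fintype.card G) v) (hv' : IsHamPath a b (Fintype.card G) v')
    (hd : |(delta (Fintype.card G) v b : ℤ) - (delta (Fintype.card G) v' a : ℤ)| ≤ 1) :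
    ∃ w w' : Fin (Fintype.card G) → G,
      IsHamPath a b (Fintype.card G) w ∧ IsHamPath a b (Fintype.card G) w' ∧
      Disjoint (ArcSet (Fintype.card G) w) (ArcSet (Fintype.card G) w') := by
  classical
  obtain ⟨u, hu, huv⟩ := hv.exists_isHamSeq
  obtain ⟨u', hu', huv'⟩ := hv'.exists_isHamSeq
  have hN : 0 < Fintype.card G := Fintype.card_pos
  have hcount := hu'.count_add_count hab (Nat.sub_lt hN Nat.one_pos)
  rw [delta_eq_count huv, delta_eq_count huv', abs_le] at hd
  obtain ⟨w, w', hw, hw', hdisj⟩ := hu.exists_arcDisjoint hab hgen hu'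
    (by clear * - hd hcount hN; omega) (by clear * - hd hcount hN; omega)
  refine ⟨fun i => w i, fun i => w' i, hw.isHamPath, hw'.isHamPath, ?_⟩
  rw [Set.disjoint_left]
  rintro _ ⟨j, hj, rfl⟩ ⟨l, hl, h⟩
  rw [Prod.mk.injEq] at h
  exact hdisj j l hj hl h.1 h.2
end
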